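/- Fix a number field k and a finite set S of places of k, each either a nonzero prime ideal of O_k or a real embedding of k, and for each v \in S fix a behavior P_v: for a finite prime v, P_v is one of 'v ramifies in L', 'v splits in L', 'v is inert in L'; for a real embedding v, P_v is one of 'v ramifies in L', 'v splits in L'. For a property P of quadratic extensions L of k, set Prob(P) = lim_{x\to\infty} (#{quadratic extensions L of k with P and |\Delta_{L/k}| \le x}) / (#{quadratic extensions L of k with |\Delta_{L/k}| \le x}), when the limit exists. Then: (i) Prob(P_v) exists for each v \in S; (ii) Prob(all P_v, v \in S, hold simultaneously) exists and equals \prod_{v \in S} Prob(P_v); (iii) for each real embedding v, Prob(v ramifies) = Prob(v splits) = 1/2; (iv) for each finite prime v, Prob(v splits) = Prob(v is inert) = (1 - Prob(v ramifies))/2. -/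

import Mathlib

open NumberField Filter Topology
open scoped Classical

noncomputable section

variable (k : Type*) [Field k] [NumberField k]

/-- The absolute value of the discriminant of a number field (junk value `0` if the
field is not finite over `ℚ`). -/
def absDisc (L : Type*) [Field L] [CharZero L] : ℕ :=
  if h : FiniteDimensional ℚ L then
    letI : NumberField L := @NumberField.mk L _ inferInstance h
    (NumberField.discr L).natAbs
  else 0

/-- The absolute norm `|Δ_{L/k}|` of the relative discriminant of `L/k`, computed as
`d_L / d_k²`. -/
def relDiscNorm (L : IntermediateField k (AlgebraicClosure k)) : ℝ :=
  (absDisc L : ℝ) / ((NumberField.discr k).natAbs : ℝ) ^ 2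

/-- The number of quadratic extensions of `k` (inside a fixed algebraic closure;
quadratic extensions are Galois, so this is the same as counting them up to
`k`-isomorphism) satisfying `P` and with `|Δ_{L/k}| ≤ x`. -/
def quadCount (P : IntermediateField k (AlgebraicClosure k) → Prop) (x : ℝ) : ℕ :=
  Nat.card {L : IntermediateField k (AlgebraicClosure k) //
    Module.finrank k L = 2 ∧ P L ∧ relDiscNorm k L ≤ x}

/-- A finite prime `p` of `k` splits in `L` if `p O_L` is a product of two distinct
primes. -/
def SplitsIn (p : Ideal (𝓞 k)) (L : IntermediateField k (AlgebraicClosure k)) : Prop :=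
  ∃ P Q : Ideal (𝓞 L), P ≠ Q ∧ P.IsPrime ∧ Q.IsPrime ∧
    Ideal.map (algebraMap (𝓞 k) (𝓞 L)) p = P * Q

/-- A finite prime `p` of `k` is inert in `L` if `p O_L` is prime. -/
def InertIn (p : Ideal (𝓞 k)) (L : IntermediateField k (AlgebraicClosure k)) : Prop :=
  (Ideal.map (algebraMap (𝓞 k) (𝓞 L)) p).IsPrime

/-- A finite prime `p` of `k` ramifies in `L` if `p O_L = P²` for a prime `P`. -/
def RamifiesIn (p : Ideal (𝓞 k)) (L : IntermediateField k (AlgebraicClosure k)) : Prop :=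
  ∃ P : Ideal (𝓞 L), P.IsPrime ∧ Ideal.map (algebraMap (𝓞 k) (𝓞 L)) p = P ^ 2

/-- A real embedding `σ` of `k` splits in `L` if it extends to a real embedding of
`L`. -/
def RealSplitsIn (σ : k →+* ℝ) (L : IntermediateField k (AlgebraicClosure k)) : Prop :=
  ∃ τ : L →+* ℝ, τ.comp (algebraMap k L) = σ

/-- A real embedding `σ` of `k` ramifies in `L` if it has no real extension to `L`. -/
def RealRamifiesIn (σ : k →+* ℝ) (L : IntermediateField k (AlgebraicClosure k)) : Prop :=
  ¬ RealSplitsIn k σ L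

/-- Possible prescribed behaviors at a finite prime. -/
inductive FiniteBehavior : Type | ramified | split | inert

/-- Possible prescribed behaviors at a real embedding. -/
inductive RealBehavior : Type | ramified | split

/-- The property of a quadratic extension prescribed by a finite behavior. -/
def FiniteBehavior.holds (b : FiniteBehavior) (p : Ideal (𝓞 k))
    (L : IntermediateField k (AlgebraicClosure k)) : Prop :=
  match b with
  | .ramified => RamifiesIn k p L
  | .split => SplitsIn k p L
  | .inert => InertIn k p L

/-- The property of a quadratic extension prescribed by a real behavior. -/
def RealBehavior.holds (b : RealBehavior) (σ : k →+* ℝ)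
    (L : IntermediateField k (AlgebraicClosure k)) : Prop :=
  match b with
  | .ramified => RealRamifiesIn k σ L
  | .split => RealSplitsIn k σ L

/-- `HasProb k P c` says that the natural density (ordering quadratic extensions of `k`
by `|Δ_{L/k}|`) of quadratic extensions satisfying `P` exists and equals `c`. -/
def HasProb (P : IntermediateField k (AlgebraicClosure k) → Prop) (c : ℝ) : Prop :=
  Filter.Tendsto
    (fun x : ℝ => (quadCount k P x : ℝ) / (quadCount k (fun _ => True) x : ℝ))
    atTop (𝓝 c)

section LatticeCosets

open MeasureTheory Metric Module
open scoped Pointwise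

variable {E : Type*} [NormedAddCommGroup E] [NormedSpace ℝ E] [FiniteDimensional ℝ E]
  (Λ : Submodule ℤ E) [DiscreteTopology Λ]

/-- A bounded measurable set whose translates by a lattice tile the space. -/
theorem exists_bounded_tile [IsZLattice ℝ Λ] [MeasurableSpace E] [BorelSpace E] (μ : Measure E)
    [μ.IsAddHaarMeasure] :
    ∃ (F : Set E) (R : ℝ), MeasurableSet F ∧ 0 < R ∧ (∀ x ∈ F, ‖x‖ ≤ R) ∧
      (∀ y : E, ∃! x : E, x ∈ Λ ∧ y - x ∈ F) ∧ μ F = ENNReal.ofReal (ZLattice.covolume Λ μ) := by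
  let b := (Module.Free.chooseBasis ℤ Λ).ofZLatticeBasis ℝ
  have hb : Submodule.span ℤ (Set.range b) = Λ :=
    (Module.Free.chooseBasis ℤ Λ).ofZLatticeBasis_span ℝ Λ
  obtain ⟨R, hR⟩ := (ZSpan.fundamentalDomain_isBounded b).exists_norm_le
  have hfd := ZLattice.isAddFundamentalDomain (Module.Free.chooseBasis ℤ Λ) μ
  refine ⟨ZSpan.fundamentalDomain b, max R 1, ZSpan.fundamentalDomain_measurableSet b,
    by positivity, fun x hx => (hR x hx).trans (le_max_left _ _), fun y => ?_, ?_⟩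
  · obtain ⟨v, hv, hu⟩ := ZSpan.exist_unique_vadd_mem_fundamentalDomain b y
    refine ⟨-(v : E), ⟨Λ.neg_mem (hb.le v.2), ?_⟩, ?_⟩
    · rw [Submodule.vadd_def, vadd_eq_add, add_comm] at hv
      simpa using hv
    · rintro x ⟨hx, hyx⟩
      have := hu ⟨-x, hb.ge (Λ.neg_mem hx)⟩ (by
        change -x + y ∈ _
        rwa [add_comm, ← sub_eq_add_neg])
      rw [← this]; simp
  · have h := ZLattice.covolume_eq_measure_fundamentalDomain Λ μ hfd
    rw [h, Measure.real, ENNReal.ofReal_toReal]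
    exact (ZSpan.fundamentalDomain_isBounded b).measure_lt_top.ne

theorem finite_coset_inter (v : E) {D : Set E} (hD : Bornology.IsBounded D) :
    {x : E | x - v ∈ Λ ∧ x ∈ D}.Finite := by
  have hfin : ((Λ : Set E) ∩ ((fun x => x - v) '' D)).Finite := by
    rw [Set.inter_comm]
    have : DiscreteTopology (Λ : Set E) := inferInstanceAs (DiscreteTopology Λ)
    have hc : IsClosed (Λ : Set E) := @AddSubgroup.isClosed_of_discrete _ _ _ _ _
      Λ.toAddSubgroup (inferInstanceAs (DiscreteTopology Λ))
    refine Metric.finite_isBounded_inter_isClosed DiscreteTopology.isDiscrete ?_ hc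
    obtain ⟨C, hC⟩ := hD.exists_norm_le
    refine isBounded_iff_forall_norm_le.2 ⟨C + ‖v‖, ?_⟩
    rintro _ ⟨x, hx, rfl⟩
    exact (norm_sub_le _ _).trans (by gcongr; exact hC x hx)
  refine (hfin.preimage (f := fun x => x - v) (fun _ _ _ _ h => sub_left_injective h)).subset ?_
  rintro x ⟨h1, h2⟩
  exact ⟨h1, x, h2, rfl⟩

variable [IsZLattice ℝ Λ] [MeasurableSpace E] [BorelSpace E] (μ : Measure E) [μ.IsAddHaarMeasure]

theorem tendsto_card_coset_div_pow (v : E) {D : Set E} (hD : Bornology.IsBounded D)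
    (hDm : MeasurableSet D) (hDf : μ (frontier D) = 0) :
    Tendsto (fun t : ℝ => (Nat.card {x : E | x - v ∈ Λ ∧ t⁻¹ • x ∈ D} : ℝ) / t ^ finrank ℝ E)
      atTop (𝓝 (μ.real D / ZLattice.covolume Λ μ)) := by
  obtain ⟨F, R, hFm, hR, hFR, hFu, hFμ⟩ := exists_bounded_tile Λ μ
  set c := ZLattice.covolume Λ μ with hc
  have hcpos : 0 < c := ZLattice.covolume_pos Λ μ
  set n := finrank ℝ E
  have hfinP : ∀ t : ℝ, 0 < t → {x : E | x - v ∈ Λ ∧ t⁻¹ • x ∈ D}.Finite := fun t ht => by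
    have := finite_coset_inter Λ v (hD.smul₀ t)
    refine this.subset ?_
    rintro x ⟨h1, h2⟩
    exact ⟨h1, (Set.mem_smul_set_iff_inv_smul_mem₀ ht.ne' _ _).2 h2⟩
  -- the union of the tiles attached to the points of the coset
  let U : ℝ → Set E := fun t => ⋃ x ∈ {x : E | x - v ∈ Λ ∧ t⁻¹ • x ∈ D}, (fun y => y - x) ⁻¹' F
  have hU : ∀ t, 0 < t → μ.real (U t) = Nat.card {x : E | x - v ∈ Λ ∧ t⁻¹ • x ∈ D} * c := by
    intro t ht
    have : μ (U t) = ∑ x ∈ (hfinP t ht).toFinset, μ ((fun y => y - x) ⁻¹' F) := by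
      rw [← measure_biUnion_finset]
      · congr 1; ext y; simp [U]
      · intro x hx x' hx' hne
        refine Set.disjoint_left.2 fun y hy hy' => hne ?_
        simp only [Set.Finite.coe_toFinset, Set.mem_ofPred_eq] at hx hx'
        have := (hFu (y - v)).unique ⟨hx.1, by simpa using hy⟩ ⟨hx'.1, by simpa using hy'⟩
        simpa using this
      · intro x _
        exact (measurable_id.sub_const x) hFm
    have h2 : ∀ x : E, μ ((fun y => y - x) ⁻¹' F) = ENNReal.ofReal c := fun x => by
      simp only [sub_eq_add_neg]
      rw [measure_preimage_add_right, hFμ]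
    simp only [h2, Finset.sum_const, nsmul_eq_mul] at this
    rw [Measure.real, this, ENNReal.toReal_mul, ENNReal.toReal_ofReal hcpos.le,
      Nat.card_eq_card_finite_toFinset (hfinP t ht)]
    simp
  have hUp : ∀ t, 0 < t → U t ⊆ t • cthickening (R / t) D := by
    intro t ht y hy
    simp only [U, Set.mem_iUnion, Set.mem_preimage] at hy
    obtain ⟨x, ⟨hx1, hx2⟩, hyx⟩ := hy
    rw [Set.mem_smul_set_iff_inv_smul_mem₀ ht.ne']
    refine mem_cthickening_of_dist_le _ _ _ _ hx2 ?_
    rw [dist_eq_norm, ← smul_sub, norm_smul, norm_inv, Real.norm_of_nonneg ht.le, div_eq_inv_mul]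
    exact mul_le_mul_of_nonneg_left (hFR _ hyx) (by positivity)
  have hLo : ∀ t, 0 < t → t • (D \ cthickening (R / t) Dᶜ) ⊆ U t := by
    intro t ht y hy
    rw [Set.mem_smul_set_iff_inv_smul_mem₀ ht.ne'] at hy
    obtain ⟨x, ⟨hx1, hx2⟩, -⟩ := hFu (y - v)
    simp only [U, Set.mem_iUnion, Set.mem_preimage]
    refine ⟨x + v, ⟨by simpa using hx1, ?_⟩, by simpa [sub_sub, add_comm] using hx2⟩
    by_contra hcon
    refine hy.2 (mem_cthickening_of_dist_le _ _ _ _ (Set.mem_compl hcon) ?_)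
    rw [dist_eq_norm, ← smul_sub, norm_smul, norm_inv, Real.norm_of_nonneg ht.le, div_eq_inv_mul]
    refine mul_le_mul_of_nonneg_left (hFR _ ?_) (by positivity)
    simpa [sub_sub, add_comm] using hx2
  have hscale : ∀ (t : ℝ) (A : Set E), 0 < t → μ.real (t • A) = t ^ n * μ.real A := by
    intro t A ht
    rw [Measure.real, Measure.addHaar_smul, ENNReal.toReal_mul, Measure.real,
      ENNReal.toReal_ofReal (by positivity), abs_of_pos (by positivity)]
  have htend : Tendsto (fun t : ℝ => R / t) atTop (𝓝 0) := tendsto_const_nhds.div_atTop tendsto_id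
  have hbd : ∀ r, μ (cthickening r D) ≠ ⊤ := fun r => (hD.cthickening).measure_lt_top.ne
  have h_up : Tendsto (fun t : ℝ => μ.real (cthickening (R / t) D)) atTop (𝓝 (μ.real D)) := by
    have h1 := (tendsto_measure_cthickening (μ := μ) (s := D) ⟨1, one_pos, hbd 1⟩).comp htend
    have h2 : μ (closure D) = μ D := by
      refine le_antisymm ?_ (measure_mono subset_closure)
      rw [closure_eq_self_union_frontier]
      exact (measure_union_le _ _).trans (by rw [hDf, add_zero])
    rw [h2] at h1
    exact (ENNReal.tendsto_toReal hD.measure_lt_top.ne).comp h1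
  have h_lo : Tendsto (fun t : ℝ => μ.real (D \ cthickening (R / t) Dᶜ)) atTop
      (𝓝 (μ.real D)) := by
    have hfinD : IsFiniteMeasure (μ.restrict D) := ⟨by
      rw [Measure.restrict_apply_univ]; exact hD.measure_lt_top⟩
    have h1 := (tendsto_measure_cthickening (μ := μ.restrict D) (s := Dᶜ)
      ⟨1, one_pos, measure_ne_top _ _⟩).comp htend
    have h0 : μ.restrict D (closure Dᶜ) = 0 := by
      rw [Measure.restrict_apply isClosed_closure.measurableSet]
      refine measure_mono_null ?_ hDf
      rintro x ⟨h, h'⟩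
      rw [frontier_eq_closure_inter_closure]
      exact ⟨subset_closure h', h⟩
    rw [h0] at h1
    have h2 := (ENNReal.tendsto_toReal ENNReal.zero_ne_top).comp h1
    have h3 := (tendsto_const_nhds (x := μ.real D)).sub h2
    simp only [ENNReal.toReal_zero, sub_zero] at h3
    refine h3.congr fun t => ?_
    simp only [Function.comp]
    rw [Measure.restrict_apply isClosed_cthickening.measurableSet, Measure.real, Measure.real,
      ← Set.sdiff_inter_self_eq_sdiff, measure_sdiff Set.inter_subset_right
        ((isClosed_cthickening.measurableSet.inter hDm).nullMeasurableSet)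
        ((measure_mono Set.inter_subset_right).trans_lt hD.measure_lt_top).ne,
      ENNReal.toReal_sub_of_le (measure_mono Set.inter_subset_right) hD.measure_lt_top.ne]
  refine tendsto_of_tendsto_of_tendsto_of_le_of_le' (h_lo.div_const c) (h_up.div_const c) ?_ ?_
  · filter_upwards [eventually_gt_atTop 0] with t ht
    have hfinU : μ (U t) ≠ ⊤ := by
      refine ((measure_mono (hUp t ht)).trans_lt ?_).ne
      exact (hD.cthickening.smul₀ t).measure_lt_top
    have := measureReal_mono (hLo t ht) hfinU
    rw [hscale t _ ht, hU t ht] at this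
    rw [div_le_div_iff₀ hcpos (by positivity)]
    linarith
  · filter_upwards [eventually_gt_atTop 0] with t ht
    have := measureReal_mono (μ := μ) (hUp t ht) (hD.cthickening.smul₀ t).measure_lt_top.ne
    rw [hscale t _ ht, hU t ht] at this
    rw [div_le_div_iff₀ (by positivity) hcpos]
    linarith

end LatticeCosets

section ConeCounting

open scoped nonZeroDivisors Pointwise
open MeasureTheory Module NumberField.Units NumberField.mixedEmbedding NumberField.mixedEmbedding.fundamentalCone

variable (K : Type*) [Field K] [NumberField K]

/-- The number of integers in the fundamental cone of norm at most `X` satisfying `P`. -/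
def coneCount (P : 𝓞 K → Prop) (X : ℝ) : ℕ :=
  Nat.card {a : 𝓞 K // mixedEmbedding K a ∈ fundamentalCone K ∧ P a ∧
    (Ideal.absNorm (Ideal.span {a}) : ℝ) ≤ X}

theorem norm_mixedEmbedding_int (a : 𝓞 K) :
    mixedEmbedding.norm (mixedEmbedding K a) = Ideal.absNorm (Ideal.span {a}) := by
  rw [mixedEmbedding.norm_eq_norm, Ideal.absNorm_span_singleton, ← Algebra.coe_norm_int]
  push_cast [Nat.cast_natAbs]
  simp

theorem inv_smul_mem_normLeOne_iff {t : ℝ} (ht : 0 < t) (x : mixedSpace K) :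
    t⁻¹ • x ∈ normLeOne K ↔ x ∈ fundamentalCone K ∧ mixedEmbedding.norm x ≤ t ^ finrank ℚ K := by
  rw [mem_normLeOne, smul_mem_iff_mem (inv_ne_zero ht.ne'), mixedEmbedding.norm_smul,
    abs_of_pos (inv_pos.2 ht), inv_pow, inv_mul_le_iff₀ (by positivity), mul_one]

theorem mem_normLeOne_iff_abs (x : mixedSpace K) :
    x ∈ normLeOne K ↔ (fun w ↦ ‖x.1 w‖, x.2) ∈ normLeOne K := by
  have h : normAtAllPlaces x = normAtAllPlaces ((fun w ↦ ‖x.1 w‖, x.2) : mixedSpace K) := by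
    ext w
    simp only [normAtAllPlaces_apply]
    obtain hw | hw := InfinitePlace.isReal_or_isComplex w
    · simp [normAtPlace_apply_of_isReal hw]
    · simp [normAtPlace_apply_of_isComplex hw]
  rw [normLeOne_eq_preimage_image, Set.mem_preimage, Set.mem_preimage, h]

theorem isReal_apply_ne_zero_of_mem_cone {x : mixedSpace K} (hx : x ∈ fundamentalCone K)
    (w : {w : InfinitePlace K // w.IsReal}) : x.1 w ≠ 0 := by
  have := normAtPlace_pos_of_mem hx w.1
  rw [normAtPlace_apply_of_isReal w.2] at this
  exact norm_pos_iff.1 this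

theorem mem_negAt_plusPart_normLeOne_iff (s : Set {w : InfinitePlace K // w.IsReal})
    (x : mixedSpace K) :
    x ∈ negAt s '' (plusPart (normLeOne K)) ↔ x ∈ normLeOne K ∧ signSet x = s := by
  constructor
  · intro h
    have h1 : x ∈ normLeOne K := by
      obtain ⟨y, ⟨hy, -⟩, rfl⟩ := h
      rw [mem_normLeOne] at hy ⊢
      refine ⟨mem_of_normAtPlace_eq hy.1 fun w => normAtPlace_negAt s _ w, ?_⟩
      rw [norm_negAt]; exact hy.2
    refine ⟨h1, ?_⟩
    ext w
    refine ⟨fun hw => by_contra fun hws => ?_, fun hw => ?_⟩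
    · exact absurd (pos_of_notMem_negAt_plusPart _ h hws) (not_lt.2 hw)
    · exact (neg_of_mem_negA_plusPart _ h hw).le
  · rintro ⟨h, rfl⟩
    have hne := isReal_apply_ne_zero_of_mem_cone K (mem_normLeOne.1 h).1
    rw [mem_negAt_plusPart_of_mem _ (mem_normLeOne_iff_abs K) h hne]
    exact ⟨fun w hw => lt_of_le_of_ne hw (hne w), fun w hw => not_le.1 hw⟩

theorem volume_frontier_negAt_plusPart_normLeOne (s : Set {w : InfinitePlace K // w.IsReal}) :
    volume (frontier (negAt s '' (plusPart (normLeOne K)))) = 0 := by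
  have h0 : volume (frontier (plusPart (normLeOne K))) = 0 := by
    refine measure_mono_null (t := frontier (normLeOne K) ∪ ⋃ w, {x | x.1 w = 0}) ?_ ?_
    · have hopen : IsOpen {x : mixedSpace K | ∀ w, 0 < x.1 w} := by
        simp only [Set.ofPred_forall]
        exact isOpen_iInter_of_finite fun w => isOpen_lt continuous_const (by fun_prop)
      have hcl : closure {x : mixedSpace K | ∀ w, 0 < x.1 w} ⊆ {x | ∀ w, 0 ≤ x.1 w} := by
        refine closure_minimal (fun x hx w => (hx w).le) ?_
        simp only [Set.ofPred_forall]
        exact isClosed_iInter fun w => isClosed_le continuous_const (by fun_prop)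
      refine (frontier_inter_subset _ _).trans (Set.union_subset_union Set.inter_subset_left ?_)
      refine Set.inter_subset_right.trans fun x hx => ?_
      rw [hopen.frontier_eq] at hx
      have h1 := hcl hx.1
      have h2 := hx.2
      simp only [Set.mem_ofPred_eq, not_forall, not_lt] at h1 h2
      obtain ⟨w, hw⟩ := h2
      exact Set.mem_iUnion.2 ⟨w, le_antisymm hw (h1 w)⟩
    · exact measure_union_null (volume_frontier_normLeOne K)
        (measure_iUnion_null fun w => volume_eq_zero w)
  have h1 := (negAt s).toHomeomorph.image_frontier (plusPart (normLeOne K))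
  have h2 : frontier (negAt s '' (plusPart (normLeOne K))) =
      negAt s '' frontier (plusPart (normLeOne K)) := h1.symm
  rw [h2, ← negAt_preimage, volume_preserving_negAt.measure_preimage
    (NullMeasurableSet.of_null h0), h0]

/-- The fractional ideal unit attached to a nonzero integral ideal. -/
def idealUnit {J : Ideal (𝓞 K)} (hJ : J ≠ ⊥) : (FractionalIdeal (𝓞 K)⁰ K)ˣ :=
  FractionalIdeal.mk0 K ⟨J, mem_nonZeroDivisors_of_ne_zero hJ⟩

theorem mem_idealLattice_unit {J : Ideal (𝓞 K)} (hJ : J ≠ ⊥) (x : mixedSpace K) :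
    x ∈ idealLattice K (idealUnit K hJ) ↔ ∃ a ∈ J, mixedEmbedding K (a : 𝓞 K) = x := by
  rw [mem_idealLattice, idealUnit, FractionalIdeal.coe_mk0]
  simp

theorem coneCount_eq_card {J : Ideal (𝓞 K)} (hJ : J ≠ ⊥) (r : 𝓞 K)
    (s : Set {w : InfinitePlace K // w.IsReal}) {t : ℝ} (ht : 0 < t) :
    coneCount K (fun a => a - r ∈ J ∧ signSet (mixedEmbedding K a) = s) (t ^ finrank ℚ K) =
      Nat.card {x : mixedSpace K | x - mixedEmbedding K r ∈ idealLattice K (idealUnit K hJ) ∧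
        t⁻¹ • x ∈ negAt s '' (plusPart (normLeOne K))} := by
  have hsg : ∀ x : mixedSpace K, signSet (t⁻¹ • x) = signSet x := fun x => by
    ext w
    simp only [signSet, Set.mem_ofPred_eq, Prod.smul_fst, Pi.smul_apply, smul_eq_mul]
    constructor
    · intro h; by_contra h'; push Not at h'
      have := mul_pos (inv_pos.2 ht) h'; linarith
    · exact fun h => mul_nonpos_of_nonneg_of_nonpos (inv_pos.2 ht).le h
  refine Nat.card_congr (Equiv.ofBijective (fun a => ⟨mixedEmbedding K a.1, ?_, ?_⟩) ⟨?_, ?_⟩)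
  · rw [mem_idealLattice_unit]
    exact ⟨a.1 - r, a.2.2.1.1, by simp⟩
  · rw [mem_negAt_plusPart_normLeOne_iff, inv_smul_mem_normLeOne_iff K ht, hsg,
      norm_mixedEmbedding_int]
    exact ⟨⟨a.2.1, a.2.2.2⟩, a.2.2.1.2⟩
  · intro a b h
    exact Subtype.ext (RingOfIntegers.ext ((mixedEmbedding_injective K) (Subtype.ext_iff.1 h)))
  · rintro ⟨x, hx1, hx2⟩
    obtain ⟨a, ha, hax⟩ := (mem_idealLattice_unit K hJ _).1 hx1
    rw [mem_negAt_plusPart_normLeOne_iff, inv_smul_mem_normLeOne_iff K ht, hsg] at hx2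
    have hx : mixedEmbedding K ((a + r : 𝓞 K) : K) = x := by
      have h0 : ((a + r : 𝓞 K) : K) = (a : K) + r := map_add _ _ _
      rw [h0, map_add, hax]; abel
    refine ⟨⟨a + r, ?_, ⟨?_, ?_⟩, ?_⟩, Subtype.ext hx⟩
    · rw [hx]; exact hx2.1.1
    · simpa using ha
    · rw [hx]; exact hx2.2
    · rw [← norm_mixedEmbedding_int, hx]; exact hx2.1.2

theorem setOf_mem_cone_finite (X : ℝ) :
    {a : 𝓞 K | mixedEmbedding K a ∈ fundamentalCone K ∧
      (Ideal.absNorm (Ideal.span {a}) : ℝ) ≤ X}.Finite := by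
  have hn : finrank ℚ K ≠ 0 := finrank_pos.ne'
  set t : ℝ := (max X 1) ^ (finrank ℚ K : ℝ)⁻¹ with htdef
  have ht : 0 < t := by positivity
  have htn : t ^ finrank ℚ K = max X 1 := Real.rpow_inv_natCast_pow (by positivity) hn
  have hb : Bornology.IsBounded (t • normLeOne K) := (isBounded_normLeOne K).smul₀ t
  have hfin := finite_coset_inter (idealLattice K (idealUnit K (J := ⊤) top_ne_bot)) 0 hb
  refine (hfin.preimage (f := fun a : 𝓞 K => mixedEmbedding K (a : K)) ?_).subset ?_
  · intro a _ b _ h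
    exact RingOfIntegers.ext ((mixedEmbedding_injective K) h)
  · rintro a ⟨h1, h2⟩
    refine ⟨?_, ?_⟩
    · rw [sub_zero, mem_idealLattice_unit]
      exact ⟨a, trivial, rfl⟩
    · rw [Set.mem_smul_set_iff_inv_smul_mem₀ ht.ne', inv_smul_mem_normLeOne_iff K ht, htn,
        norm_mixedEmbedding_int]
      exact ⟨h1, h2.trans (le_max_left _ _)⟩

theorem tendsto_coneCount : ∃ V : ℝ, 0 < V ∧ ∀ (J : Ideal (𝓞 K)), J ≠ ⊥ → ∀ (r : 𝓞 K)
    (s : Set {w : InfinitePlace K // w.IsReal}),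
    Tendsto (fun X : ℝ => (coneCount K
      (fun a => a - r ∈ J ∧ signSet (mixedEmbedding K a) = s) X : ℝ) / X) atTop
      (𝓝 (V / Ideal.absNorm J)) := by
  have hn : finrank ℚ K ≠ 0 := finrank_pos.ne'
  set c : ℝ := (2⁻¹) ^ InfinitePlace.nrComplexPlaces K * √|discr K| with hc
  have hc0 : 0 < c := by
    have := discr_ne_zero K
    positivity
  have hvol := volume_eq_two_pow_mul_volume_plusPart (K := K)
    (mem_normLeOne_iff_abs K) (measurableSet_normLeOne K)
  have hvpos : 0 < volume (normLeOne K) := by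
    rw [volume_normLeOne]
    have h1 := ENNReal.ofReal_pos.2 (regulator_pos K)
    have h2 : (0 : ENNReal) < NNReal.pi := by exact_mod_cast NNReal.pi_pos
    have h3 : (0 : ENNReal) < 2 ^ InfinitePlace.nrRealPlaces K := by positivity
    exact ENNReal.mul_pos (ENNReal.mul_pos h3.ne' (ENNReal.pow_pos h2 _).ne').ne' h1.ne'
  have hplus : 0 < volume.real (plusPart (normLeOne K)) := by
    refine ENNReal.toReal_pos ?_ ?_
    · intro h; rw [h, mul_zero] at hvol; exact hvpos.ne' hvol
    · exact ((measure_mono Set.inter_subset_left).trans_lt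
        (isBounded_normLeOne K).measure_lt_top).ne
  refine ⟨volume.real (plusPart (normLeOne K)) / c, by positivity, fun J hJ r s => ?_⟩
  have hbd : Bornology.IsBounded (negAt s '' (plusPart (normLeOne K))) :=
    (isBounded_normLeOne K).subset fun x hx =>
      ((mem_negAt_plusPart_normLeOne_iff K s x).1 hx).1
  have h := tendsto_card_coset_div_pow (idealLattice K (idealUnit K hJ)) volume
    (mixedEmbedding K r) hbd (measurableSet_negAt_plusPart s _ (measurableSet_normLeOne K))
    (volume_frontier_negAt_plusPart_normLeOne K s)
  rw [mixedEmbedding.finrank, Measure.real, volume_negAt_plusPart (measurableSet_normLeOne K),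
    covolume_idealLattice] at h
  have h2 := h.comp (tendsto_rpow_atTop (y := (finrank ℚ K : ℝ)⁻¹) (by positivity))
  have hlim : (volume (plusPart (normLeOne K))).toReal / (FractionalIdeal.absNorm
      (idealUnit K hJ : FractionalIdeal (𝓞 K)⁰ K) * (2⁻¹) ^ InfinitePlace.nrComplexPlaces K *
        √|discr K|) = volume.real (plusPart (normLeOne K)) / c / Ideal.absNorm J := by
    rw [idealUnit, FractionalIdeal.coe_mk0, FractionalIdeal.coeIdeal_absNorm, div_div, hc,
      Measure.real]
    push_cast
    ring_nf
  rw [hlim] at h2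
  refine h2.congr' ?_
  filter_upwards [eventually_gt_atTop 0] with X hX
  have htn : (X ^ (finrank ℚ K : ℝ)⁻¹) ^ finrank ℚ K = X := Real.rpow_inv_natCast_pow hX.le hn
  simp only [Function.comp]
  rw [← coneCount_eq_card K hJ r s (by positivity), htn]

theorem card_ideal_le : ∃ C : ℝ, 0 < C ∧ ∀ X : ℝ, 0 < X →
    (Nat.card {I : (Ideal (𝓞 K))⁰ // (Ideal.absNorm (I : Ideal (𝓞 K)) : ℝ) ≤ X} : ℝ) ≤ C * X := by
  have h := NumberField.Ideal.tendsto_norm_le_div_atTop₀ K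
  have hfin : ∀ X : ℝ, Finite {I : (Ideal (𝓞 K))⁰ // (Ideal.absNorm (I : Ideal (𝓞 K)) : ℝ) ≤ X} := by
    intro X
    refine (Set.Finite.subset (Ideal.finite_setOfPred_absNorm_le₀ (S := 𝓞 K) ⌊X⌋₊) ?_)
    intro I hI
    exact Nat.le_floor hI
  obtain ⟨B, hB⟩ := h.isBoundedUnder_le.eventually_le
  obtain ⟨X0, hX0⟩ := eventually_atTop.1 hB
  set N : ℝ → ℕ := fun X =>
    Nat.card {I : (Ideal (𝓞 K))⁰ // (Ideal.absNorm (I : Ideal (𝓞 K)) : ℝ) ≤ X} with hN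
  have hmono : ∀ X Y, X ≤ Y → N X ≤ N Y := fun X Y hXY =>
    have := hfin Y
    Nat.card_le_card_of_injective (fun I => ⟨I.1, I.2.trans hXY⟩) fun I I' hII => by
      exact Subtype.ext (congrArg (fun z => z.1) hII)
  refine ⟨max B 0 + N (max X0 1) + 1, by positivity, fun X hX => ?_⟩
  change (N X : ℝ) ≤ _
  by_cases h1 : X < 1
  · have : N X = 0 := by
      refine @Nat.card_of_isEmpty _ ⟨fun I => ?_⟩
      have h3 : Ideal.absNorm (I.1 : Ideal (𝓞 K)) < 1 := by exact_mod_cast I.2.trans_lt h1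
      rw [Nat.lt_one_iff, Ideal.absNorm_eq_zero_iff] at h3
      exact nonZeroDivisors.coe_ne_zero _ h3
    rw [this, Nat.cast_zero]
    positivity
  push Not at h1
  rcases le_total X0 X with h2 | h2
  · have h3 := hX0 X h2
    rw [div_le_iff₀ hX] at h3
    refine h3.trans (mul_le_mul_of_nonneg_right ?_ hX.le)
    have := le_max_left B 0
    have : (0 : ℝ) ≤ N (max X0 1) := by positivity
    linarith
  · have h3 : (N X : ℝ) ≤ N (max X0 1) := by exact_mod_cast hmono _ _ (h2.trans (le_max_left _ _))
    have h4 : (0 : ℝ) ≤ max B 0 := le_max_right _ _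
    nlinarith [(Nat.cast_nonneg (N (max X0 1)) : (0 : ℝ) ≤ _)]

theorem coneCount_ideal_le : ∃ C : ℝ, 0 < C ∧ ∀ (J : Ideal (𝓞 K)), J ≠ ⊥ → ∀ X : ℝ, 0 < X →
    (coneCount K (fun a => a ∈ J) X : ℝ) ≤ C * X / Ideal.absNorm J := by
  obtain ⟨C, hC, h⟩ := card_ideal_le K
  have hw : 0 < torsionOrder K := torsionOrder_pos K
  refine ⟨C * torsionOrder K, by positivity, fun J hJ X hX => ?_⟩
  have hJ0 : (0 : ℝ) < Ideal.absNorm J := by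
    have : Ideal.absNorm J ≠ 0 := fun h => hJ (Ideal.absNorm_eq_zero_iff.1 h)
    positivity
  have hcard : coneCount K (fun a => a ∈ J) X = Nat.card {a : idealSet K
      ⟨J, mem_nonZeroDivisors_of_ne_zero hJ⟩ // mixedEmbedding.norm (a : mixedSpace K) ≤ X} := by
    refine Nat.card_congr (Equiv.ofBijective (fun a => ⟨⟨mixedEmbedding K a.1, ?_⟩, ?_⟩) ⟨?_, ?_⟩)
    · exact mem_idealSet.2 ⟨a.2.1, a.1, a.2.2.1, rfl⟩
    · change mixedEmbedding.norm (mixedEmbedding K a.1) ≤ X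
      rw [norm_mixedEmbedding_int]; exact a.2.2.2
    · intro a b hab
      refine Subtype.ext (RingOfIntegers.ext ((mixedEmbedding_injective K) ?_))
      exact Subtype.ext_iff.1 (Subtype.ext_iff.1 hab)
    · rintro ⟨⟨x, hx⟩, hx2⟩
      obtain ⟨h1, a, ha, rfl⟩ := mem_idealSet.1 hx
      refine ⟨⟨a, h1, ha, ?_⟩, rfl⟩
      rw [← norm_mixedEmbedding_int]; exact hx2
  rw [hcard, ← card_isPrincipal_dvd_norm_le]
  have hle : Nat.card {I : (Ideal (𝓞 K))⁰ // J ∣ I ∧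
      Submodule.IsPrincipal (I : Ideal (𝓞 K)) ∧ (Ideal.absNorm (I : Ideal (𝓞 K)) : ℝ) ≤ X} ≤
      Nat.card {I : (Ideal (𝓞 K))⁰ //
        (Ideal.absNorm (I : Ideal (𝓞 K)) : ℝ) ≤ X / Ideal.absNorm J} := by
    have : Finite {I : (Ideal (𝓞 K))⁰ //
        (Ideal.absNorm (I : Ideal (𝓞 K)) : ℝ) ≤ X / Ideal.absNorm J} := by
      refine (Set.Finite.subset (Ideal.finite_setOfPred_absNorm_le₀ (S := 𝓞 K)
        ⌊X / Ideal.absNorm J⌋₊) ?_)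
      intro I hI
      exact Nat.le_floor hI
    choose q hq using fun I : {I : (Ideal (𝓞 K))⁰ // J ∣ I ∧
      Submodule.IsPrincipal (I : Ideal (𝓞 K)) ∧ (Ideal.absNorm (I : Ideal (𝓞 K)) : ℝ) ≤ X} => I.2.1
    have hq0 : ∀ I, q I ≠ 0 := fun I h0 => by
      have := hq I
      rw [h0, mul_zero] at this
      exact nonZeroDivisors.coe_ne_zero _ this
    refine Nat.card_le_card_of_injective
      (fun I => ⟨⟨q I, mem_nonZeroDivisors_of_ne_zero (hq0 I)⟩, ?_⟩) ?_
    · have := I.2.2.2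
      rw [hq I, map_mul] at this
      rw [le_div_iff₀ hJ0]
      push_cast at this
      linarith
    · intro I I' hII
      have : q I = q I' := by simpa [Subtype.ext_iff] using hII
      refine Subtype.ext (Subtype.ext ?_)
      rw [hq I, hq I', this]
  push_cast
  calc _ ≤ (Nat.card {I : (Ideal (𝓞 K))⁰ //
        (Ideal.absNorm (I : Ideal (𝓞 K)) : ℝ) ≤ X / Ideal.absNorm J} : ℝ) * torsionOrder K := by
        gcongr
    _ ≤ C * (X / Ideal.absNorm J) * torsionOrder K := by
        gcongr
        exact h _ (by positivity)
    _ = _ := by ring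

end ConeCounting

section Sieve

open scoped nonZeroDivisors
open Module NumberField.mixedEmbedding NumberField.mixedEmbedding.fundamentalCone
open IsDedekindDomain

variable (K : Type*) [Field K] [NumberField K]

theorem absNorm_pos_of_ne_bot {J : Ideal (𝓞 K)} (hJ : J ≠ ⊥) : (0 : ℝ) < Ideal.absNorm J := by
  have : Ideal.absNorm J ≠ 0 := fun h => hJ (Ideal.absNorm_eq_zero_iff.1 h)
  positivity

theorem two_le_absNorm (q : HeightOneSpectrum (𝓞 K)) : 2 ≤ Ideal.absNorm q.asIdeal := by
  have h0 : Ideal.absNorm q.asIdeal ≠ 0 := fun h => q.ne_bot (Ideal.absNorm_eq_zero_iff.1 h)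
  have h1 : Ideal.absNorm q.asIdeal ≠ 1 := fun h => q.isPrime.ne_top (Ideal.absNorm_eq_one_iff.1 h)
  omega

theorem summable_inv_absNorm_sq :
    Summable fun I : (Ideal (𝓞 K))⁰ => ((Ideal.absNorm (I : Ideal (𝓞 K)) : ℝ) ^ 2)⁻¹ := by
  obtain ⟨C, hC, hcard⟩ := card_ideal_le K
  set f : (Ideal (𝓞 K))⁰ → ℕ := fun I => Nat.log 2 (Ideal.absNorm (I : Ideal (𝓞 K))) with hf
  have hpos : ∀ I : (Ideal (𝓞 K))⁰, 0 < Ideal.absNorm (I : Ideal (𝓞 K)) := fun I =>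
    Nat.pos_of_ne_zero fun h => nonZeroDivisors.coe_ne_zero I (Ideal.absNorm_eq_zero_iff.1 h)
  have hfin : ∀ X : ℝ, Finite {I : (Ideal (𝓞 K))⁰ // (Ideal.absNorm (I : Ideal (𝓞 K)) : ℝ) ≤ X} := by
    intro X
    refine (Set.Finite.subset (Ideal.finite_setOfPred_absNorm_le₀ (S := 𝓞 K) ⌊X⌋₊) ?_)
    intro I hI
    exact Nat.le_floor hI
  let ι : ∀ j, {I // f I = j} → {I : (Ideal (𝓞 K))⁰ //
      (Ideal.absNorm (I : Ideal (𝓞 K)) : ℝ) ≤ 2 ^ (j + 1)} := fun j I => ⟨I.1, by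
    have h := Nat.lt_pow_succ_log_self one_lt_two (Ideal.absNorm (I.1 : Ideal (𝓞 K)))
    have h2 : Nat.log 2 (Ideal.absNorm (I.1 : Ideal (𝓞 K))) = j := I.2
    rw [h2] at h
    exact_mod_cast h.le⟩
  have hι : ∀ j, Function.Injective (ι j) := fun j a b hab =>
    Subtype.ext (congrArg (fun z => z.1) hab)
  rw [← (Equiv.sigmaFiberEquiv f).summable_iff, summable_sigma_of_nonneg (fun _ => by
    simp only [Function.comp]; positivity)]
  have hfib : ∀ j, Finite {I // f I = j} := fun j =>
    haveI := hfin (2 ^ (j + 1))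
    Finite.of_injective (ι j) (hι j)
  refine ⟨fun j => haveI := hfib j; Summable.of_finite, ?_⟩
  refine Summable.of_nonneg_of_le (fun j => tsum_nonneg fun _ => by
    simp only [Function.comp]; positivity) (fun j => ?_)
    (((summable_geometric_of_lt_one (r := (1/2 : ℝ)) (by norm_num) (by norm_num)).mul_left (2 * C)))
  have := hfib j
  have := hfin (2 ^ (j + 1))
  have := Fintype.ofFinite {I // f I = j}
  rw [tsum_fintype]
  calc _ ≤ ∑ I : {I // f I = j}, ((2 : ℝ) ^ j)⁻¹ ^ 2 := by
        refine Finset.sum_le_sum fun I _ => ?_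
        have h := Nat.pow_log_le_self 2 (hpos I.1).ne'
        have h2 : Nat.log 2 (Ideal.absNorm (I.1 : Ideal (𝓞 K))) = j := I.2
        rw [h2] at h
        have h' : (2 : ℝ) ^ j ≤ Ideal.absNorm (I.1 : Ideal (𝓞 K)) := by exact_mod_cast h
        simp only [Function.comp, Equiv.sigmaFiberEquiv_apply]
        rw [inv_pow]
        gcongr
    _ = Nat.card {I // f I = j} * ((2 : ℝ) ^ j)⁻¹ ^ 2 := by
        rw [Finset.sum_const, nsmul_eq_mul, Nat.card_eq_fintype_card, Finset.card_univ]
    _ ≤ (C * 2 ^ (j + 1)) * ((2 : ℝ) ^ j)⁻¹ ^ 2 := by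
        gcongr
        refine le_trans ?_ (hcard _ (by positivity))
        exact_mod_cast Nat.card_le_card_of_injective (ι j) (hι j)
    _ = 2 * C * (1 / 2) ^ j := by
        rw [pow_succ]; field_simp; rw [← mul_pow]; norm_num

theorem summable_prime_inv_absNorm_sq :
    Summable fun q : HeightOneSpectrum (𝓞 K) => ((Ideal.absNorm q.asIdeal : ℝ) ^ 2)⁻¹ := by
  have h0 (q : HeightOneSpectrum (𝓞 K)) : q.asIdeal ∈ (Ideal (𝓞 K))⁰ :=
    mem_nonZeroDivisors_of_ne_zero q.ne_bot
  obtain ⟨i, hi⟩ : ∃ i : HeightOneSpectrum (𝓞 K) → (Ideal (𝓞 K))⁰,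
      ∀ q, (i q : Ideal (𝓞 K)) = q.asIdeal := ⟨fun q => ⟨q.asIdeal, h0 q⟩, fun _ => rfl⟩
  have hinj : Function.Injective i := fun a b hab =>
    HeightOneSpectrum.ext (by rw [← hi, ← hi, hab])
  refine ((summable_inv_absNorm_sq K).comp_injective hinj).congr fun q => ?_
  rw [Function.comp_apply, hi]

theorem pairwise_isCoprime_sq (T : Finset (HeightOneSpectrum (𝓞 K))) :
    (T : Set (HeightOneSpectrum (𝓞 K))).Pairwise
      (Function.onFun IsCoprime fun q => q.asIdeal ^ 2) := by
  intro p _ q _ hpq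
  refine IsCoprime.pow ?_
  rw [Ideal.isCoprime_iff_sup_eq]
  exact Ideal.IsMaximal.coprime_of_ne p.isMaximal q.isMaximal fun h => hpq (HeightOneSpectrum.ext h)

theorem mem_sq_mul_prod_iff {𝔟 : Ideal (𝓞 K)} (h𝔟 : 𝔟 ≠ ⊥)
    (T : Finset (HeightOneSpectrum (𝓞 K))) (a : 𝓞 K) :
    a ∈ 𝔟 ^ 2 * ∏ q ∈ T, q.asIdeal ^ 2 ↔ a ∈ 𝔟 ^ 2 ∧ ∀ q ∈ T, a ∈ 𝔟 ^ 2 * q.asIdeal ^ 2 := by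
  constructor
  · intro h
    rw [← Ideal.dvd_span_singleton] at h
    refine ⟨Ideal.dvd_span_singleton.1 ((dvd_mul_right _ _).trans h), fun q hq => ?_⟩
    rw [← Ideal.dvd_span_singleton]
    exact (mul_dvd_mul_left _ (Finset.dvd_prod_of_mem (fun q : HeightOneSpectrum (𝓞 K) =>
      q.asIdeal ^ 2) hq)).trans h
  · rintro ⟨h1, h⟩
    obtain ⟨c, hc⟩ := (Ideal.dvd_span_singleton (I := 𝔟 ^ 2)).2 h1
    have hdvd : ∏ q ∈ T, q.asIdeal ^ 2 ∣ c := by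
      refine Finset.prod_dvd_of_coprime (pairwise_isCoprime_sq K T) fun q hq => ?_
      have := (Ideal.dvd_span_singleton (I := 𝔟 ^ 2 * q.asIdeal ^ 2)).2 (h q hq)
      rw [hc] at this
      exact (mul_dvd_mul_iff_left (pow_ne_zero 2 h𝔟)).1 this
    rw [← Ideal.dvd_span_singleton, hc]
    exact mul_dvd_mul_left _ hdvd

theorem exists_coset_rep {I J : Ideal (𝓞 K)} (h : IsCoprime I J) (r : 𝓞 K) :
    ∃ r', ∀ a, (a - r' ∈ I * J ↔ a - r ∈ I ∧ a ∈ J) := by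
  obtain ⟨x, hx, y, hy, hxy⟩ := Ideal.isCoprime_iff_exists.1 h
  refine ⟨r * y, fun a => ?_⟩
  rw [Ideal.mul_eq_inf_of_isCoprime h, Ideal.mem_inf]
  have h1 : a - r * y = (a - r) + r * x := by
    linear_combination (-r) * hxy
  refine and_congr ?_ ?_
  · rw [h1]; exact Ideal.add_mem_iff_left _ (I.mul_mem_left _ hx)
  · rw [sub_eq_add_neg]
    exact Ideal.add_mem_iff_left _ (J.neg_mem (J.mul_mem_left _ hy))

theorem finite_setOf_mem_sq {a : 𝓞 K} (ha : a ≠ 0) (𝔟 : Ideal (𝓞 K)) :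
    {q : HeightOneSpectrum (𝓞 K) | a ∈ 𝔟 ^ 2 * q.asIdeal ^ 2}.Finite := by
  refine (Ideal.finite_factors (I := Ideal.span {a}) (by simpa using ha)).subset fun q hq => ?_
  rw [Set.mem_ofPred_eq, ← Ideal.dvd_span_singleton] at hq
  exact ((dvd_pow_self _ two_ne_zero).trans (Dvd.intro_left _ rfl)).trans hq

theorem int_ne_zero_of_mem_cone {a : 𝓞 K} (ha : mixedEmbedding K a ∈ fundamentalCone K) :
    a ≠ 0 := by
  rintro rfl
  simpa using norm_pos_of_mem ha

theorem coneCount_eq_sum (P : 𝓞 K → Prop) [DecidablePred P] (X : ℝ) :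
    (coneCount K P X : ℝ) =
      ∑ a ∈ (setOf_mem_cone_finite K X).toFinset, if P a then (1 : ℝ) else 0 := by
  rw [Finset.sum_boole, coneCount, Nat.cast_inj, ← Nat.card_eq_finsetCard]
  refine Nat.card_congr (Equiv.subtypeEquivRight fun a => ?_)
  simp only [Finset.mem_filter, Set.Finite.mem_toFinset, Set.mem_ofPred_eq]
  tauto

/-- The sieve. -/
theorem tendsto_sieve (S : Finset (HeightOneSpectrum (𝓞 K))) : ∃ κ : ℝ, κ ≠ 0 ∧
    ∀ 𝔪 𝔟 : Ideal (𝓞 K), 𝔪 ≠ ⊥ → 𝔟 ≠ ⊥ → IsCoprime 𝔪 𝔟 →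
    (∀ q, q ∉ S → IsCoprime 𝔪 q.asIdeal) → ∀ (r : 𝓞 K)
    (s : Set {w : InfinitePlace K // w.IsReal}),
    Tendsto (fun X : ℝ => (coneCount K (fun a => (a - r ∈ 𝔪 ∧ signSet (mixedEmbedding K a) = s) ∧
      a ∈ 𝔟 ^ 2 ∧ ∀ q, q ∉ S → a ∉ 𝔟 ^ 2 * q.asIdeal ^ 2) X : ℝ) / X) atTop
      (𝓝 (κ / (Ideal.absNorm 𝔪 * Ideal.absNorm 𝔟 ^ 2))) := by
  obtain ⟨V, hV, hlim⟩ := tendsto_coneCount K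
  obtain ⟨C, hC, hbound⟩ := coneCount_ideal_le K
  set ι := {q : HeightOneSpectrum (𝓞 K) // q ∉ S}
  set g : ι → ℝ := fun q => ((Ideal.absNorm q.1.asIdeal : ℝ) ^ 2)⁻¹ with hg
  have hg0 : ∀ q, 0 ≤ g q := fun q => by positivity
  have hgs : Summable g := (summable_prime_inv_absNorm_sq K).comp_injective Subtype.val_injective
  have hprod : Summable fun T : Finset ι => ∏ q ∈ T, g q :=
    summable_finsetProd_of_summable_nonneg hg0 hgs
  have hprod' : Summable fun T : Finset ι => ∏ q ∈ T, -g q := by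
    refine Summable.of_norm (hprod.congr fun T => ?_)
    rw [norm_prod]
    exact Finset.prod_congr rfl fun q _ => by rw [norm_neg, Real.norm_of_nonneg (hg0 q)]
  have hZ : ∑' T : Finset ι, ∏ q ∈ T, -g q ≠ 0 := by
    rw [← tprod_one_add hprod']
    refine tprod_one_add_ne_zero_of_summable (fun q => ?_) (by simpa using hgs.abs)
    have h2 : (2 : ℝ) ≤ Ideal.absNorm q.1.asIdeal := by exact_mod_cast two_le_absNorm K q.1
    have : g q < 1 := inv_lt_one_of_one_lt₀ (by nlinarith)
    linarith
  refine ⟨V * ∑' T : Finset ι, ∏ q ∈ T, -g q, mul_ne_zero hV.ne' hZ, ?_⟩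
  intro 𝔪 𝔟 h𝔪 h𝔟 hcop hcopS r s
  have hNm := absNorm_pos_of_ne_bot K h𝔪
  have hNb := absNorm_pos_of_ne_bot K h𝔟
  set W : Finset ι → Ideal (𝓞 K) := fun T => 𝔟 ^ 2 * ∏ q ∈ T, q.1.asIdeal ^ 2 with hW
  have hWeq : ∀ T : Finset ι, W T = 𝔟 ^ 2 *
      ∏ q ∈ T.map (Function.Embedding.subtype _), q.asIdeal ^ 2 := fun T => by
    rw [Finset.prod_map]; rfl
  have hW0 : ∀ T, W T ≠ ⊥ := fun T => mul_ne_zero (pow_ne_zero 2 h𝔟)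
    (Finset.prod_ne_zero_iff.2 fun q _ => pow_ne_zero 2 q.1.ne_bot)
  have hmemW : ∀ T a, a ∈ W T ↔ a ∈ 𝔟 ^ 2 ∧ ∀ q ∈ T, a ∈ 𝔟 ^ 2 * q.1.asIdeal ^ 2 := fun T a => by
    rw [hWeq, mem_sq_mul_prod_iff K h𝔟]
    simp [ι]
  have hcopW : ∀ T, IsCoprime 𝔪 (W T) := fun T =>
    (hcop.pow_right).mul_right (IsCoprime.prod_right fun q _ => (hcopS q.1 q.2).pow_right)
  have hNW : ∀ T, (Ideal.absNorm (W T) : ℝ)⁻¹ = (Ideal.absNorm 𝔟 ^ 2 : ℝ)⁻¹ * ∏ q ∈ T, g q := by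
    intro T
    simp only [hW, map_mul, map_pow, map_prod, Nat.cast_mul, Nat.cast_pow, Nat.cast_prod, mul_inv,
      hg, Finset.prod_inv_distrib]
  set A : Finset ι → ℝ → ℝ := fun T X =>
    coneCount K (fun a => (a - r ∈ 𝔪 ∧ signSet (mixedEmbedding K a) = s) ∧ a ∈ W T) X with hA
  have hAlim : ∀ T, Tendsto (fun X => (-1) ^ T.card * (A T X / X)) atTop
      (𝓝 (V / (Ideal.absNorm 𝔪 * Ideal.absNorm 𝔟 ^ 2) * ∏ q ∈ T, -g q)) := by
    intro T
    obtain ⟨r', hr'⟩ := exists_coset_rep K (hcopW T) r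
    have h := (hlim (𝔪 * W T) (mul_ne_zero h𝔪 (hW0 T)) r' s).const_mul ((-1) ^ T.card)
    have e1 : ∀ X, coneCount K (fun a => a - r' ∈ 𝔪 * W T ∧ signSet (mixedEmbedding K a) = s) X =
        coneCount K (fun a => (a - r ∈ 𝔪 ∧ signSet (mixedEmbedding K a) = s) ∧ a ∈ W T) X := by
      intro X
      congr 1
      ext a
      rw [hr']; tauto
    simp only [e1] at h
    convert h using 2
    rw [Finset.prod_neg, map_mul, Nat.cast_mul, div_eq_mul_inv V, div_eq_mul_inv V, mul_inv,
      mul_inv, hNW]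
    ring
  have hdom := tendsto_tsum_of_dominated_convergence (𝓕 := atTop)
    (f := fun X T => (-1) ^ T.card * (A T X / X))
    (bound := fun T => C * (Ideal.absNorm 𝔟 ^ 2 : ℝ)⁻¹ * ∏ q ∈ T, g q)
    (hprod.mul_left _) hAlim (by
      filter_upwards [eventually_gt_atTop 0] with X hX T
      have h1 : A T X ≤ coneCount K (fun a => a ∈ W T) X := by
        simp only [hA]
        rw [coneCount_eq_sum, coneCount_eq_sum]
        refine Finset.sum_le_sum fun a _ => ?_
        split_ifs with h h' <;> first | exact le_rfl | exact zero_le_one | exact absurd h.2 h'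
      have h2 := hbound (W T) (hW0 T) X hX
      have h3 : 0 ≤ A T X := Nat.cast_nonneg _
      rw [norm_mul, norm_pow, norm_neg, norm_one, one_pow, one_mul,
        Real.norm_of_nonneg (by positivity), div_le_iff₀ hX]
      refine (h1.trans h2).trans (le_of_eq ?_)
      rw [div_eq_mul_inv, hNW]; ring)
  rw [tsum_mul_left] at hdom
  have hfinal : V / (Ideal.absNorm 𝔪 * Ideal.absNorm 𝔟 ^ 2) * ∑' T : Finset ι, ∏ q ∈ T, -g q =
      (V * ∑' T : Finset ι, ∏ q ∈ T, -g q) / (Ideal.absNorm 𝔪 * Ideal.absNorm 𝔟 ^ 2) := by ring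
  rw [hfinal] at hdom
  refine hdom.congr fun X => ?_
  -- inclusion-exclusion
  have key : HasSum (fun T : Finset ι => (-1) ^ T.card * A T X)
      (∑ a ∈ (setOf_mem_cone_finite K X).toFinset,
        if ((a - r ∈ 𝔪 ∧ signSet (mixedEmbedding K a) = s) ∧
          a ∈ 𝔟 ^ 2 ∧ ∀ q, q ∉ S → a ∉ 𝔟 ^ 2 * q.asIdeal ^ 2) then (1 : ℝ) else 0) := by
    have e : (fun T : Finset ι => (-1) ^ T.card * A T X) = fun T =>
        ∑ a ∈ (setOf_mem_cone_finite K X).toFinset, (-1) ^ T.card *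
          if ((a - r ∈ 𝔪 ∧ signSet (mixedEmbedding K a) = s) ∧ a ∈ W T) then (1 : ℝ) else 0 := by
      ext T
      simp only [hA]
      rw [coneCount_eq_sum, Finset.mul_sum]
    rw [e]
    refine hasSum_sum fun a ha => ?_
    have ha0 : a ≠ 0 := int_ne_zero_of_mem_cone K ((Set.Finite.mem_toFinset _).1 ha).1
    have hbad : {q : ι | a ∈ 𝔟 ^ 2 * q.1.asIdeal ^ 2}.Finite :=
      (finite_setOf_mem_sq K ha0 𝔟).preimage (f := fun q : ι => q.1)
        Subtype.val_injective.injOn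
    by_cases hbase : (a - r ∈ 𝔪 ∧ signSet (mixedEmbedding K a) = s) ∧ a ∈ 𝔟 ^ 2
    · have h1 : (if ((a - r ∈ 𝔪 ∧ signSet (mixedEmbedding K a) = s) ∧
          a ∈ 𝔟 ^ 2 ∧ ∀ q, q ∉ S → a ∉ 𝔟 ^ 2 * q.asIdeal ^ 2) then (1 : ℝ) else 0) =
          ∑ T ∈ hbad.toFinset.powerset, (-1) ^ T.card *
          if ((a - r ∈ 𝔪 ∧ signSet (mixedEmbedding K a) = s) ∧ a ∈ W T) then (1 : ℝ) else 0 := by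
        have h2 : ∑ T ∈ hbad.toFinset.powerset, (-1 : ℝ) ^ T.card *
            (if ((a - r ∈ 𝔪 ∧ signSet (mixedEmbedding K a) = s) ∧ a ∈ W T) then (1 : ℝ) else 0) =
            ((∑ T ∈ hbad.toFinset.powerset, (-1 : ℤ) ^ T.card : ℤ) : ℝ) := by
          push_cast
          refine Finset.sum_congr rfl fun T hT => ?_
          rw [if_pos, mul_one]
          refine ⟨hbase.1, (hmemW T a).2 ⟨hbase.2, fun q hq => ?_⟩⟩
          simpa using Finset.mem_powerset.1 hT hq
        rw [h2, Finset.sum_powerset_neg_one_pow_card]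
        push_cast
        refine if_congr ?_ rfl rfl
        rw [Finset.eq_empty_iff_forall_notMem]
        simp only [Set.Finite.mem_toFinset, Set.mem_ofPred_eq]
        exact ⟨fun h q => h.2.2 q.1 q.2, fun h => ⟨hbase.1, hbase.2, fun q hq => h ⟨q, hq⟩⟩⟩
      rw [h1]
      refine hasSum_sum_of_ne_finset_zero fun T hT => ?_
      rw [if_neg, mul_zero]
      rintro ⟨-, h⟩
      refine hT (Finset.mem_powerset.2 fun q hq => ?_)
      simpa using ((hmemW T a).1 h).2 q hq
    · rw [if_neg (fun h => hbase ⟨h.1, h.2.1⟩)]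
      convert hasSum_zero (α := ℝ) (β := Finset ι) using 2 with T
      rw [if_neg (fun h => hbase ⟨h.1, ((hmemW T a).1 h.2).1⟩), mul_zero]
  rw [coneCount_eq_sum, ← (key.div_const X).tsum_eq]
  exact tsum_congr fun T => by ring

end Sieve

section Valuation

open IsDedekindDomain

variable {R : Type*} [CommRing R] [IsDedekindDomain R]

/-- The exponent of the prime `p` in the factorization of the ideal `I` (junk for `I = ⊥`). -/
def ordAt (p : HeightOneSpectrum R) (I : Ideal R) : ℕ := multiplicity p.asIdeal I

variable (p : HeightOneSpectrum R) {I J : Ideal R}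

theorem finiteMultiplicity_asIdeal (hI : I ≠ ⊥) : FiniteMultiplicity p.asIdeal I :=
  FiniteMultiplicity.of_prime_left p.prime hI

theorem pow_dvd_iff_le_ordAt (hI : I ≠ ⊥) {n : ℕ} : p.asIdeal ^ n ∣ I ↔ n ≤ ordAt p I :=
  (finiteMultiplicity_asIdeal p hI).pow_dvd_iff_le_multiplicity

theorem ordAt_mul (hI : I ≠ ⊥) (hJ : J ≠ ⊥) : ordAt p (I * J) = ordAt p I + ordAt p J :=
  multiplicity_mul p.prime (finiteMultiplicity_asIdeal p (mul_ne_zero hI hJ))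

theorem ordAt_pow (hI : I ≠ ⊥) (n : ℕ) : ordAt p (I ^ n) = n * ordAt p I :=
  (finiteMultiplicity_asIdeal p hI).multiplicity_pow p.prime

theorem mem_pow_iff_le_ordAt {a : R} (ha : a ≠ 0) {n : ℕ} :
    a ∈ p.asIdeal ^ n ↔ n ≤ ordAt p (Ideal.span {a}) := by
  rw [← pow_dvd_iff_le_ordAt p (by simpa using ha), Ideal.dvd_span_singleton]

theorem ordAt_eq_zero_iff (hI : I ≠ ⊥) : ordAt p I = 0 ↔ ¬ I ≤ p.asIdeal := by
  rw [← Ideal.dvd_iff_le, ← pow_one p.asIdeal, pow_dvd_iff_le_ordAt p hI]; omega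

theorem ordAt_self : ordAt p p.asIdeal = 1 :=
  multiplicity_self

theorem ordAt_of_ne {p q : HeightOneSpectrum R} (h : q ≠ p) : ordAt p q.asIdeal = 0 := by
  rw [ordAt_eq_zero_iff p q.ne_bot]
  exact fun hle => h (HeightOneSpectrum.ext (q.isMaximal.eq_of_le p.isPrime.ne_top hle))

theorem dvd_of_ordAt_le (hI : I ≠ ⊥) (hJ : J ≠ ⊥)
    (h : ∀ p : HeightOneSpectrum R, ordAt p I ≤ ordAt p J) : I ∣ J := by
  rw [UniqueFactorizationMonoid.dvd_iff_emultiplicity_le hI]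
  intro P hP
  let p : HeightOneSpectrum R := ⟨P, Ideal.isPrime_of_prime hP, hP.ne_zero⟩
  have hp : P = p.asIdeal := rfl
  rw [hp, (finiteMultiplicity_asIdeal p hI).emultiplicity_eq_multiplicity,
    (finiteMultiplicity_asIdeal p hJ).emultiplicity_eq_multiplicity]
  exact_mod_cast h p

theorem ideal_eq_of_ordAt (hI : I ≠ ⊥) (hJ : J ≠ ⊥)
    (h : ∀ p : HeightOneSpectrum R, ordAt p I = ordAt p J) : I = J :=
  dvd_antisymm (dvd_of_ordAt_le hI hJ fun p => (h p).le) (dvd_of_ordAt_le hJ hI fun p => (h p).ge)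

theorem ordAt_prod_pow (S : Finset (HeightOneSpectrum R)) (f : HeightOneSpectrum R → ℕ) :
    ordAt p (∏ q ∈ S, q.asIdeal ^ f q) = if p ∈ S then f p else 0 := by
  induction S using Finset.induction_on with
  | empty => 
    rw [Finset.prod_empty, if_neg (Finset.notMem_empty _), ordAt_eq_zero_iff p one_ne_zero]
    rw [Ideal.one_eq_top, top_le_iff]; exact p.isPrime.ne_top
  | insert q S hq ih =>
    have h0 : ∏ q ∈ S, q.asIdeal ^ f q ≠ ⊥ :=
      Finset.prod_ne_zero_iff.2 fun q _ => pow_ne_zero _ q.ne_bot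
    rw [Finset.prod_insert hq, ordAt_mul p (pow_ne_zero _ q.ne_bot) h0, ih, ordAt_pow p q.ne_bot]
    by_cases h : q = p
    · subst h; simp [hq, ordAt_self]
    · simp [ordAt_of_ne h, Ne.symm h]

omit [IsDedekindDomain R] in
theorem span_singleton_ne_bot {a : R} (ha : a ≠ 0) : Ideal.span {a} ≠ ⊥ := by simpa using ha

theorem ordAt_span_mul {a b : R} (ha : a ≠ 0) (hb : b ≠ 0) :
    ordAt p (Ideal.span {a * b}) = ordAt p (Ideal.span {a}) + ordAt p (Ideal.span {b}) := by
  rw [← Ideal.span_singleton_mul_span_singleton,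
    ordAt_mul p (span_singleton_ne_bot ha) (span_singleton_ne_bot hb)]

theorem ordAt_span_pow {a : R} (ha : a ≠ 0) (n : ℕ) :
    ordAt p (Ideal.span {a ^ n}) = n * ordAt p (Ideal.span {a}) := by
  rw [← Ideal.span_singleton_pow, ordAt_pow p (span_singleton_ne_bot ha)]

theorem ordAt_span_eq_zero {a : R} (h : a ∉ p.asIdeal) : ordAt p (Ideal.span {a}) = 0 := by
  have ha : a ≠ 0 := fun h0 => h (h0 ▸ zero_mem _)
  rw [ordAt_eq_zero_iff p (span_singleton_ne_bot ha), Ideal.span_singleton_le_iff_mem]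
  exact h

theorem exists_eq_span_mul_of_mem {b : R} {I : Ideal R} (h : b ∈ I) :
    ∃ J, Ideal.span {b} = I * J := Ideal.dvd_span_singleton.2 h

/-- Every nonzero element divides, up to a factor prime to `p`, every element with larger
exponent at `p`. -/
theorem exists_notMem_forall_dvd {π : R} (hπ : π ≠ 0) :
    ∃ G ∉ p.asIdeal, ∀ m x, x ∈ p.asIdeal ^ (m * ordAt p (Ideal.span {π})) → π ^ m ∣ G ^ m * x := by
  set n := ordAt p (Ideal.span {π})
  obtain ⟨J, hJ⟩ := (pow_dvd_iff_le_ordAt p (span_singleton_ne_bot hπ)).2 (le_refl n)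
  have hJp : ¬ J ≤ p.asIdeal := by
    intro h
    obtain ⟨J', rfl⟩ := Ideal.dvd_iff_le.2 h
    have : p.asIdeal ^ (n + 1) ∣ Ideal.span {π} := ⟨J', by rw [hJ]; ring⟩
    rw [pow_dvd_iff_le_ordAt p (span_singleton_ne_bot hπ)] at this
    omega
  obtain ⟨G, hG, hGp⟩ := SetLike.not_le_iff_exists.1 hJp
  refine ⟨G, hGp, fun m x hx => ?_⟩
  rw [← Ideal.mem_span_singleton, ← Ideal.span_singleton_pow, hJ, mul_pow, ← pow_mul, mul_comm n,
    mul_comm (G ^ m)]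
  exact Ideal.mul_mem_mul hx (Ideal.pow_mem_pow hG m)

end Valuation

section QuadraticFields

open Module IsDedekindDomain

theorem linearIndependent_one_of_notMem_range {F M : Type*} [Field F] [CommRing M] [Nontrivial M]
    [Algebra F M] {y : M} (hy : y ∉ (algebraMap F M).range) :
    LinearIndependent F ![(1 : M), y] := by
  rw [LinearIndependent.pair_iff]
  intro s t hst
  have ht : t = 0 := by
    by_contra ht
    refine hy ⟨-(t⁻¹ * s), ?_⟩
    have h1 := congrArg (fun z => t⁻¹ • z) hst
    simp only [smul_add, smul_smul, inv_mul_cancel₀ ht, one_smul, smul_zero] at h1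
    rw [map_neg, Algebra.algebraMap_eq_smul_one]
    linear_combination -h1
  subst ht
  refine ⟨?_, rfl⟩
  simpa using hst

/-- In an algebra of rank two, `1` and any `y` outside the base field form a basis. -/
theorem exists_eq_add_mul_of_finrank_two {F M : Type*} [Field F] [CommRing M] [Nontrivial M]
    [Algebra F M]
    (h : finrank F M = 2) {y : M} (hy : y ∉ (algebraMap F M).range) (z : M) :
    ∃ s t : F, z = algebraMap F M s + algebraMap F M t * y := by
  have hli := linearIndependent_one_of_notMem_range hy
  have hfin : FiniteDimensional F M := FiniteDimensional.of_finrank_pos (by omega)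
  have hspan := hli.span_eq_top_of_card_eq_finrank' (by simp [h])
  have hz : z ∈ Submodule.span F (Set.range ![(1 : M), y]) := hspan ▸ Submodule.mem_top
  rw [Matrix.range_cons, Matrix.range_cons, Matrix.range_empty, Set.union_empty,
    Set.singleton_union, Submodule.mem_span_pair] at hz
  obtain ⟨s, t, rfl⟩ := hz
  exact ⟨s, t, by rw [Algebra.smul_def, Algebra.smul_def, mul_one]⟩

variable (K : Type*) [Field K] [NumberField K]

/-- `L` is the quadratic extension of `K` generated by a square root of `α`. -/
def IsSqrt (α : 𝓞 K) (L : IntermediateField K (AlgebraicClosure K)) : Prop :=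
  finrank K L = 2 ∧ ∃ y : L, y ^ 2 = algebraMap K L α ∧ y ∉ (algebraMap K L).range

variable {K} {L L' : IntermediateField K (AlgebraicClosure K)}

omit [NumberField K] in
theorem eq_adjoin_of_finrank_two (h : finrank K L = 2) {y : L} (hy : y ∉ (algebraMap K L).range) :
    L = IntermediateField.adjoin K {(y : AlgebraicClosure K)} := by
  refine le_antisymm (fun z hz => ?_) (IntermediateField.adjoin_le_iff.2 (by simp))
  obtain ⟨s, t, hst⟩ := exists_eq_add_mul_of_finrank_two h hy ⟨z, hz⟩
  have hz' : z = algebraMap K _ s + algebraMap K _ t * (y : AlgebraicClosure K) :=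
    congrArg (fun w : L => (w : AlgebraicClosure K)) hst
  rw [hz']
  exact add_mem (IntermediateField.algebraMap_mem _ _)
    (mul_mem (IntermediateField.algebraMap_mem _ _) (IntermediateField.mem_adjoin_simple_self _ _))

omit [NumberField K] in
theorem IsSqrt.unique {α : 𝓞 K} (h : IsSqrt K α L) (h' : IsSqrt K α L') : L = L' := by
  obtain ⟨h2, y, hy, hyr⟩ := h
  obtain ⟨h2', y', hy', hyr'⟩ := h'
  rw [eq_adjoin_of_finrank_two h2 hyr, eq_adjoin_of_finrank_two h2' hyr']
  have e : (y : AlgebraicClosure K) ^ 2 = (y' : AlgebraicClosure K) ^ 2 := by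
    have e1 := congrArg (fun w : L => (w : AlgebraicClosure K)) hy
    have e2 := congrArg (fun w : L' => (w : AlgebraicClosure K)) hy'
    exact e1.trans e2.symm
  rcases sq_eq_sq_iff_eq_or_eq_neg.1 e with e | e
  · rw [e]
  · rw [e]
    refine le_antisymm ?_ ?_ <;> rw [IntermediateField.adjoin_simple_le_iff]
    · exact neg_mem (IntermediateField.mem_adjoin_simple_self _ _)
    · rw [← neg_mem_iff]; exact IntermediateField.mem_adjoin_simple_self _ _

omit [NumberField K] in
theorem exists_isSqrt (α : 𝓞 K) (hα : ¬ IsSquare (α : K)) : ∃ L, IsSqrt K α L := by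
  obtain ⟨y, hy⟩ := IsAlgClosed.exists_pow_nat_eq
    (algebraMap K (AlgebraicClosure K) α) (n := 2) (by norm_num)
  have hirr : Irreducible (Polynomial.X ^ 2 - Polynomial.C (α : K)) :=
    X_pow_sub_C_irreducible_of_prime Nat.prime_two fun b hb => hα ⟨b, by rw [← hb, sq]⟩
  have hmin : minpoly K y = Polynomial.X ^ 2 - Polynomial.C (α : K) := by
    refine (minpoly.eq_of_irreducible_of_monic hirr ?_ (Polynomial.monic_X_pow_sub_C _ two_ne_zero)).symm
    simp [hy]
  have hint : IsIntegral K y := Algebra.IsIntegral.isIntegral y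
  refine ⟨IntermediateField.adjoin K {y}, ?_, ⟨y, IntermediateField.mem_adjoin_simple_self K y⟩,
    Subtype.ext hy, ?_⟩
  · rw [IntermediateField.adjoin.finrank hint, hmin, Polynomial.natDegree_X_pow_sub_C]
  · rintro ⟨b, hb⟩
    refine hα ⟨b, (algebraMap K (AlgebraicClosure K)).injective ?_⟩
    have hb' : algebraMap K (AlgebraicClosure K) b = y :=
      congrArg (fun w : IntermediateField.adjoin K {y} => (w : AlgebraicClosure K)) hb
    rw [← hy, ← hb', map_mul, sq]

theorem IsSqrt.not_isSquare {α : 𝓞 K} (h : IsSqrt K α L) : ¬ IsSquare (α : K) := by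
  rintro ⟨b, hb⟩
  obtain ⟨-, y, hy, hyr⟩ := h
  rw [hb, map_mul, ← sq] at hy
  rcases sq_eq_sq_iff_eq_or_eq_neg.1 hy with e | e
  · exact hyr ⟨b, e.symm⟩
  · exact hyr ⟨-b, by rw [map_neg, e]⟩

theorem IsSqrt.ne_zero {α : 𝓞 K} (h : IsSqrt K α L) : α ≠ 0 := by
  rintro rfl
  exact h.not_isSquare ⟨0, by simp⟩

omit [NumberField K] in
theorem IsSqrt.of_mul_sq_eq {α β g h : 𝓞 K} (hg : g ≠ 0) (hh : h ≠ 0)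
    (e : β * h ^ 2 = α * g ^ 2) (H : IsSqrt K α L) : IsSqrt K β L := by
  obtain ⟨h2, y, hy, hyr⟩ := H
  have hg' : (algebraMap K L g) ≠ 0 := by simpa using hg
  have hh' : (algebraMap K L h) ≠ 0 := by simpa using hh
  have e' : algebraMap K L β * algebraMap K L h ^ 2 = algebraMap K L α * algebraMap K L g ^ 2 := by
    have := congrArg (fun z : 𝓞 K => algebraMap K L z) e
    simpa using this
  refine ⟨h2, algebraMap K L g / algebraMap K L h * y, ?_, ?_⟩
  · rw [mul_pow, hy, div_pow, div_mul_eq_mul_div, div_eq_iff (pow_ne_zero 2 hh'), e']; ring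
  · rintro ⟨b, hb⟩
    refine hyr ⟨b * h / g, ?_⟩
    rw [map_div₀, map_mul, hb]
    field_simp

theorem exists_isSqrt_of_finrank_two (h : finrank K L = 2) : ∃ α : 𝓞 K, IsSqrt K α L := by
  have hne : ∃ y : L, y ∉ (algebraMap K L).range := by
    by_contra! hall
    have : (⊥ : Subalgebra K L) = ⊤ := by
      rw [eq_top_iff]; intro y _
      obtain ⟨b, hb⟩ := hall y
      exact hb ▸ Subalgebra.algebraMap_mem _ b
    have := Subalgebra.bot_eq_top_iff_finrank_eq_one.1 this
    omega
  obtain ⟨y, hy⟩ := hne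
  obtain ⟨s, t, hst⟩ := exists_eq_add_mul_of_finrank_two h hy (y ^ 2)
  obtain ⟨u, v, hv, huv⟩ := IsFractionRing.div_surjective (A := 𝓞 K) (t ^ 2 + 4 * s)
  have hv0 : (v : K) ≠ 0 := by simpa using nonZeroDivisors.ne_zero hv
  refine ⟨u * v, h, algebraMap K L v * (2 * y - algebraMap K L t), ?_, ?_⟩
  · have e : (2 * y - algebraMap K L t) ^ 2 = algebraMap K L (u / v) := by
      rw [huv]; simp only [map_add, map_pow, map_mul, map_ofNat]; linear_combination 4 * hst
    rw [mul_pow, e, ← map_pow, ← map_mul]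
    congr 1
    push_cast
    field_simp
  · rintro ⟨b, hb⟩
    refine hy ⟨(b / v + t) / 2, ?_⟩
    have hv0' : algebraMap K L v ≠ 0 := by simpa using hv0
    rw [map_div₀, map_add, map_div₀, hb, map_ofNat]
    field_simp
    ring

theorem exists_mul_sq_eq_of_finrank_two {M : Type*} [Field M] [Algebra K M]
    (h2 : finrank K M = 2) {α β : 𝓞 K} {y z : M} (hy : y ^ 2 = algebraMap K M α)
    (hyr : y ∉ (algebraMap K M).range) (hz : z ^ 2 = algebraMap K M β)
    (hzr : z ∉ (algebraMap K M).range) :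
    ∃ g h : 𝓞 K, g ≠ 0 ∧ h ≠ 0 ∧ α * g ^ 2 = β * h ^ 2 := by
  have : CharZero M := charZero_of_injective_algebraMap (algebraMap K M).injective
  obtain ⟨s, t, hst⟩ := exists_eq_add_mul_of_finrank_two h2 hyr z
  have ht : t ≠ 0 := by
    rintro rfl
    exact hzr ⟨s, by rw [hst]; simp⟩
  have hs : s = 0 := by
    by_contra hs
    refine hyr ⟨(β - s ^ 2 - t ^ 2 * α) / (2 * s * t), ?_⟩
    have h1 : algebraMap K M s ≠ 0 := by simpa using hs
    have h2 : algebraMap K M t ≠ 0 := by simpa using ht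
    simp only [map_div₀, map_sub, map_mul, map_pow, map_ofNat]
    rw [← hz, ← hy, hst]
    field_simp
    ring
  subst hs
  have e : (β : K) = t ^ 2 * α := by
    apply (algebraMap K M).injective
    rw [← hz, hst, map_mul, ← hy, map_pow]; simp; ring
  obtain ⟨u, v, hv, rfl⟩ := IsFractionRing.div_surjective (A := 𝓞 K) t
  have hv0 : v ≠ 0 := nonZeroDivisors.ne_zero hv
  have hv0' : (v : K) ≠ 0 := by simpa using hv0
  have hu0 : u ≠ 0 := by rintro rfl; simp at ht
  refine ⟨u, v, hu0, hv0, FaithfulSMul.algebraMap_injective (𝓞 K) K ?_⟩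
  rw [RingOfIntegers.coe_eq_algebraMap, RingOfIntegers.coe_eq_algebraMap] at e
  rw [map_mul, map_mul, map_pow, map_pow, e]
  field_simp

theorem IsSqrt.exists_mul_sq_eq {α β : 𝓞 K} (hα : IsSqrt K α L) (hβ : IsSqrt K β L) :
    ∃ g h : 𝓞 K, g ≠ 0 ∧ h ≠ 0 ∧ α * g ^ 2 = β * h ^ 2 := by
  obtain ⟨h2, y, hy, hyr⟩ := hα
  obtain ⟨-, z, hz, hzr⟩ := hβ
  exact exists_mul_sq_eq_of_finrank_two h2 hy hyr hz hzr

end QuadraticFields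

section Parametrization

open Module IsDedekindDomain NumberField.Units NumberField.mixedEmbedding
  NumberField.mixedEmbedding.fundamentalCone
open scoped nonZeroDivisors

variable {K : Type*} [Field K] [NumberField K]

/-- `a` generates an ideal of the form `𝔞 * 𝔟 ^ 2` with `𝔞` squarefree. -/
def IsSelected (𝔟 : Ideal (𝓞 K)) (a : 𝓞 K) : Prop :=
  a ∈ 𝔟 ^ 2 ∧ ∀ q : HeightOneSpectrum (𝓞 K), a ∉ 𝔟 ^ 2 * q.asIdeal ^ 2

theorem IsSelected.exists_factor {𝔟 : Ideal (𝓞 K)} {a : 𝓞 K} (ha : a ≠ 0)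
    (h : IsSelected 𝔟 a) : ∃ 𝔞 : Ideal (𝓞 K), 𝔞 ≠ ⊥ ∧ Ideal.span {a} = 𝔞 * 𝔟 ^ 2 ∧
      ∀ q, ordAt q 𝔞 ≤ 1 := by
  obtain ⟨𝔞, h𝔞⟩ := exists_eq_span_mul_of_mem h.1
  have h0 : 𝔞 ≠ ⊥ := by
    rintro rfl
    exact span_singleton_ne_bot ha (by rw [h𝔞]; simp)
  refine ⟨𝔞, h0, by rw [h𝔞, mul_comm], fun q => ?_⟩
  by_contra! hq
  obtain ⟨c, hc⟩ := (pow_dvd_iff_le_ordAt q h0).2 hq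
  refine h.2 q (Ideal.dvd_span_singleton.1 ⟨c, ?_⟩)
  rw [h𝔞, hc, mul_assoc]

theorem IsSelected.span_mul_eq {𝔟 𝔟' : Ideal (𝓞 K)} {a a' g h : 𝓞 K} (h𝔟 : 𝔟 ≠ ⊥) (h𝔟' : 𝔟' ≠ ⊥)
    (ha : a ≠ 0) (ha' : a' ≠ 0) (hg : g ≠ 0) (hh : h ≠ 0) (H : IsSelected 𝔟 a)
    (H' : IsSelected 𝔟' a') (e : Associated (a * g ^ 2) (a' * h ^ 2)) :
    Ideal.span {g} * 𝔟 = Ideal.span {h} * 𝔟' := by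
  obtain ⟨𝔞, h0, h1, h2⟩ := H.exists_factor ha
  obtain ⟨𝔞', h0', h1', h2'⟩ := H'.exists_factor ha'
  have hg' := span_singleton_ne_bot hg
  have hh' := span_singleton_ne_bot hh
  have hX : Ideal.span {g} * 𝔟 ≠ ⊥ := mul_ne_zero hg' h𝔟
  have hY : Ideal.span {h} * 𝔟' ≠ ⊥ := mul_ne_zero hh' h𝔟'
  have e' : 𝔞 * (Ideal.span {g} * 𝔟) ^ 2 = 𝔞' * (Ideal.span {h} * 𝔟') ^ 2 := by
    rw [← Ideal.span_singleton_eq_span_singleton, ← Ideal.span_singleton_mul_span_singleton,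
      ← Ideal.span_singleton_mul_span_singleton, ← Ideal.span_singleton_pow,
      ← Ideal.span_singleton_pow, h1, h1'] at e
    calc _ = 𝔞 * 𝔟 ^ 2 * Ideal.span {g} ^ 2 := by ring
      _ = _ := by rw [e]; ring
  refine ideal_eq_of_ordAt hX hY fun q => ?_
  have := congrArg (ordAt q) e'
  rw [ordAt_mul q h0 (pow_ne_zero 2 hX), ordAt_mul q h0' (pow_ne_zero 2 hY), ordAt_pow q hX,
    ordAt_pow q hY] at this
  have := h2 q
  have := h2' q
  omega

theorem exists_sq_dvd {I : Ideal (𝓞 K)} (hI : I ≠ ⊥) :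
    ∃ 𝔞 𝔠 : Ideal (𝓞 K), 𝔞 ≠ ⊥ ∧ 𝔠 ≠ ⊥ ∧ I = 𝔞 * 𝔠 ^ 2 ∧ ∀ q, ordAt q 𝔞 ≤ 1 := by
  have hfin := Ideal.finite_factors hI
  set 𝔠 : Ideal (𝓞 K) := ∏ q ∈ hfin.toFinset, q.asIdeal ^ (ordAt q I / 2) with h𝔠
  have h0 : 𝔠 ≠ ⊥ := Finset.prod_ne_zero_iff.2 fun q _ => pow_ne_zero _ q.ne_bot
  have hord : ∀ q, ordAt q 𝔠 = ordAt q I / 2 := fun q => by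
    rw [h𝔠, ordAt_prod_pow]
    split_ifs with h
    · rfl
    · rw [Set.Finite.mem_toFinset, Set.mem_ofPred_eq, Ideal.dvd_iff_le,
        ← ordAt_eq_zero_iff q hI] at h
      rw [h]
  obtain ⟨𝔞, h𝔞⟩ : 𝔠 ^ 2 ∣ I := dvd_of_ordAt_le (pow_ne_zero 2 h0) hI fun q => by
    rw [ordAt_pow q h0, hord]; omega
  have h0' : 𝔞 ≠ ⊥ := by
    rintro rfl
    exact hI (by rw [h𝔞]; simp)
  refine ⟨𝔞, 𝔠, h0', h0, by rw [h𝔞, mul_comm], fun q => ?_⟩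
  have := congrArg (ordAt q) h𝔞
  rw [ordAt_mul q (pow_ne_zero 2 h0) h0', ordAt_pow q h0, hord] at this
  omega

/-- A family of integral ideals representing the ideal classes. -/
structure ClassReps (K : Type*) [Field K] [NumberField K] where
  /-- the representative of a class -/
  rep : ClassGroup (𝓞 K) → (Ideal (𝓞 K))⁰
  mk0_rep : ∀ c, ClassGroup.mk0 (rep c) = c

variable (r : ClassReps K)

theorem ClassReps.rep_ne_bot (c : ClassGroup (𝓞 K)) : (r.rep c : Ideal (𝓞 K)) ≠ ⊥ :=
  nonZeroDivisors.coe_ne_zero _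

theorem ClassReps.exists_isSelected {a : 𝓞 K} (ha : a ≠ 0) :
    ∃ (c : ClassGroup (𝓞 K)) (α g h : 𝓞 K), α ≠ 0 ∧ g ≠ 0 ∧ h ≠ 0 ∧ α * h ^ 2 = a * g ^ 2 ∧
      IsSelected (r.rep c : Ideal (𝓞 K)) α := by
  obtain ⟨𝔞, 𝔠, h𝔞0, h𝔠0, hfac, hsf⟩ := exists_sq_dvd (span_singleton_ne_bot ha)
  set c := ClassGroup.mk0 (⟨𝔠, mem_nonZeroDivisors_of_ne_zero h𝔠0⟩ : (Ideal (𝓞 K))⁰) with hc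
  have hcc := r.mk0_rep c
  rw [hc, ← hc, eq_comm] at hcc
  obtain ⟨g, h, hg, hh, hgh⟩ := ClassGroup.mk0_eq_mk0_iff.1 (hc.symm.trans hcc)
  simp only at hgh
  have key : Ideal.span {a * g ^ 2} =
      𝔞 * (r.rep c : Ideal (𝓞 K)) ^ 2 * Ideal.span {h ^ 2} := by
    rw [← Ideal.span_singleton_mul_span_singleton, ← Ideal.span_singleton_pow,
      ← Ideal.span_singleton_pow, hfac]
    calc _ = 𝔞 * (Ideal.span {g} * 𝔠) ^ 2 := by ring
      _ = _ := by rw [hgh]; ring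
  obtain ⟨α, hα⟩ : h ^ 2 ∣ a * g ^ 2 := by
    rw [← Ideal.span_singleton_le_span_singleton, key]
    exact Ideal.mul_le_right
  have hα0 : α ≠ 0 := by
    rintro rfl
    rw [mul_zero] at hα
    exact mul_ne_zero ha (pow_ne_zero 2 hg) hα
  have hspan : Ideal.span {α} = 𝔞 * (r.rep c : Ideal (𝓞 K)) ^ 2 := by
    rw [hα, mul_comm, ← Ideal.span_singleton_mul_span_singleton] at key
    exact mul_right_cancel₀ (span_singleton_ne_bot (pow_ne_zero 2 hh)) key
  refine ⟨c, α, g, h, hα0, hg, hh, by rw [hα]; ring, ?_, fun q hq => ?_⟩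
  · rw [← Ideal.dvd_span_singleton, hspan]; exact Dvd.intro_left _ rfl
  · rw [← Ideal.dvd_span_singleton, hspan, mul_comm 𝔞] at hq
    have := (mul_dvd_mul_iff_left (pow_ne_zero 2 (r.rep_ne_bot c))).1 hq
    rw [pow_dvd_iff_le_ordAt q h𝔞0] at this
    have := hsf q
    omega

variable (K) in
/-- Units modulo squares. -/
abbrev UnitClasses := (𝓞 K)ˣ ⧸ (powMonoidHom 2 : (𝓞 K)ˣ →* (𝓞 K)ˣ).range

instance : Finite (UnitClasses K) := by
  have : Group.FG (𝓞 K)ˣ := Group.fg_iff_monoid_fg.2 inferInstance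
  refine CommGroup.finite_of_fg_isMulTorsion _ fun g => ?_
  induction g using QuotientGroup.induction_on with
  | H u =>
    refine isOfFinOrder_iff_pow_eq_one.2 ⟨2, two_pos, ?_⟩
    rw [← QuotientGroup.mk_pow, QuotientGroup.eq_one_iff]
    exact ⟨u, rfl⟩

omit [NumberField K] in
theorem UnitClasses.exists_eq_out_mul_sq (u : (𝓞 K)ˣ) :
    ∃ v : (𝓞 K)ˣ, u = (Quotient.out (u : UnitClasses K) : (𝓞 K)ˣ) * v ^ 2 := by
  obtain ⟨⟨_, v, rfl⟩, hv⟩ := QuotientGroup.mk_out_eq_mul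
    (powMonoidHom 2 : (𝓞 K)ˣ →* (𝓞 K)ˣ).range u
  refine ⟨v⁻¹, ?_⟩
  rw [hv]
  simp

omit [NumberField K] in
theorem UnitClasses.mk_eq_of_mul_sq_eq {u u' v v' : (𝓞 K)ˣ} (h : u * v ^ 2 = u' * v' ^ 2) :
    (u : UnitClasses K) = u' := by
  rw [QuotientGroup.eq]
  refine ⟨v * v'⁻¹, ?_⟩
  simp only [powMonoidHom_apply]
  rw [mul_pow, inv_pow, eq_inv_mul_iff_mul_eq, ← mul_assoc, h]
  simp

/-- The parameters of quadratic extensions: a unit class representative, an ideal class and a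
generator in the fundamental cone. -/
abbrev QuadParam (K : Type*) [Field K] [NumberField K] :=
  ClassGroup (𝓞 K) × UnitClasses K × 𝓞 K

/-- The radicand attached to a parameter. -/
def QuadParam.radicand (ω : QuadParam K) : 𝓞 K := (Quotient.out ω.2.1 : (𝓞 K)ˣ) * ω.2.2

/-- Parameters that are counted. -/
def QuadParam.IsValid (ω : QuadParam K) : Prop :=
  mixedEmbedding K ω.2.2 ∈ fundamentalCone K ∧ IsSelected (r.rep ω.1 : Ideal (𝓞 K)) ω.2.2

omit [NumberField K] in
theorem IsSelected.unit_mul {𝔟 : Ideal (𝓞 K)} {a : 𝓞 K} (h : IsSelected 𝔟 a) (u : (𝓞 K)ˣ) :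
    IsSelected 𝔟 (u * a) := by
  refine ⟨Ideal.mul_mem_left _ _ h.1, fun q hq => h.2 q ?_⟩
  have := Ideal.mul_mem_left _ (↑u⁻¹ : 𝓞 K) hq
  simpa using this

theorem exists_param {L : IntermediateField K (AlgebraicClosure K)} (h : finrank K L = 2) :
    ∃ ω : QuadParam K, ω.IsValid r ∧ IsSqrt K ω.radicand L := by
  obtain ⟨a, ha⟩ := exists_isSqrt_of_finrank_two h
  obtain ⟨c, α, g, k, hα0, hg, hk, e, hsel⟩ := r.exists_isSelected ha.ne_zero
  have hα := ha.of_mul_sq_eq hg hk e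
  obtain ⟨u, hu⟩ := exists_unit_smul_mem (x := mixedEmbedding K α) (by
    simpa [mixedEmbedding.norm_eq_norm] using hα0)
  obtain ⟨v, hv⟩ := UnitClasses.exists_eq_out_mul_sq u⁻¹
  refine ⟨⟨c, (u⁻¹ : (𝓞 K)ˣ), u * α⟩, ⟨?_, hsel.unit_mul u⟩, ?_⟩
  · rwa [← unit_smul_eq_iff_mul_eq.2 rfl]
  · refine hα.of_mul_sq_eq (g := 1) (h := v) one_ne_zero v.ne_zero ?_
    have hv' := congrArg (fun z : (𝓞 K)ˣ => (z : 𝓞 K)) hv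
    simp only [Units.val_mul, Units.val_pow_eq_pow_val] at hv'
    simp only [QuadParam.radicand]
    calc _ = ((Quotient.out ((u⁻¹ : (𝓞 K)ˣ) : UnitClasses K) : (𝓞 K)ˣ) * v ^ 2 : 𝓞 K) * u * α := by
          ring
      _ = _ := by rw [← hv']; simp

/-- The action of roots of unity on parameters, preserving the field. -/
def QuadParam.twist (ζ : torsion K) (ω : QuadParam K) : QuadParam K :=
  ⟨ω.1, (((Quotient.out ω.2.1 : (𝓞 K)ˣ) * (ζ : (𝓞 K)ˣ)⁻¹ : (𝓞 K)ˣ) : UnitClasses K),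
    (ζ : (𝓞 K)ˣ) * ω.2.2⟩

theorem QuadParam.IsValid.twist {ω : QuadParam K} (h : ω.IsValid r) (ζ : torsion K) :
    (ω.twist ζ).IsValid r := by
  refine ⟨?_, h.2.unit_mul _⟩
  have := torsion_smul_mem_of_mem h.1 ζ.2
  rwa [unit_smul_eq_iff_mul_eq.2 rfl] at this

theorem QuadParam.isSqrt_twist {ω : QuadParam K} {L : IntermediateField K (AlgebraicClosure K)}
    (h : IsSqrt K ω.radicand L) (ζ : torsion K) : IsSqrt K (ω.twist ζ).radicand L := by
  obtain ⟨v, hv⟩ := UnitClasses.exists_eq_out_mul_sq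
    ((Quotient.out ω.2.1 : (𝓞 K)ˣ) * (ζ : (𝓞 K)ˣ)⁻¹)
  refine h.of_mul_sq_eq (g := 1) (h := v) one_ne_zero v.ne_zero ?_
  have hv' := congrArg (fun z : (𝓞 K)ˣ => (z : 𝓞 K)) hv
  simp only [Units.val_mul, Units.val_pow_eq_pow_val] at hv'
  simp only [QuadParam.radicand, QuadParam.twist]
  calc _ = ((Quotient.out (((Quotient.out ω.2.1 : (𝓞 K)ˣ) * (ζ : (𝓞 K)ˣ)⁻¹ : (𝓞 K)ˣ) :
        UnitClasses K) : (𝓞 K)ˣ) * v ^ 2 : 𝓞 K) * (ζ : (𝓞 K)ˣ) * ω.2.2 := by ring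
    _ = _ := by rw [← hv']; simp

theorem QuadParam.IsValid.ne_zero {ω : QuadParam K} (h : ω.IsValid r) : ω.2.2 ≠ 0 :=
  int_ne_zero_of_mem_cone K h.1

theorem QuadParam.exists_eq_twist {ω ω' : QuadParam K}
    {L : IntermediateField K (AlgebraicClosure K)} (hω : ω.IsValid r) (hω' : ω'.IsValid r)
    (h : IsSqrt K ω.radicand L) (h' : IsSqrt K ω'.radicand L) : ∃ ζ, ω' = ω.twist ζ := by
  obtain ⟨g, k, hg, hk, e⟩ := h.exists_mul_sq_eq h'
  have ha := hω.ne_zero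
  have ha' := hω'.ne_zero
  obtain ⟨c, j, a⟩ := ω
  obtain ⟨c', j', a'⟩ := ω'
  simp only [QuadParam.radicand] at e ha ha'
  set u : (𝓞 K)ˣ := Quotient.out j with hu
  set u' : (𝓞 K)ˣ := Quotient.out j' with hu'
  have hassoc : Associated (a * g ^ 2) (a' * k ^ 2) := by
    refine ⟨u * u'⁻¹, ?_⟩
    rw [Units.val_mul]
    calc _ = (u * a * g ^ 2) * (↑u'⁻¹ : 𝓞 K) := by ring
      _ = (u' * (↑u'⁻¹ : 𝓞 K)) * (a' * k ^ 2) := by rw [e]; ring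
      _ = _ := by simp
  have hspan := hω.2.span_mul_eq (r.rep_ne_bot c) (r.rep_ne_bot c') ha ha' hg hk hω'.2 hassoc
  have hc : c = c' := by
    rw [← r.mk0_rep c, ← r.mk0_rep c', ClassGroup.mk0_eq_mk0_iff]
    exact ⟨g, k, hg, hk, hspan⟩
  subst hc
  obtain ⟨v, hv⟩ := Ideal.span_singleton_eq_span_singleton.1
    (mul_right_cancel₀ (r.rep_ne_bot c) hspan)
  rw [← hv] at e
  have e1 : (u : 𝓞 K) * a = u' * v ^ 2 * a' := by
    refine mul_right_cancel₀ (pow_ne_zero 2 hg) (e.trans ?_)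
    ring
  set ζ : (𝓞 K)ˣ := u * (u' * v ^ 2)⁻¹ with hζ
  have e2 : (ζ : 𝓞 K) * a = a' := by
    rw [hζ, Units.val_mul, mul_right_comm, e1]
    calc _ = (((u' * v ^ 2 : (𝓞 K)ˣ) * (u' * v ^ 2)⁻¹ : (𝓞 K)ˣ) : 𝓞 K) * a' := by
          push_cast; ring
      _ = a' := by rw [mul_inv_cancel]; simp
  have hζt : ζ ∈ torsion K := by
    rw [← unit_smul_mem_iff_mem_torsion hω.1, unit_smul_eq_iff_mul_eq.2 e2]
    exact hω'.1
  refine ⟨⟨ζ, hζt⟩, ?_⟩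
  simp only [QuadParam.twist]
  rw [e2, ← hu]
  have : ((u * ζ⁻¹ : (𝓞 K)ˣ) : UnitClasses K) = j' := by
    rw [← QuotientGroup.out_eq' j']
    refine UnitClasses.mk_eq_of_mul_sq_eq (v := 1) (v' := v) ?_
    rw [hζ, ← hu']
    simp
  rw [this]

/-- Every quadratic extension corresponds to exactly as many parameters as there are roots of
unity. -/
theorem card_quadratic_mul_card_torsion (Q : IntermediateField K (AlgebraicClosure K) → Prop) :
    Nat.card {L : IntermediateField K (AlgebraicClosure K) // finrank K L = 2 ∧ Q L} *
      Nat.card (torsion K) =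
    Nat.card {ω : QuadParam K // ω.IsValid r ∧ ∃ L, IsSqrt K ω.radicand L ∧ Q L} := by
  choose ω₀ hω₀ hs using fun L : {L : IntermediateField K (AlgebraicClosure K) //
    finrank K L = 2 ∧ Q L} => exists_param r L.2.1
  rw [← Nat.card_prod]
  refine Nat.card_congr (Equiv.ofBijective (fun x => ⟨(ω₀ x.1).twist x.2, (hω₀ x.1).twist r x.2,
    x.1.1, QuadParam.isSqrt_twist (hs x.1) x.2, x.1.2.2⟩) ⟨?_, ?_⟩)
  · rintro ⟨L, ζ⟩ ⟨L', ζ'⟩ h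
    have h1 : (ω₀ L).twist ζ = (ω₀ L').twist ζ' := congrArg Subtype.val h
    have hL : L = L' := by
      have h2 := QuadParam.isSqrt_twist (hs L) ζ
      rw [h1] at h2
      exact Subtype.ext (h2.unique (QuadParam.isSqrt_twist (hs L') ζ'))
    subst hL
    have h3 : ((ζ : (𝓞 K)ˣ) : 𝓞 K) * (ω₀ L).2.2 = ((ζ' : (𝓞 K)ˣ) : 𝓞 K) * (ω₀ L).2.2 :=
      congrArg (fun z : QuadParam K => z.2.2) h1
    have h4 := mul_right_cancel₀ (hω₀ L).ne_zero h3
    rw [Prod.mk.injEq]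
    exact ⟨rfl, Subtype.ext (Units.ext h4)⟩
  · rintro ⟨ω, hω, L, hL, hQ⟩
    obtain ⟨ζ, hζ⟩ := QuadParam.exists_eq_twist r (hω₀ ⟨L, hL.1, hQ⟩) hω (hs ⟨L, hL.1, hQ⟩) hL
    exact ⟨⟨⟨L, hL.1, hQ⟩, ζ⟩, Subtype.ext hζ.symm⟩

/-- Representatives of ideal classes can be chosen coprime to a given ideal. -/
theorem exists_classReps_isCoprime {𝔪 : Ideal (𝓞 K)} (h𝔪 : 𝔪 ≠ ⊥) :
    ∃ r : ClassReps K, ∀ c, IsCoprime 𝔪 (r.rep c : Ideal (𝓞 K)) := by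
  have : ∀ c : ClassGroup (𝓞 K), ∃ I : (Ideal (𝓞 K))⁰, ClassGroup.mk0 I = c ∧
      IsCoprime 𝔪 (I : Ideal (𝓞 K)) := by
    intro c
    obtain ⟨J, hJ⟩ := ClassGroup.mk0_surjective c⁻¹
    have hJ0 : (J : Ideal (𝓞 K)) ≠ ⊥ := nonZeroDivisors.coe_ne_zero _
    obtain ⟨a, ha⟩ := IsDedekindDomain.exists_sup_span_eq (I := (J : Ideal (𝓞 K)) * 𝔪)
      (J := J) Ideal.mul_le_left (mul_ne_zero hJ0 h𝔪)
    by_cases htop : 𝔪 = ⊤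
    · obtain ⟨I, hI⟩ := ClassGroup.mk0_surjective c
      exact ⟨I, hI, by rw [htop, ← Ideal.one_eq_top]; exact isCoprime_one_left⟩
    have haJ : a ∈ (J : Ideal (𝓞 K)) := by
      rw [← ha]; exact Ideal.mem_sup_right (Ideal.mem_span_singleton_self a)
    obtain ⟨I, hI⟩ := exists_eq_span_mul_of_mem haJ
    have hcop : 𝔪 ⊔ I = ⊤ := by
      rw [hI, ← Ideal.mul_sup] at ha
      rw [← Ideal.one_eq_top]
      exact mul_left_cancel₀ hJ0 (ha.trans (mul_one _).symm)
    have hI0 : I ≠ ⊥ := by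
      rintro rfl
      exact htop (by simpa using hcop)
    refine ⟨⟨I, mem_nonZeroDivisors_of_ne_zero hI0⟩, ?_, Ideal.isCoprime_iff_sup_eq.2 hcop⟩
    have h1 : ClassGroup.mk0 (J * ⟨I, mem_nonZeroDivisors_of_ne_zero hI0⟩) = 1 := by
      rw [ClassGroup.mk0_eq_one_iff]
      exact ⟨⟨a, hI.symm⟩⟩
    rw [map_mul, hJ] at h1
    exact (inv_mul_eq_one.1 h1).symm
  choose rep h1 h2 using this
  exact ⟨⟨rep, h1⟩, h2⟩

end Parametrization

open Module

section QuadraticExtension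

variable {K L : Type*} [Field K] [NumberField K] [Field L] [NumberField L] [Algebra K L]

theorem finrank_ringOfIntegers : finrank (𝓞 K) (𝓞 L) = finrank K L :=
  (IsFractionRing.finrank_eq (𝓞 K) K (𝓞 L) L).symm

theorem relNorm_map_of_finrank_two (h2 : finrank K L = 2) (I : Ideal (𝓞 K)) :
    Ideal.relNorm (𝓞 K) (I.map (algebraMap (𝓞 K) (𝓞 L))) = I ^ 2 := by
  rw [Ideal.relNorm_algebraMap, finrank_ringOfIntegers, h2]

theorem relNorm_span_algebraMap_of_finrank_two (h2 : finrank K L = 2) (x : 𝓞 K) :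
    Ideal.relNorm (𝓞 K) (Ideal.span {algebraMap (𝓞 K) (𝓞 L) x}) = Ideal.span {x} ^ 2 := by
  rw [← relNorm_map_of_finrank_two h2, Ideal.map_span, Set.image_singleton]

theorem relNorm_eq_top_iff {I : Ideal (𝓞 L)} : Ideal.relNorm (𝓞 K) I = ⊤ ↔ I = ⊤ := by
  constructor
  · intro h
    rw [← Ideal.absNorm_eq_one_iff, ← Ideal.absNorm_relNorm (𝓞 K), h, Ideal.absNorm_top]
  · rintro rfl
    exact Ideal.relNorm_top _

omit [NumberField K] [NumberField L] in
theorem algebraMap_notMem_range_iff {θ : 𝓞 L} :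
    (θ : L) ∉ (algebraMap K L).range ↔ ∀ r : 𝓞 K, algebraMap (𝓞 K) (𝓞 L) r ≠ θ := by
  constructor
  · rintro h r rfl
    exact h ⟨r, rfl⟩
  · rintro h ⟨r, hr⟩
    have hi : IsIntegral ℤ r := by
      rw [← isIntegral_algebraMap_iff (algebraMap K L).injective, hr]
      exact θ.2
    exact h ⟨r, hi⟩ (RingOfIntegers.ext hr)

theorem minpoly_eq_of_notMem_range (h2 : finrank K L = 2) {θ : 𝓞 L}
    (hθ : (θ : L) ∉ (algebraMap K L).range) :
    ∃ b c : 𝓞 K, minpoly (𝓞 K) θ = Polynomial.X ^ 2 + Polynomial.C b * Polynomial.X +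
      Polynomial.C c := by
  have hint : IsIntegral (𝓞 K) θ := IsIntegralClosure.isIntegral (𝓞 K) L θ
  have hmon := minpoly.monic hint
  have hdeg : (minpoly (𝓞 K) θ).natDegree = 2 := by
    have e := minpoly.isIntegrallyClosed_eq_field_fractions K L hint
    have h3 : (minpoly K (θ : L)).natDegree = (minpoly (𝓞 K) θ).natDegree := by
      rw [e]; exact hmon.natDegree_map _
    rw [← h3]
    have hKint : IsIntegral K (θ : L) := Algebra.IsIntegral.isIntegral _
    apply le_antisymm
    · rw [← h2]; exact minpoly.natDegree_le _
    · exact (minpoly.two_le_natDegree_iff hKint).2 hθ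
  refine ⟨(minpoly (𝓞 K) θ).coeff 1, (minpoly (𝓞 K) θ).coeff 0, ?_⟩
  have hc : (minpoly (𝓞 K) θ).coeff 2 = 1 := by rw [← hdeg]; exact hmon
  conv_lhs => rw [(minpoly (𝓞 K) θ).as_sum_range, hdeg]
  simp only [Finset.sum_range_succ, Finset.sum_range_zero, hc, zero_add,
    ← Polynomial.C_mul_X_pow_eq_monomial, pow_zero, mul_one, pow_one, map_one, one_mul]
  ring

theorem exists_quadratic_of_notMem_range (h2 : finrank K L = 2) {θ : 𝓞 L}
    (hθ : (θ : L) ∉ (algebraMap K L).range) :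
    ∃ b c : 𝓞 K, θ ^ 2 + algebraMap _ _ b * θ + algebraMap _ _ c = 0 := by
  obtain ⟨b, c, h⟩ := minpoly_eq_of_notMem_range h2 hθ
  refine ⟨b, c, ?_⟩
  have := minpoly.aeval (𝓞 K) θ
  rw [h] at this
  simpa using this

omit [NumberField K] [NumberField L] in
theorem quadratic_unique {θ : 𝓞 L}
    (hθ : (θ : L) ∉ (algebraMap K L).range) {b c b' c' : 𝓞 K}
    (h : θ ^ 2 + algebraMap _ _ b * θ + algebraMap _ _ c = 0)
    (h' : θ ^ 2 + algebraMap _ _ b' * θ + algebraMap _ _ c' = 0) : b = b' ∧ c = c' := by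
  have e : algebraMap (𝓞 K) (𝓞 L) (b - b') * θ = algebraMap (𝓞 K) (𝓞 L) (c' - c) := by
    rw [map_sub, map_sub]; linear_combination h - h'
  have hinj := FaithfulSMul.algebraMap_injective (𝓞 K) (𝓞 L)
  have hb : b - b' = 0 := by
    by_contra hb
    refine hθ ⟨((c' - c : 𝓞 K) : K) / ((b - b' : 𝓞 K) : K), ?_⟩
    have e' := congrArg (algebraMap (𝓞 L) L) e
    have hb' : algebraMap K L ((b - b' : 𝓞 K) : K) ≠ 0 := by
      simpa only [ne_eq, map_eq_zero, RingOfIntegers.coe_eq_zero_iff] using hb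
    rw [map_div₀, div_eq_iff hb', mul_comm]
    exact (e'.trans rfl).symm.trans (map_mul _ _ _) |>.trans rfl
  rw [hb, map_zero, zero_mul, eq_comm, map_eq_zero_iff _ hinj] at e
  exact ⟨sub_eq_zero.1 hb, (sub_eq_zero.1 e).symm⟩

theorem conductor_mul_differentIdeal_of_quadratic (h2 : finrank K L = 2) {θ : 𝓞 L}
    (hθ : (θ : L) ∉ (algebraMap K L).range) {b c : 𝓞 K}
    (h : θ ^ 2 + algebraMap _ _ b * θ + algebraMap _ _ c = 0) :
    conductor (𝓞 K) θ * differentIdeal (𝓞 K) (𝓞 L) =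
      Ideal.span {2 * θ + algebraMap _ _ b} := by
  obtain ⟨b', c', hm⟩ := minpoly_eq_of_notMem_range h2 hθ
  have := minpoly.aeval (𝓞 K) θ
  rw [hm] at this
  obtain ⟨rfl, rfl⟩ := quadratic_unique hθ h (by simpa using this)
  rw [conductor_mul_differentIdeal (𝓞 K) K L θ, hm]
  · simp [one_add_one_eq_two, map_ofNat (algebraMap (𝓞 K) (𝓞 L)) 2]
  · rw [eq_top_iff]
    rintro z -
    obtain ⟨s, t, rfl⟩ := exists_eq_add_mul_of_finrank_two h2 hθ z
    exact add_mem (Subalgebra.algebraMap_mem _ _)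
      (mul_mem (Subalgebra.algebraMap_mem _ _) (Algebra.subset_adjoin rfl))

theorem relNorm_span_of_sq_eq (h2 : finrank K L = 2) {η : 𝓞 L} {d : 𝓞 K}
    (h : η ^ 2 = algebraMap _ _ d) :
    Ideal.relNorm (𝓞 K) (Ideal.span {η}) = Ideal.span {d} := by
  have e : Ideal.relNorm (𝓞 K) (Ideal.span {η}) ^ 2 = Ideal.span {d} ^ 2 := by
    rw [← map_pow, Ideal.span_singleton_pow, h, relNorm_span_algebraMap_of_finrank_two h2]
  exact pow_left_injective two_ne_zero e

variable (K L) in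
/-- The relative discriminant ideal, as the norm of the different. -/
def relDiscIdeal : Ideal (𝓞 K) :=
  Ideal.relNorm (𝓞 K) (differentIdeal (𝓞 K) (𝓞 L))

theorem relNorm_conductor_mul_relDiscIdeal (h2 : finrank K L = 2) {θ : 𝓞 L}
    (hθ : (θ : L) ∉ (algebraMap K L).range) {b c : 𝓞 K}
    (h : θ ^ 2 + algebraMap _ _ b * θ + algebraMap _ _ c = 0) :
    Ideal.relNorm (𝓞 K) (conductor (𝓞 K) θ) * relDiscIdeal K L =
      Ideal.span {b ^ 2 - 4 * c} := by
  rw [relDiscIdeal, ← map_mul, conductor_mul_differentIdeal_of_quadratic h2 hθ h]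
  refine relNorm_span_of_sq_eq h2 ?_
  simp only [map_sub, map_pow, map_mul, map_ofNat]
  linear_combination 4 * h

omit [NumberField L] in
theorem discr_ne_zero_of_notMem_range {θ : 𝓞 L}
    (hθ : (θ : L) ∉ (algebraMap K L).range) {b c : 𝓞 K}
    (h : θ ^ 2 + algebraMap _ _ b * θ + algebraMap _ _ c = 0) : b ^ 2 - 4 * c ≠ 0 := by
  intro h0
  have : CharZero L := charZero_of_injective_algebraMap (algebraMap K L).injective
  have e : (2 * θ + algebraMap _ _ b) ^ 2 = algebraMap (𝓞 K) (𝓞 L) (b ^ 2 - 4 * c) := by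
    simp only [map_sub, map_pow, map_mul, map_ofNat]
    linear_combination 4 * h
  rw [h0, map_zero, sq_eq_zero_iff] at e
  refine hθ ⟨-(b : K) / 2, ?_⟩
  have e' := congrArg (algebraMap (𝓞 L) L) e
  rw [map_add, map_mul, map_ofNat, map_zero] at e'
  rw [map_div₀, map_neg, map_ofNat, div_eq_iff two_ne_zero]
  have e2 : algebraMap (𝓞 L) L (algebraMap (𝓞 K) (𝓞 L) b) = algebraMap K L b := rfl
  rw [e2] at e'
  linear_combination -e'

variable (K L) in
theorem exists_notMem_range (h2 : finrank K L = 2) :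
    ∃ θ : 𝓞 L, (θ : L) ∉ (algebraMap K L).range := by
  have hne : ∃ y : L, y ∉ (algebraMap K L).range := by
    by_contra! hall
    have : (⊥ : Subalgebra K L) = ⊤ := by
      rw [eq_top_iff]
      intro y _
      exact Algebra.mem_bot.2 (hall y)
    have h3 := subalgebra_top_finrank_eq_submodule_top_finrank (F := K) (E := L)
    rw [← this, Subalgebra.finrank_bot, finrank_top, h2] at h3
    omega
  obtain ⟨y, hy⟩ := hne
  obtain ⟨u, v, hv, rfl⟩ := IsFractionRing.div_surjective (A := 𝓞 L) y
  by_contra! hall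
  obtain ⟨a, ha⟩ := hall u
  obtain ⟨b, hb⟩ := hall v
  exact hy ⟨a / b, by rw [map_div₀, ha, hb]⟩

theorem relDiscIdeal_ne_bot (h2 : finrank K L = 2) : relDiscIdeal K L ≠ ⊥ := by
  obtain ⟨θ, hθ⟩ := exists_notMem_range K L h2
  obtain ⟨b, c, h⟩ := exists_quadratic_of_notMem_range h2 hθ
  intro h0
  have := relNorm_conductor_mul_relDiscIdeal h2 hθ h
  rw [h0, Ideal.mul_bot, eq_comm, Ideal.span_singleton_eq_bot] at this
  exact discr_ne_zero_of_notMem_range hθ h this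

theorem ordAt_relDiscIdeal_le (p : IsDedekindDomain.HeightOneSpectrum (𝓞 K))
    (h2 : finrank K L = 2) {θ : 𝓞 L}
    (hθ : (θ : L) ∉ (algebraMap K L).range) {b c : 𝓞 K}
    (h : θ ^ 2 + algebraMap _ _ b * θ + algebraMap _ _ c = 0) :
    ordAt p (relDiscIdeal K L) ≤ ordAt p (Ideal.span {b ^ 2 - 4 * c}) := by
  have e := relNorm_conductor_mul_relDiscIdeal h2 hθ h
  have hne := span_singleton_ne_bot (discr_ne_zero_of_notMem_range hθ h)
  rw [← e] at hne ⊢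
  rw [ordAt_mul p (left_ne_zero_of_mul hne) (right_ne_zero_of_mul hne)]
  exact Nat.le_add_left _ _

theorem finrank_quotient_of_finrank_two (p : IsDedekindDomain.HeightOneSpectrum (𝓞 K))
    (h2 : finrank K L = 2) :
    finrank (𝓞 K ⧸ p.asIdeal) (𝓞 L ⧸ p.asIdeal.map (algebraMap (𝓞 K) (𝓞 L))) = 2 := by
  let := Ideal.Quotient.field p.asIdeal
  have hf : Finite (𝓞 K ⧸ p.asIdeal) := Ideal.finiteQuotientOfFreeOfNeBot _ p.ne_bot
  have h := Ideal.absNorm_algebraMap (𝓞 K) (𝓞 L) p.asIdeal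
  rw [finrank_ringOfIntegers, h2] at h
  have h1 : Nat.card (𝓞 L ⧸ p.asIdeal.map (algebraMap (𝓞 K) (𝓞 L))) =
      Nat.card (𝓞 K ⧸ p.asIdeal) ^ 2 := h
  rw [Module.natCard_eq_pow_finrank (K := 𝓞 K ⧸ p.asIdeal)] at h1
  exact Nat.pow_right_injective (two_le_absNorm K p) h1

theorem exists_sub_notMem_map (p : IsDedekindDomain.HeightOneSpectrum (𝓞 K))
    (h2 : finrank K L = 2) :
    ∃ θ : 𝓞 L, ∀ r : 𝓞 K,
      θ - algebraMap _ _ r ∉ p.asIdeal.map (algebraMap (𝓞 K) (𝓞 L)) := by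
  let := Ideal.Quotient.field p.asIdeal
  set pB := p.asIdeal.map (algebraMap (𝓞 K) (𝓞 L)) with hpB
  have hfin : finrank (𝓞 K ⧸ p.asIdeal) (𝓞 L ⧸ pB) = 2 := finrank_quotient_of_finrank_two p h2
  have : Nontrivial (𝓞 L ⧸ pB) := Module.nontrivial_of_finrank_pos (R := 𝓞 K ⧸ p.asIdeal) (by omega)
  have hne : ∃ y : 𝓞 L ⧸ pB, y ∉ (algebraMap (𝓞 K ⧸ p.asIdeal) (𝓞 L ⧸ pB)).range := by
    by_contra! hall
    have : (⊥ : Subalgebra (𝓞 K ⧸ p.asIdeal) (𝓞 L ⧸ pB)) = ⊤ := by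
      rw [eq_top_iff]
      intro y _
      exact Algebra.mem_bot.2 (hall y)
    have h3 := subalgebra_top_finrank_eq_submodule_top_finrank (F := 𝓞 K ⧸ p.asIdeal) (E := 𝓞 L ⧸ pB)
    rw [← this, Subalgebra.finrank_bot, finrank_top, hfin] at h3
    omega
  obtain ⟨y, hy⟩ := hne
  obtain ⟨θ, rfl⟩ := Ideal.Quotient.mk_surjective y
  refine ⟨θ, fun r hr => hy ⟨Ideal.Quotient.mk _ r, ?_⟩⟩
  exact (Ideal.Quotient.eq.2 hr).symm

theorem exists_ordAt_relDiscIdeal_eq (p : IsDedekindDomain.HeightOneSpectrum (𝓞 K))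
    (h2 : finrank K L = 2) :
    ∃ (θ : 𝓞 L) (b c : 𝓞 K), (θ : L) ∉ (algebraMap K L).range ∧
      θ ^ 2 + algebraMap _ _ b * θ + algebraMap _ _ c = 0 ∧
      ordAt p (relDiscIdeal K L) = ordAt p (Ideal.span {b ^ 2 - 4 * c}) := by
  let := Ideal.Quotient.field p.asIdeal
  set pB := p.asIdeal.map (algebraMap (𝓞 K) (𝓞 L)) with hpB
  have hfin : finrank (𝓞 K ⧸ p.asIdeal) (𝓞 L ⧸ pB) = 2 := finrank_quotient_of_finrank_two p h2
  have : Nontrivial (𝓞 L ⧸ pB) := Module.nontrivial_of_finrank_pos (R := 𝓞 K ⧸ p.asIdeal) (by omega)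
  obtain ⟨θ, hθp⟩ := exists_sub_notMem_map (L := L) p h2
  have hy : Ideal.Quotient.mk pB θ ∉ (algebraMap (𝓞 K ⧸ p.asIdeal) (𝓞 L ⧸ pB)).range := by
    rintro ⟨r, hr⟩
    obtain ⟨r, rfl⟩ := Ideal.Quotient.mk_surjective r
    exact hθp r (Ideal.Quotient.eq.1 hr.symm)
  have hθ : (θ : L) ∉ (algebraMap K L).range := by
    rw [algebraMap_notMem_range_iff]
    rintro r rfl
    exact hy ⟨Ideal.Quotient.mk _ r, rfl⟩
  obtain ⟨b, c, h⟩ := exists_quadratic_of_notMem_range h2 hθ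
  refine ⟨θ, b, c, hθ, h, ?_⟩
  let N : Submodule (𝓞 K) (𝓞 L) := Submodule.span (𝓞 K) {1, θ}
  have hle : (⊤ : Submodule (𝓞 K) (𝓞 L ⧸ N)) ≤ p.asIdeal • ⊤ := by
    rintro z -
    obtain ⟨β, rfl⟩ := Submodule.Quotient.mk_surjective N z
    obtain ⟨s, t, hst⟩ := exists_eq_add_mul_of_finrank_two hfin hy (Ideal.Quotient.mk pB β)
    obtain ⟨s, rfl⟩ := Ideal.Quotient.mk_surjective s
    obtain ⟨t, rfl⟩ := Ideal.Quotient.mk_surjective t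
    have hmem : β - (algebraMap _ _ s + algebraMap _ _ t * θ) ∈ pB := by
      rw [← Ideal.Quotient.eq]
      exact hst
    have hN : algebraMap (𝓞 K) (𝓞 L) s + algebraMap (𝓞 K) (𝓞 L) t * θ ∈ N := by
      refine add_mem ?_ ?_
      · rw [Algebra.algebraMap_eq_smul_one]
        exact N.smul_mem _ (Submodule.subset_span (by simp))
      · rw [← Algebra.smul_def]
        exact N.smul_mem _ (Submodule.subset_span (by simp))
    have e : Submodule.Quotient.mk (p := N) β =
        N.mkQ (β - (algebraMap _ _ s + algebraMap _ _ t * θ)) := by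
      rw [Submodule.mkQ_apply, eq_comm, Submodule.Quotient.eq]
      simpa using neg_mem hN
    rw [e]
    have h3 : β - (algebraMap _ _ s + algebraMap _ _ t * θ) ∈
        (p.asIdeal • ⊤ : Submodule (𝓞 K) (𝓞 L)) := by
      rw [Ideal.smul_top_eq_map]
      exact hmem
    have h4 := Submodule.mem_map_of_mem (f := N.mkQ) h3
    rw [Submodule.map_smul''] at h4
    exact Submodule.smul_mono le_rfl le_top h4
  obtain ⟨r, hr, hr0⟩ := Submodule.exists_sub_one_mem_and_smul_eq_zero_of_fg_of_le_smul
    p.asIdeal ⊤ Module.Finite.fg_top hle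
  have hrp : r ∉ p.asIdeal := fun hrp =>
    p.isPrime.ne_top ((Ideal.eq_top_iff_one _).2 (by simpa using sub_mem hrp hr))
  have hr1 : r ≠ 0 := by rintro rfl; simp at hrp
  have hcond : algebraMap _ _ r ∈ conductor (𝓞 K) θ := by
    rw [mem_conductor_iff]
    intro β
    have := hr0 (Submodule.Quotient.mk β) trivial
    rw [← Submodule.Quotient.mk_smul, Submodule.Quotient.mk_eq_zero, Algebra.smul_def] at this
    have hN : N ≤ Subalgebra.toSubmodule (Algebra.adjoin (𝓞 K) {θ}) := by
      rw [Submodule.span_le]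
      rintro x (rfl | rfl)
      · exact one_mem (Algebra.adjoin (𝓞 K) {θ})
      · exact Algebra.subset_adjoin rfl
    exact hN this
  have hdvd : Ideal.relNorm (𝓞 K) (conductor (𝓞 K) θ) ∣ Ideal.span {r} ^ 2 := by
    rw [← relNorm_span_algebraMap_of_finrank_two h2]
    exact map_dvd _ (Ideal.dvd_span_singleton.2 hcond)
  have hc0 : Ideal.relNorm (𝓞 K) (conductor (𝓞 K) θ) ≠ ⊥ := by
    rintro h0
    rw [h0] at hdvd
    exact pow_ne_zero 2 (span_singleton_ne_bot hr1) (zero_dvd_iff.1 hdvd)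
  rw [← relNorm_conductor_mul_relDiscIdeal h2 hθ h, ordAt_mul p hc0 (relDiscIdeal_ne_bot h2),
    (ordAt_eq_zero_iff p hc0).2, zero_add]
  intro hle
  exact hrp (p.isPrime.mem_of_pow_mem 2
    (hle (Ideal.le_of_dvd hdvd (Ideal.pow_mem_pow (Ideal.mem_span_singleton_self r) 2))))

end QuadraticExtension

open Module IsDedekindDomain

section PrimeDecomposition

variable {K L : Type*} [Field K] [NumberField K] [Field L] [NumberField L] [Algebra K L]

theorem isPrime_of_relNorm_eq (p : HeightOneSpectrum (𝓞 K)) {P : Ideal (𝓞 L)}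
    (h : Ideal.relNorm (𝓞 K) P = p.asIdeal) : P.IsPrime := by
  have hP : P ≠ ⊥ := by
    rintro rfl
    exact p.ne_bot (by rw [← h, Ideal.relNorm_bot])
  refine Ideal.isPrime_of_prime (irreducible_iff_prime.1 ⟨?_, ?_⟩)
  · rw [Ideal.isUnit_iff, ← relNorm_eq_top_iff (K := K), h]
    exact p.isPrime.ne_top
  · rintro I J rfl
    rw [map_mul] at h
    have hp := (Ideal.prime_of_isPrime p.ne_bot p.isPrime).irreducible
    have := hp.isUnit_or_isUnit h.symm
    rwa [Ideal.isUnit_iff, Ideal.isUnit_iff, relNorm_eq_top_iff, relNorm_eq_top_iff,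
      ← Ideal.isUnit_iff, ← Ideal.isUnit_iff] at this

theorem relNorm_eq_of_mul_eq_map (p : HeightOneSpectrum (𝓞 K)) (h2 : finrank K L = 2)
    {P J : Ideal (𝓞 L)} (h : p.asIdeal.map (algebraMap (𝓞 K) (𝓞 L)) = P * J)
    (hP : P ≠ ⊤) (hJ : J ≠ ⊤) : Ideal.relNorm (𝓞 K) P = p.asIdeal := by
  have hp := Ideal.prime_of_isPrime p.ne_bot p.isPrime
  have e : Ideal.relNorm (𝓞 K) P * Ideal.relNorm (𝓞 K) J = p.asIdeal ^ 2 := by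
    rw [← map_mul, ← h, relNorm_map_of_finrank_two h2]
  obtain ⟨i, hi, hi'⟩ := (dvd_prime_pow hp 2).1 (Dvd.intro _ e)
  rw [associated_iff_eq] at hi'
  interval_cases i
  · rw [pow_zero, Ideal.one_eq_top, relNorm_eq_top_iff] at hi'
    exact absurd hi' hP
  · rw [hi', pow_one]
  · rw [hi'] at e
    have := mul_left_cancel₀ (pow_ne_zero 2 p.ne_bot) (e.trans (mul_one _).symm)
    rw [Ideal.one_eq_top, relNorm_eq_top_iff] at this
    exact absurd this hJ

theorem map_ne_top_of_finrank_two (p : HeightOneSpectrum (𝓞 K)) (h2 : finrank K L = 2) :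
    p.asIdeal.map (algebraMap (𝓞 K) (𝓞 L)) ≠ ⊤ := by
  rw [Ne, ← relNorm_eq_top_iff (K := K), relNorm_map_of_finrank_two h2, ← Ideal.one_eq_top,
    ← Ideal.isUnit_iff.trans Ideal.one_eq_top.symm.congr_right, isUnit_pow_iff two_ne_zero,
    Ideal.isUnit_iff]
  exact p.isPrime.ne_top

omit [NumberField K] [NumberField L] in
theorem map_ne_bot (p : HeightOneSpectrum (𝓞 K)) :
    p.asIdeal.map (algebraMap (𝓞 K) (𝓞 L)) ≠ ⊥ :=
  fun h => p.ne_bot ((Ideal.map_eq_bot_iff_of_injective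
    (FaithfulSMul.algebraMap_injective (𝓞 K) (𝓞 L))).1 h)

theorem isPrime_or_exists_mul_eq_map (p : HeightOneSpectrum (𝓞 K)) (h2 : finrank K L = 2) :
    (p.asIdeal.map (algebraMap (𝓞 K) (𝓞 L))).IsPrime ∨
      ∃ P Q : Ideal (𝓞 L), Ideal.relNorm (𝓞 K) P = p.asIdeal ∧
        Ideal.relNorm (𝓞 K) Q = p.asIdeal ∧
        p.asIdeal.map (algebraMap (𝓞 K) (𝓞 L)) = P * Q := by
  obtain ⟨P, hP, hle⟩ := Ideal.exists_le_maximal _ (map_ne_top_of_finrank_two (L := L) p h2)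
  obtain ⟨J, hJ⟩ := Ideal.dvd_iff_le.2 hle
  by_cases hJt : J = ⊤
  · left
    rw [hJ, hJt, Ideal.mul_top]
    exact hP.isPrime
  · exact .inr ⟨P, J, relNorm_eq_of_mul_eq_map p h2 hJ hP.ne_top hJt,
      relNorm_eq_of_mul_eq_map p h2 (hJ.trans (mul_comm _ _)) hJt hP.ne_top, hJ⟩

theorem algebraMap_mem_of_relNorm_eq (p : HeightOneSpectrum (𝓞 K)) {P : Ideal (𝓞 L)}
    (h : Ideal.relNorm (𝓞 K) P = p.asIdeal) {r : 𝓞 K} :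
    algebraMap _ _ r ∈ P ↔ r ∈ p.asIdeal := by
  have hle : p.asIdeal ≤ P.comap (algebraMap (𝓞 K) (𝓞 L)) := by
    rw [← h]; exact Ideal.relNorm_le_comap _ P
  have hP := isPrime_of_relNorm_eq p h
  have : p.asIdeal = P.comap (algebraMap (𝓞 K) (𝓞 L)) :=
    p.isMaximal.eq_of_le (hP.comap _).ne_top hle
  rw [this, Ideal.mem_comap]

theorem exists_sub_mem_of_relNorm_eq (p : HeightOneSpectrum (𝓞 K)) {P : Ideal (𝓞 L)}
    (h : Ideal.relNorm (𝓞 K) P = p.asIdeal) (β : 𝓞 L) :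
    ∃ r : 𝓞 K, β - algebraMap _ _ r ∈ P := by
  have hle : ∀ r ∈ p.asIdeal, algebraMap (𝓞 K) (𝓞 L) r ∈ P := fun r hr =>
    (algebraMap_mem_of_relNorm_eq p h).2 hr
  let φ : 𝓞 K ⧸ p.asIdeal →+* 𝓞 L ⧸ P :=
    Ideal.Quotient.lift p.asIdeal ((Ideal.Quotient.mk P).comp (algebraMap (𝓞 K) (𝓞 L)))
      fun r hr => Ideal.Quotient.eq_zero_iff_mem.2 (hle r hr)
  have hinj : Function.Injective φ := by
    rw [injective_iff_map_eq_zero]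
    intro x hx
    obtain ⟨r, rfl⟩ := Ideal.Quotient.mk_surjective x
    rw [Ideal.Quotient.lift_mk, RingHom.comp_apply, Ideal.Quotient.eq_zero_iff_mem,
      algebraMap_mem_of_relNorm_eq p h] at hx
    exact Ideal.Quotient.eq_zero_iff_mem.2 hx
  have hP : P ≠ ⊥ := by
    rintro rfl
    exact p.ne_bot (by rw [← h, Ideal.relNorm_bot])
  have : Finite (𝓞 L ⧸ P) := Ideal.finiteQuotientOfFreeOfNeBot _ hP
  have hcard : Nat.card (𝓞 L ⧸ P) ≤ Nat.card (𝓞 K ⧸ p.asIdeal) := by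
    have := Ideal.absNorm_relNorm (𝓞 K) (𝓞 L) P
    rw [h] at this
    exact this.ge
  obtain ⟨x, hx⟩ := (hinj.bijective_of_nat_card_le hcard).surjective (Ideal.Quotient.mk P β)
  obtain ⟨r, rfl⟩ := Ideal.Quotient.mk_surjective x
  exact ⟨r, Ideal.Quotient.eq.1 hx.symm⟩

end PrimeDecomposition

open Module IsDedekindDomain

section SplittingCriterion

variable {K L : Type*} [Field K] [NumberField K] [Field L] [NumberField L] [Algebra K L]

theorem discr_mem_of_sub_mem_map (p : HeightOneSpectrum (𝓞 K)) (h2 : finrank K L = 2) {θ : 𝓞 L}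
    (hθ : (θ : L) ∉ (algebraMap K L).range) {b c : 𝓞 K}
    (h : θ ^ 2 + algebraMap _ _ b * θ + algebraMap _ _ c = 0) {u : 𝓞 K}
    (hu : θ - algebraMap _ _ u ∈ p.asIdeal.map (algebraMap (𝓞 K) (𝓞 L))) :
    b ^ 2 - 4 * c ∈ p.asIdeal := by
  obtain ⟨π, hπ, hπ2⟩ : ∃ π ∈ p.asIdeal, π ∉ p.asIdeal ^ 2 := by
    by_contra! hall
    have hlt := Ideal.pow_right_strictAnti p.asIdeal p.ne_bot p.isPrime.ne_top one_lt_two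
    simp only [pow_one] at hlt
    exact hlt.not_ge hall
  have hπ0 : π ≠ 0 := by rintro rfl; exact hπ2 (zero_mem _)
  have hord : ordAt p (Ideal.span {π}) = 1 := by
    have h1 := (mem_pow_iff_le_ordAt p (n := 1) hπ0).1 (by simpa using hπ)
    have h2 := (mem_pow_iff_le_ordAt p (n := 2) hπ0).not.1 hπ2
    omega
  obtain ⟨G, hG, hGd⟩ := exists_notMem_forall_dvd p hπ0
  have hdvd : ∀ z ∈ p.asIdeal.map (algebraMap (𝓞 K) (𝓞 L)),
      algebraMap _ _ π ∣ algebraMap _ _ G * z := by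
    intro z hz
    refine Submodule.span_induction ?_ ?_ ?_ ?_ hz
    · rintro _ ⟨x, hx, rfl⟩
      rw [← map_mul]
      refine map_dvd _ ?_
      simpa using hGd 1 x (by simpa [hord] using hx)
    · simp
    · intro x y _ _ hx hy
      rw [mul_add]; exact dvd_add hx hy
    · intro a x _ hx
      rw [smul_eq_mul, mul_left_comm]
      exact hx.mul_left a
  obtain ⟨γ, hγ⟩ := hdvd _ hu
  have hG0 : G ≠ 0 := by rintro rfl; simp at hG
  have hinj := FaithfulSMul.algebraMap_injective (𝓞 K) (𝓞 L)
  have hGθ : ((algebraMap _ _ G * (θ - algebraMap _ _ u) : 𝓞 L) : L) ∉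
      (algebraMap K L).range := by
    rintro ⟨s, hs⟩
    refine hθ ⟨s / G + u, ?_⟩
    have hG' : algebraMap K L G ≠ 0 := by
      simpa only [ne_eq, map_eq_zero, RingOfIntegers.coe_eq_zero_iff] using hG0
    rw [map_add, map_div₀, hs]
    change algebraMap K L G * (θ - algebraMap K L u) / algebraMap K L G + algebraMap K L u = θ
    field_simp
    ring
  have hγr : (γ : L) ∉ (algebraMap K L).range := by
    rintro ⟨s, hs⟩
    refine hGθ ⟨π * s, ?_⟩
    rw [hγ, map_mul, hs]
    rfl
  obtain ⟨v, w, hvw⟩ := exists_quadratic_of_notMem_range h2 hγr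
  have e1 : (algebraMap _ _ G * (θ - algebraMap _ _ u) : 𝓞 L) ^ 2 +
      algebraMap (𝓞 K) (𝓞 L) (G * (b + 2 * u)) * (algebraMap _ _ G * (θ - algebraMap _ _ u)) +
      algebraMap (𝓞 K) (𝓞 L) (G ^ 2 * (u ^ 2 + b * u + c)) = 0 := by
    simp only [map_mul, map_add, map_pow, map_ofNat]
    linear_combination algebraMap (𝓞 K) (𝓞 L) G ^ 2 * h
  have e2 : (algebraMap _ _ G * (θ - algebraMap _ _ u) : 𝓞 L) ^ 2 +
      algebraMap (𝓞 K) (𝓞 L) (π * v) * (algebraMap _ _ G * (θ - algebraMap _ _ u)) +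
      algebraMap (𝓞 K) (𝓞 L) (π ^ 2 * w) = 0 := by
    rw [hγ]
    simp only [map_mul, map_pow]
    linear_combination algebraMap (𝓞 K) (𝓞 L) π ^ 2 * hvw
  obtain ⟨e3, e4⟩ := quadratic_unique hGθ e1 e2
  have m3 : b + 2 * u ∈ p.asIdeal := by
    refine (p.isPrime.mem_or_mem (x := G) ?_).resolve_left hG
    rw [e3]; exact Ideal.mul_mem_right _ _ hπ
  have m4 : u ^ 2 + b * u + c ∈ p.asIdeal := by
    refine (p.isPrime.mem_or_mem (x := G ^ 2) ?_).resolve_left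
      fun h => hG (p.isPrime.mem_of_pow_mem 2 h)
    rw [e4]; exact Ideal.mul_mem_right _ _ (Ideal.pow_mem_of_mem _ hπ 2 two_pos)
  have : b ^ 2 - 4 * c = (b + 2 * u) * (b + 2 * u) - 4 * (u ^ 2 + b * u + c) := by ring
  rw [this]
  exact sub_mem (Ideal.mul_mem_left _ _ m3) (Ideal.mul_mem_left _ _ m4)

theorem discr_mem_of_map_eq_sq (p : HeightOneSpectrum (𝓞 K)) (h2 : finrank K L = 2)
    {P : Ideal (𝓞 L)} (hP : Ideal.relNorm (𝓞 K) P = p.asIdeal)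
    (hPp : p.asIdeal.map (algebraMap (𝓞 K) (𝓞 L)) = P * P) {θ : 𝓞 L}
    (hθ : (θ : L) ∉ (algebraMap K L).range) {b c : 𝓞 K}
    (h : θ ^ 2 + algebraMap _ _ b * θ + algebraMap _ _ c = 0) :
    b ^ 2 - 4 * c ∈ p.asIdeal := by
  obtain ⟨s, hs⟩ := exists_sub_mem_of_relNorm_eq p hP θ
  have hroot : s ^ 2 + b * s + c ∈ p.asIdeal := by
    rw [← algebraMap_mem_of_relNorm_eq p hP]
    have : algebraMap (𝓞 K) (𝓞 L) (s ^ 2 + b * s + c) =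
        (θ - algebraMap _ _ s) * -(θ + algebraMap _ _ s + algebraMap _ _ b) := by
      simp only [map_mul, map_add, map_pow]
      linear_combination h
    rw [this]
    exact Ideal.mul_mem_right _ _ hs
  by_cases hb : b + 2 * s ∈ p.asIdeal
  · have : b ^ 2 - 4 * c = (b + 2 * s) * (b + 2 * s) - 4 * (s ^ 2 + b * s + c) := by ring
    rw [this]
    exact sub_mem (Ideal.mul_mem_left _ _ hb) (Ideal.mul_mem_left _ _ hroot)
  · obtain ⟨w, hw⟩ : ∃ w, w * (b + 2 * s) - 1 ∈ p.asIdeal := by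
      obtain ⟨w, i, hi, e⟩ := p.isMaximal.exists_inv hb
      exact ⟨w, by rw [← e]; simpa using hi⟩
    refine discr_mem_of_sub_mem_map p h2 hθ h (u := w * (s ^ 2 - c)) ?_
    have h1 : (θ - algebraMap _ _ s) * (θ - algebraMap _ _ s) ∈
        p.asIdeal.map (algebraMap (𝓞 K) (𝓞 L)) := by
      rw [hPp]; exact Ideal.mul_mem_mul hs hs
    have h3 := Ideal.mem_map_of_mem (algebraMap (𝓞 K) (𝓞 L)) hw
    have e : θ - algebraMap _ _ (w * (s ^ 2 - c)) =
        -algebraMap _ _ w * ((θ - algebraMap _ _ s) * (θ - algebraMap _ _ s)) -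
          θ * algebraMap (𝓞 K) (𝓞 L) (w * (b + 2 * s) - 1) := by
      simp only [map_mul, map_add, map_sub, map_pow, map_ofNat, map_one]
      linear_combination algebraMap (𝓞 K) (𝓞 L) w * h
    rw [e]
    exact sub_mem (Ideal.mul_mem_left _ _ h1) (Ideal.mul_mem_left _ _ h3)


/-- If the discriminant of a quadratic polynomial vanishes in a finite residue field, the
polynomial has a root there. -/
theorem exists_root_of_discr_mem (p : HeightOneSpectrum (𝓞 K)) {b c : 𝓞 K}
    (h : b ^ 2 - 4 * c ∈ p.asIdeal) : ∃ r, r ^ 2 + b * r + c ∈ p.asIdeal := by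
  let := Ideal.Quotient.field p.asIdeal
  have : Finite (𝓞 K ⧸ p.asIdeal) := Ideal.finiteQuotientOfFreeOfNeBot _ p.ne_bot
  have := Fintype.ofFinite (𝓞 K ⧸ p.asIdeal)
  suffices ∃ x : 𝓞 K ⧸ p.asIdeal, x ^ 2 + Ideal.Quotient.mk _ b * x + Ideal.Quotient.mk _ c = 0 by
    obtain ⟨x, hx⟩ := this
    obtain ⟨r, rfl⟩ := Ideal.Quotient.mk_surjective x
    refine ⟨r, Ideal.Quotient.eq_zero_iff_mem.1 ?_⟩
    simpa using hx
  have h' := Ideal.Quotient.eq_zero_iff_mem.2 h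
  simp only [map_sub, map_pow, map_mul, map_ofNat] at h'
  by_cases h2 : (2 : 𝓞 K ⧸ p.asIdeal) = 0
  · have h4 : (4 : 𝓞 K ⧸ p.asIdeal) = 0 := by linear_combination 2 * h2
    have hb : Ideal.Quotient.mk p.asIdeal b = 0 := by
      rw [h4, zero_mul, sub_zero] at h'
      exact pow_eq_zero_iff two_ne_zero |>.1 h'
    have hchar : ringChar (𝓞 K ⧸ p.asIdeal) = 2 := by
      refine (Nat.dvd_prime Nat.prime_two).1 ((ringChar.spec _ 2).1 (by exact_mod_cast h2)) |>.resolve_left ?_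
      exact CharP.ringChar_ne_one
    obtain ⟨x, hx⟩ := FiniteField.isSquare_of_char_two hchar (Ideal.Quotient.mk p.asIdeal c)
    exact ⟨x, by rw [hb, hx]; linear_combination x * x * h2⟩
  · refine ⟨-Ideal.Quotient.mk p.asIdeal b / 2, ?_⟩
    field_simp
    linear_combination -h'

omit [NumberField K] [NumberField L] in
theorem notMem_range_of_quotient (p : HeightOneSpectrum (𝓞 K)) {θ : 𝓞 L}
    (h : ∀ r : 𝓞 K, θ - algebraMap _ _ r ∉ p.asIdeal.map (algebraMap (𝓞 K) (𝓞 L))) :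
    (θ : L) ∉ (algebraMap K L).range := by
  rw [algebraMap_notMem_range_iff]
  rintro r rfl
  exact h r (by simp)

variable (L) in
theorem splits_iff (p : HeightOneSpectrum (𝓞 K)) (h2 : finrank K L = 2) :
    (∃ P Q : Ideal (𝓞 L), P ≠ Q ∧ P.IsPrime ∧ Q.IsPrime ∧
      p.asIdeal.map (algebraMap (𝓞 K) (𝓞 L)) = P * Q) ↔
    ∃ (θ : 𝓞 L) (b c : 𝓞 K), (θ : L) ∉ (algebraMap K L).range ∧
      θ ^ 2 + algebraMap _ _ b * θ + algebraMap _ _ c = 0 ∧ b ^ 2 - 4 * c ∉ p.asIdeal ∧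
      ∃ r, r ^ 2 + b * r + c ∈ p.asIdeal := by
  constructor
  · rintro ⟨P, Q, hne, hP, hQ, hPQ⟩
    have hPn := relNorm_eq_of_mul_eq_map p h2 hPQ hP.ne_top hQ.ne_top
    have hQn := relNorm_eq_of_mul_eq_map p h2 (hPQ.trans (mul_comm _ _)) hQ.ne_top hP.ne_top
    have hP0 : P ≠ ⊥ := by
      rintro rfl; exact map_ne_bot p (hPQ.trans (Ideal.bot_mul _))
    have hQ0 : Q ≠ ⊥ := by
      rintro rfl; exact map_ne_bot p (hPQ.trans (Ideal.mul_bot _))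
    have hPm : P.IsMaximal := hP.isMaximal hP0
    have hQm : Q.IsMaximal := hQ.isMaximal hQ0
    obtain ⟨u, hu, v, hv, huv⟩ := Submodule.mem_sup.1
      ((Ideal.eq_top_iff_one _).1 (hPm.coprime_of_ne hQm hne))
    have hmemP : ∀ r : 𝓞 K, algebraMap _ _ r ∈ P ↔ r ∈ p.asIdeal := fun r =>
      algebraMap_mem_of_relNorm_eq p hPn
    have hmemQ : ∀ r : 𝓞 K, algebraMap _ _ r ∈ Q ↔ r ∈ p.asIdeal := fun r =>
      algebraMap_mem_of_relNorm_eq p hQn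
    have huQ : u ∉ Q := fun h => hQ.ne_top ((Ideal.eq_top_iff_one _).2 (huv ▸ add_mem h hv))
    have hur : (u : L) ∉ (algebraMap K L).range := by
      rw [algebraMap_notMem_range_iff]
      rintro r rfl
      exact huQ ((hmemQ r).2 ((hmemP r).1 hu))
    obtain ⟨b, c, h⟩ := exists_quadratic_of_notMem_range h2 hur
    have hc : c ∈ p.asIdeal := by
      rw [← hmemP]
      have : algebraMap (𝓞 K) (𝓞 L) c = u * -(u + algebraMap _ _ b) := by linear_combination h
      rw [this]
      exact Ideal.mul_mem_right _ _ hu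
    refine ⟨u, b, c, hur, h, fun hd => ?_, 0, by simpa using hc⟩
    have hb : b ∈ p.asIdeal := by
      refine p.isPrime.mem_of_pow_mem 2 ?_
      have : b ^ 2 = b ^ 2 - 4 * c + 4 * c := by ring
      rw [this]
      exact add_mem hd (Ideal.mul_mem_left _ _ hc)
    refine huQ (hQ.mem_of_pow_mem 2 ?_)
    have : u ^ 2 = -(u * algebraMap _ _ b + algebraMap _ _ c) := by linear_combination h
    rw [this]
    exact neg_mem (add_mem (Ideal.mul_mem_left _ _ ((hmemQ b).2 hb)) ((hmemQ c).2 hc))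
  · rintro ⟨θ, b, c, hθ, h, hd, r, hr⟩
    rcases isPrime_or_exists_mul_eq_map (L := L) p h2 with hpr | ⟨P, Q, hP, hQ, hPQ⟩
    · have hmem : (θ - algebraMap _ _ r) * (θ - algebraMap _ _ (-(b + r))) ∈
          p.asIdeal.map (algebraMap (𝓞 K) (𝓞 L)) := by
        have e : (θ - algebraMap _ _ r) * (θ - algebraMap _ _ (-(b + r))) =
            -algebraMap (𝓞 K) (𝓞 L) (r ^ 2 + b * r + c) := by
          simp only [map_mul, map_add, map_neg, map_pow]
          linear_combination h
        rw [e]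
        exact neg_mem (Ideal.mem_map_of_mem _ hr)
      rcases hpr.mem_or_mem hmem with hm | hm
      · exact absurd (discr_mem_of_sub_mem_map p h2 hθ h hm) hd
      · exact absurd (discr_mem_of_sub_mem_map p h2 hθ h hm) hd
    · refine ⟨P, Q, ?_, isPrime_of_relNorm_eq p hP, isPrime_of_relNorm_eq p hQ, hPQ⟩
      rintro rfl
      exact hd (discr_mem_of_map_eq_sq p h2 hP hPQ hθ h)

variable (L) in
theorem inert_iff (p : HeightOneSpectrum (𝓞 K)) (h2 : finrank K L = 2) :
    (p.asIdeal.map (algebraMap (𝓞 K) (𝓞 L))).IsPrime ↔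
    ∃ (θ : 𝓞 L) (b c : 𝓞 K), (θ : L) ∉ (algebraMap K L).range ∧
      θ ^ 2 + algebraMap _ _ b * θ + algebraMap _ _ c = 0 ∧ b ^ 2 - 4 * c ∉ p.asIdeal ∧
      ¬∃ r, r ^ 2 + b * r + c ∈ p.asIdeal := by
  constructor
  · intro hpr
    obtain ⟨θ, hθp⟩ := exists_sub_notMem_map (L := L) p h2
    have hθ := notMem_range_of_quotient p hθp
    obtain ⟨b, c, h⟩ := exists_quadratic_of_notMem_range h2 hθ
    have hroot : ¬∃ r, r ^ 2 + b * r + c ∈ p.asIdeal := by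
      rintro ⟨r, hr⟩
      have hmem : (θ - algebraMap _ _ r) * (θ - algebraMap _ _ (-(b + r))) ∈
          p.asIdeal.map (algebraMap (𝓞 K) (𝓞 L)) := by
        have e : (θ - algebraMap _ _ r) * (θ - algebraMap _ _ (-(b + r))) =
            -algebraMap (𝓞 K) (𝓞 L) (r ^ 2 + b * r + c) := by
          simp only [map_mul, map_add, map_neg, map_pow]
          linear_combination h
        rw [e]
        exact neg_mem (Ideal.mem_map_of_mem _ hr)
      rcases hpr.mem_or_mem hmem with hm | hm
      · exact hθp _ hm
      · exact hθp _ hm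
    exact ⟨θ, b, c, hθ, h, fun hd => hroot (exists_root_of_discr_mem p hd), hroot⟩
  · rintro ⟨θ, b, c, hθ, h, hd, hroot⟩
    refine (isPrime_or_exists_mul_eq_map (L := L) p h2).resolve_right ?_
    rintro ⟨P, Q, hP, hQ, hPQ⟩
    obtain ⟨s, hs⟩ := exists_sub_mem_of_relNorm_eq p hP θ
    refine hroot ⟨s, ?_⟩
    rw [← algebraMap_mem_of_relNorm_eq p hP]
    have : algebraMap (𝓞 K) (𝓞 L) (s ^ 2 + b * s + c) =
        (θ - algebraMap _ _ s) * -(θ + algebraMap _ _ s + algebraMap _ _ b) := by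
      simp only [map_mul, map_add, map_pow]
      linear_combination h
    rw [this]
    exact Ideal.mul_mem_right _ _ hs

variable (L) in
theorem ramifies_iff (p : HeightOneSpectrum (𝓞 K)) (h2 : finrank K L = 2) :
    (∃ P : Ideal (𝓞 L), P.IsPrime ∧ p.asIdeal.map (algebraMap (𝓞 K) (𝓞 L)) = P ^ 2) ↔
    (¬∃ P Q : Ideal (𝓞 L), P ≠ Q ∧ P.IsPrime ∧ Q.IsPrime ∧
      p.asIdeal.map (algebraMap (𝓞 K) (𝓞 L)) = P * Q) ∧
    ¬(p.asIdeal.map (algebraMap (𝓞 K) (𝓞 L))).IsPrime := by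
  constructor
  · rintro ⟨P, hP, hPp⟩
    rw [sq] at hPp
    have hPn := relNorm_eq_of_mul_eq_map p h2 hPp hP.ne_top hP.ne_top
    rw [splits_iff L p h2, inert_iff L p h2]
    constructor
    · rintro ⟨θ, b, c, hθ, h, hd, -⟩
      exact hd (discr_mem_of_map_eq_sq p h2 hPn hPp hθ h)
    · rintro ⟨θ, b, c, hθ, h, hd, -⟩
      exact hd (discr_mem_of_map_eq_sq p h2 hPn hPp hθ h)
  · rintro ⟨hs, hi⟩
    obtain ⟨P, Q, hP, hQ, hPQ⟩ := (isPrime_or_exists_mul_eq_map (L := L) p h2).resolve_left hi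
    by_cases hne : P = Q
    · subst hne
      exact ⟨P, isPrime_of_relNorm_eq p hP, hPQ.trans (sq P).symm⟩
    · exact absurd ⟨P, Q, hne, isPrime_of_relNorm_eq p hP, isPrime_of_relNorm_eq p hQ, hPQ⟩ hs

variable (L) in
omit [NumberField K] in
theorem not_splits_and_inert (p : HeightOneSpectrum (𝓞 K)) :
    ¬((∃ P Q : Ideal (𝓞 L), P ≠ Q ∧ P.IsPrime ∧ Q.IsPrime ∧
      p.asIdeal.map (algebraMap (𝓞 K) (𝓞 L)) = P * Q) ∧
    (p.asIdeal.map (algebraMap (𝓞 K) (𝓞 L))).IsPrime) := by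
  rintro ⟨⟨P, Q, -, hP, hQ, h⟩, hpr⟩
  rw [h] at hpr
  have hn := (Ideal.prime_of_isPrime (h ▸ map_ne_bot p) hpr).irreducible.isUnit_or_isUnit rfl
  rw [Ideal.isUnit_iff, Ideal.isUnit_iff] at hn
  exact hn.elim hP.ne_top hQ.ne_top

end SplittingCriterion

section FiniteFieldQuadratics

variable {F : Type*} [Field F] [Finite F]

omit [Finite F] in
theorem exists_root_iff_isSquare (h2 : (2 : F) ≠ 0) (b c : F) :
    (∃ x, x ^ 2 + b * x + c = 0) ↔ IsSquare (b ^ 2 - 4 * c) := by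
  constructor
  · rintro ⟨x, hx⟩
    exact ⟨2 * x + b, by linear_combination -4 * hx⟩
  · rintro ⟨s, hs⟩
    refine ⟨(s - b) / 2, ?_⟩
    field_simp
    linear_combination -hs

theorem isSquare_mul_iff {x y : F} (hx : x ≠ 0) (hy : y ≠ 0) :
    IsSquare (x * y) ↔ (IsSquare x ↔ IsSquare y) := by
  have := Fintype.ofFinite F
  rw [← quadraticChar_one_iff_isSquare hx, ← quadraticChar_one_iff_isSquare hy,
    ← quadraticChar_one_iff_isSquare (mul_ne_zero hx hy), map_mul]
  rcases quadraticChar_dichotomy hx with h | h <;>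
    rcases quadraticChar_dichotomy hy with h' | h' <;> rw [h, h'] <;> decide

theorem mem_range_artinSchreier_iff (h2 : (2 : F) = 0) (x y : F) :
    (∃ z, z ^ 2 + z = x + y) ↔ ((∃ z, z ^ 2 + z = x) ↔ ∃ z, z ^ 2 + z = y) := by
  let φ : F →+ F :=
    { toFun := fun z => z ^ 2 + z
      map_zero' := by simp
      map_add' := fun u v => by linear_combination u * v * h2 }
  have hker : Nat.card φ.ker = 2 := by
    have : (φ.ker : Set F) = {0, 1} := by
      ext z
      simp only [SetLike.mem_coe, AddMonoidHom.mem_ker, Set.mem_insert_iff, Set.mem_singleton_iff]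
      change z ^ 2 + z = 0 ↔ _
      constructor
      · intro h
        have : z * (z - 1) = 0 := by linear_combination h - z * h2
        rcases mul_eq_zero.1 this with h | h
        · exact .inl h
        · exact .inr (sub_eq_zero.1 h)
      · rintro (rfl | rfl)
        · simp
        · linear_combination h2
    rw [← SetLike.coe_sort_coe, this, Nat.card_coe_set_eq, Set.ncard_pair zero_ne_one]
  have hidx : φ.range.index = 2 := by
    have h3 := φ.ker.card_mul_index
    rw [AddSubgroup.index_ker, hker] at h3
    have h4 := φ.range.card_mul_index
    have h5 : Nat.card φ.range ≠ 0 := Nat.card_pos.ne'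
    rw [← h3, mul_comm 2] at h4
    exact mul_left_cancel₀ h5 h4
  exact AddSubgroup.add_mem_iff_of_index_two (H := φ.range) hidx

theorem exists_root_comp_iff {b₁ c₁ b₂ c₂ : F} (h₁ : b₁ ^ 2 - 4 * c₁ ≠ 0)
    (h₂ : b₂ ^ 2 - 4 * c₂ ≠ 0) :
    (∃ x, x ^ 2 + b₁ * b₂ * x + (b₁ ^ 2 * c₂ + b₂ ^ 2 * c₁ - 4 * c₁ * c₂) = 0) ↔
      ((∃ x, x ^ 2 + b₁ * x + c₁ = 0) ↔ ∃ x, x ^ 2 + b₂ * x + c₂ = 0) := by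
  by_cases h2 : (2 : F) = 0
  · have h4 : (4 : F) = 0 := by linear_combination 2 * h2
    have hb₁ : b₁ ≠ 0 := by rintro rfl; simp [h4] at h₁
    have hb₂ : b₂ ≠ 0 := by rintro rfl; simp [h4] at h₂
    have key : ∀ {b c : F}, b ≠ 0 → ((∃ x, x ^ 2 + b * x + c = 0) ↔ ∃ z, z ^ 2 + z = c / b ^ 2) := by
      intro b c hb
      constructor
      · rintro ⟨x, hx⟩
        refine ⟨x / b, ?_⟩
        field_simp
        linear_combination hx - c * h2
      · rintro ⟨z, hz⟩
        refine ⟨b * z, ?_⟩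
        rw [eq_div_iff (pow_ne_zero 2 hb)] at hz
        linear_combination hz + c * h2
    rw [key hb₁, key hb₂, key (mul_ne_zero hb₁ hb₂), ← mem_range_artinSchreier_iff h2]
    have : (b₁ ^ 2 * c₂ + b₂ ^ 2 * c₁ - 4 * c₁ * c₂) / (b₁ * b₂) ^ 2 =
        c₁ / b₁ ^ 2 + c₂ / b₂ ^ 2 := by
      rw [h4]; field_simp; ring
    rw [this]
  · rw [exists_root_iff_isSquare h2, exists_root_iff_isSquare h2, exists_root_iff_isSquare h2,
      ← isSquare_mul_iff h₁ h₂]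
    have : (b₁ * b₂) ^ 2 - 4 * (b₁ ^ 2 * c₂ + b₂ ^ 2 * c₁ - 4 * c₁ * c₂) =
      (b₁ ^ 2 - 4 * c₁) * (b₂ ^ 2 - 4 * c₂) := by ring
    rw [this]

variable (F) in
theorem exists_rootless_quadratic : ∃ b c : F, ¬∃ x, x ^ 2 + b * x + c = 0 := by
  have hni : ¬Function.Injective fun z : F × F => (z.1 + z.2, z.1 * z.2) := by
    intro h
    have := @h (0, 1) (1, 0) (by simp)
    simp at this
  rw [Finite.injective_iff_surjective] at hni
  simp only [Function.Surjective, not_forall] at hni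
  obtain ⟨⟨s, t⟩, hst⟩ := hni
  refine ⟨-s, t, ?_⟩
  rintro ⟨x, hx⟩
  exact hst ⟨(x, s - x), Prod.ext (by simp) (by simp; linear_combination -hx)⟩

end FiniteFieldQuadratics

section LocalInvariants

open IsDedekindDomain

variable {R : Type*} [CommRing R] [IsDedekindDomain R]

/-- The quadratic polynomial `X² + bX + c` has discriminant in the square class of `a`. -/
def IsQuadDisc (a b c : R) : Prop := ∃ H Z : R, H ≠ 0 ∧ Z ≠ 0 ∧ (b ^ 2 - 4 * c) * H ^ 2 = a * Z ^ 2

/-- Some quadratic polynomial defining the extension by `√a` is separable with a root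
modulo `p`. -/
def HasLocalRoot (p : HeightOneSpectrum R) (a : R) : Prop :=
  ∃ b c, IsQuadDisc a b c ∧ b ^ 2 - 4 * c ∉ p.asIdeal ∧ ∃ r, r ^ 2 + b * r + c ∈ p.asIdeal

/-- Some quadratic polynomial defining the extension by `√a` is separable without roots
modulo `p`. -/
def HasLocalInert (p : HeightOneSpectrum R) (a : R) : Prop :=
  ∃ b c, IsQuadDisc a b c ∧ b ^ 2 - 4 * c ∉ p.asIdeal ∧ ¬ ∃ r, r ^ 2 + b * r + c ∈ p.asIdeal

/-- The exponent at `p` of the discriminant of the extension by `√a`. -/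
def discExp (p : HeightOneSpectrum R) (a : R) : ℕ :=
  sInf {j | ∃ b c, IsQuadDisc a b c ∧ ordAt p (Ideal.span {b ^ 2 - 4 * c}) = j}

variable (p : HeightOneSpectrum R) {a a' b c : R}

theorem IsQuadDisc.discr_ne_zero (ha : a ≠ 0) (h : IsQuadDisc a b c) : b ^ 2 - 4 * c ≠ 0 := by
  obtain ⟨H, Z, hH, hZ, e⟩ := h
  intro h0
  rw [h0, zero_mul] at e
  exact mul_ne_zero ha (pow_ne_zero 2 hZ) e.symm

theorem notMem_iff_ordAt_eq_zero (ha : a ≠ 0) :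
    a ∉ p.asIdeal ↔ ordAt p (Ideal.span {a}) = 0 := by
  rw [ordAt_eq_zero_iff p (span_singleton_ne_bot ha), Ideal.span_singleton_le_iff_mem]

theorem ordAt_le_one_of_notMem (h : a ∉ p.asIdeal ^ 2) : ordAt p (Ideal.span {a}) ≤ 1 := by
  have ha : a ≠ 0 := fun h0 => h (h0 ▸ zero_mem _)
  rw [mem_pow_iff_le_ordAt p ha] at h
  omega

theorem ordAt_of_notMem_sq (h : a ∉ p.asIdeal ^ 2) :
    ordAt p (Ideal.span {a}) = if a ∈ p.asIdeal then 1 else 0 := by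
  have ha : a ≠ 0 := fun h0 => h (h0 ▸ zero_mem _)
  have h1 := ordAt_le_one_of_notMem p h
  have h2 := notMem_iff_ordAt_eq_zero p ha
  split_ifs with hm
  · have : ordAt p (Ideal.span {a}) ≠ 0 := fun h0 => h2.2 h0 hm
    omega
  · exact h2.1 hm

/-- A quadratic polynomial for `a` can be moved to one for a nearby `a'`. -/
theorem IsQuadDisc.exists_of_sub_mem (h2 : (2 : R) ≠ 0) (ha : a ∉ p.asIdeal ^ 2)
    (ha' : a' ∉ p.asIdeal ^ 2)
    (haa' : a - a' ∈ p.asIdeal ^ (2 * ordAt p (Ideal.span {(2 : R)}) + 2))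
    (h : IsQuadDisc a b c) :
    ∃ b' c', IsQuadDisc a' b' c' ∧
      ordAt p (Ideal.span {b' ^ 2 - 4 * c'}) = ordAt p (Ideal.span {b ^ 2 - 4 * c}) ∧
      ((∃ r, r ^ 2 + b' * r + c' ∈ p.asIdeal) ↔ ∃ r, r ^ 2 + b * r + c ∈ p.asIdeal) := by
  have ha0 : a ≠ 0 := fun h0 => ha (h0 ▸ zero_mem _)
  have ha0' : a' ≠ 0 := fun h0 => ha' (h0 ▸ zero_mem _)
  have hΔ := h.discr_ne_zero ha0
  obtain ⟨H, Z, hH, hZ, e⟩ := h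
  set d := ordAt p (Ideal.span {(2 : R)}) with hd
  have ho1 := ordAt_le_one_of_notMem p ha
  have hHZ : ordAt p (Ideal.span {H}) ≤ ordAt p (Ideal.span {Z}) := by
    have := congrArg (fun x => ordAt p (Ideal.span {x})) e
    simp only [ordAt_span_mul p hΔ (pow_ne_zero 2 hH), ordAt_span_mul p ha0 (pow_ne_zero 2 hZ),
      ordAt_span_pow p hH, ordAt_span_pow p hZ] at this
    omega
  obtain ⟨G₁, hG₁, hG₁'⟩ := exists_notMem_forall_dvd p hH
  obtain ⟨Z', hZ'⟩ := hG₁' 1 Z (by rwa [one_mul, mem_pow_iff_le_ordAt p hZ])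
  simp only [pow_one] at hZ'
  have hG₁0 : G₁ ≠ 0 := fun h0 => hG₁ (h0 ▸ zero_mem _)
  have hZ'0 : Z' ≠ 0 := by
    rintro rfl
    rw [mul_zero] at hZ'
    exact mul_ne_zero hG₁0 hZ hZ'
  have e₁ : (b ^ 2 - 4 * c) * G₁ ^ 2 = a * Z' ^ 2 := by
    refine mul_right_cancel₀ (pow_ne_zero 2 hH) ?_
    linear_combination G₁ ^ 2 * e + a * (G₁ * Z + H * Z') * hZ'
  obtain ⟨G₂, hG₂, hG₂'⟩ := exists_notMem_forall_dvd p h2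
  obtain ⟨t, ht⟩ := hG₂' 2 (a - a') (Ideal.pow_le_pow_right (by omega) haa')
  have hG₂0 : G₂ ≠ 0 := fun h0 => hG₂ (h0 ▸ zero_mem _)
  have htp : t ∈ p.asIdeal := by
    by_cases ht0 : t = 0
    · rw [ht0]; exact zero_mem _
    have hm : 2 ^ 2 * t ∈ p.asIdeal ^ (2 * d + 2) := ht ▸ Ideal.mul_mem_left _ _ haa'
    rw [mem_pow_iff_le_ordAt p (mul_ne_zero (pow_ne_zero 2 h2) ht0),
      ordAt_span_mul p (pow_ne_zero 2 h2) ht0, ordAt_span_pow p h2, ← hd] at hm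
    have := (mem_pow_iff_le_ordAt p ht0 (n := 1)).2 (by omega)
    rwa [pow_one] at this
  have e₂ : (b * (G₁ * G₂)) ^ 2 - 4 * (c * (G₁ * G₂) ^ 2 + t * Z' ^ 2) = a' * (G₂ * Z') ^ 2 := by
    linear_combination G₂ ^ 2 * e₁ + Z' ^ 2 * ht
  have hGp : G₁ * G₂ ∉ p.asIdeal := fun hm => (p.isPrime.mem_or_mem hm).elim hG₁ hG₂
  have hoa : ordAt p (Ideal.span {a}) = ordAt p (Ideal.span {a'}) := by
    rw [ordAt_of_notMem_sq p ha, ordAt_of_notMem_sq p ha']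
    have : a - a' ∈ p.asIdeal := Ideal.pow_le_self (by omega) haa'
    have : a ∈ p.asIdeal ↔ a' ∈ p.asIdeal := by
      constructor
      · intro h; simpa using sub_mem h this
      · intro h; simpa using add_mem this h
    simp only [this]
  refine ⟨b * (G₁ * G₂), c * (G₁ * G₂) ^ 2 + t * Z' ^ 2,
    ⟨1, G₂ * Z', one_ne_zero, mul_ne_zero hG₂0 hZ'0, by rw [e₂]; ring⟩, ?_, ?_, ?_⟩
  · have := congrArg (fun x => ordAt p (Ideal.span {x})) e₁
    simp only [ordAt_span_mul p hΔ (pow_ne_zero 2 hG₁0), ordAt_span_mul p ha0 (pow_ne_zero 2 hZ'0),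
      ordAt_span_pow p hG₁0, ordAt_span_pow p hZ'0, ordAt_span_eq_zero p hG₁] at this
    rw [e₂, ordAt_span_mul p ha0' (pow_ne_zero 2 (mul_ne_zero hG₂0 hZ'0)), ordAt_span_pow p
      (mul_ne_zero hG₂0 hZ'0), ordAt_span_mul p hG₂0 hZ'0, ordAt_span_eq_zero p hG₂]
    omega
  · rintro ⟨r, hr⟩
    obtain ⟨u, w, hw, huw⟩ := p.isMaximal.exists_inv hGp
    refine ⟨u * r, ?_⟩
    have hw' : w = 1 - u * (G₁ * G₂) := by rw [← huw]; ring
    have h1 : u * (G₁ * G₂) - 1 ∈ p.asIdeal := by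
      rw [← neg_sub, ← hw']; exact neg_mem hw
    have h3 : (u * r) ^ 2 + b * (u * r) + c =
        u ^ 2 * (r ^ 2 + b * (G₁ * G₂) * r + (c * (G₁ * G₂) ^ 2 + t * Z' ^ 2))
        - u ^ 2 * Z' ^ 2 * t
        - (b * u * r + c * (u * (G₁ * G₂) + 1)) * (u * (G₁ * G₂) - 1) := by ring
    rw [h3]
    exact sub_mem (sub_mem (Ideal.mul_mem_left _ _ hr) (Ideal.mul_mem_left _ _ htp))
      (Ideal.mul_mem_left _ _ h1)
  · rintro ⟨r, hr⟩
    refine ⟨G₁ * G₂ * r, ?_⟩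
    have h3 : (G₁ * G₂ * r) ^ 2 + b * (G₁ * G₂) * (G₁ * G₂ * r) + (c * (G₁ * G₂) ^ 2 + t * Z' ^ 2)
      = (G₁ * G₂) ^ 2 * (r ^ 2 + b * r + c) + Z' ^ 2 * t := by ring
    rw [h3]
    exact add_mem (Ideal.mul_mem_left _ _ hr) (Ideal.mul_mem_left _ _ htp)

/-- The modulus of constancy of the local invariants. -/
abbrev localLevel (p : HeightOneSpectrum R) : ℕ := 2 * ordAt p (Ideal.span {(2 : R)}) + 2

section Congr

variable (h2 : (2 : R) ≠ 0) (ha : a ∉ p.asIdeal ^ 2) (ha' : a' ∉ p.asIdeal ^ 2)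
  (haa' : a - a' ∈ p.asIdeal ^ localLevel p)

include h2 ha ha' haa'

theorem HasLocalRoot.congr (h : HasLocalRoot p a) : HasLocalRoot p a' := by
  have ha0 : a ≠ 0 := fun h0 => ha (h0 ▸ zero_mem _)
  have ha0' : a' ≠ 0 := fun h0 => ha' (h0 ▸ zero_mem _)
  obtain ⟨b, c, hq, hd, hr⟩ := h
  obtain ⟨b', c', hq', hd', hr'⟩ := hq.exists_of_sub_mem p h2 ha ha' haa'
  refine ⟨b', c', hq', ?_, hr'.2 hr⟩
  rwa [notMem_iff_ordAt_eq_zero p (hq'.discr_ne_zero ha0'), hd',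
    ← notMem_iff_ordAt_eq_zero p (hq.discr_ne_zero ha0)]

theorem HasLocalInert.congr (h : HasLocalInert p a) : HasLocalInert p a' := by
  have ha0 : a ≠ 0 := fun h0 => ha (h0 ▸ zero_mem _)
  have ha0' : a' ≠ 0 := fun h0 => ha' (h0 ▸ zero_mem _)
  obtain ⟨b, c, hq, hd, hr⟩ := h
  obtain ⟨b', c', hq', hd', hr'⟩ := hq.exists_of_sub_mem p h2 ha ha' haa'
  refine ⟨b', c', hq', ?_, fun h => hr (hr'.1 h)⟩
  rwa [notMem_iff_ordAt_eq_zero p (hq'.discr_ne_zero ha0'), hd',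
    ← notMem_iff_ordAt_eq_zero p (hq.discr_ne_zero ha0)]

theorem discExp_congr : discExp p a = discExp p a' := by
  have haa'' : a' - a ∈ p.asIdeal ^ localLevel p := by rw [← neg_sub]; exact neg_mem haa'
  unfold discExp
  congr 1
  ext j
  constructor
  · rintro ⟨b, c, hq, hj⟩
    obtain ⟨b', c', hq', hd', -⟩ := hq.exists_of_sub_mem p h2 ha ha' haa'
    exact ⟨b', c', hq', hd'.trans hj⟩
  · rintro ⟨b, c, hq, hj⟩
    obtain ⟨b', c', hq', hd', -⟩ := hq.exists_of_sub_mem p h2 ha' ha haa''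
    exact ⟨b', c', hq', hd'.trans hj⟩

end Congr

theorem discExp_eq_zero_of_exists (h : ∃ b c, IsQuadDisc a b c ∧ b ^ 2 - 4 * c ∉ p.asIdeal) :
    discExp p a = 0 := by
  obtain ⟨b, c, hq, hd⟩ := h
  exact Nat.sInf_eq_zero.2 (.inl ⟨b, c, hq, ordAt_span_eq_zero p hd⟩)

omit [IsDedekindDomain R] in
theorem discExp_le (hq : IsQuadDisc a b c) :
    discExp p a ≤ ordAt p (Ideal.span {b ^ 2 - 4 * c}) :=
  Nat.sInf_le ⟨b, c, hq, rfl⟩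

/-- At a prime not dividing two, the discriminant exponent is the parity of the exponent. -/
theorem discExp_eq_mod_two (h2 : (2 : R) ∉ p.asIdeal) (ha : a ≠ 0) :
    discExp p a = ordAt p (Ideal.span {a}) % 2 := by
  have h20 : (2 : R) ≠ 0 := fun h0 => h2 (h0 ▸ zero_mem _)
  set n := ordAt p (Ideal.span {a}) / 2 with hn
  have hlt : p.asIdeal ^ (n + 1) < p.asIdeal ^ n :=
    Ideal.pow_right_strictAnti p.asIdeal p.ne_bot p.isPrime.ne_top (Nat.lt_succ_self n)
  obtain ⟨π, hπ, hπ'⟩ := SetLike.exists_of_lt hlt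
  have hπ0 : π ≠ 0 := fun h0 => hπ' (h0 ▸ zero_mem _)
  have hπn : ordAt p (Ideal.span {π}) = n := by
    rw [mem_pow_iff_le_ordAt p hπ0] at hπ hπ'
    omega
  obtain ⟨G, hG, hG'⟩ := exists_notMem_forall_dvd p hπ0
  obtain ⟨α, hα⟩ := hG' 2 a (by rw [hπn, mem_pow_iff_le_ordAt p ha]; omega)
  have hG0 : G ≠ 0 := fun h0 => hG (h0 ▸ zero_mem _)
  have hα0 : α ≠ 0 := by
    rintro rfl
    rw [mul_zero] at hα
    exact mul_ne_zero (pow_ne_zero 2 hG0) ha hα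
  have hq : IsQuadDisc a 0 (-α) :=
    ⟨π, 2 * G, hπ0, mul_ne_zero h20 hG0, by linear_combination -4 * hα⟩
  apply le_antisymm
  · refine (discExp_le p hq).trans (le_of_eq ?_)
    have e1 := congrArg (fun x => ordAt p (Ideal.span {x})) hα
    simp only [ordAt_span_mul p (pow_ne_zero 2 hG0) ha, ordAt_span_mul p (pow_ne_zero 2 hπ0) hα0,
      ordAt_span_pow p hG0, ordAt_span_pow p hπ0, ordAt_span_eq_zero p hG, hπn] at e1
    have e2 : (0 : R) ^ 2 - 4 * -α = 2 ^ 2 * α := by ring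
    rw [e2, ordAt_span_mul p (pow_ne_zero 2 h20) hα0, ordAt_span_pow p h20,
      ordAt_span_eq_zero p h2]
    omega
  · refine le_csInf ⟨_, 0, -α, hq, rfl⟩ ?_
    rintro j ⟨b, c, hq', rfl⟩
    have hΔ := hq'.discr_ne_zero ha
    obtain ⟨H, Z, hH, hZ, e⟩ := hq'
    have := congrArg (fun x => ordAt p (Ideal.span {x})) e
    simp only [ordAt_span_mul p hΔ (pow_ne_zero 2 hH), ordAt_span_mul p ha (pow_ne_zero 2 hZ),
      ordAt_span_pow p hH, ordAt_span_pow p hZ] at this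
    omega

end LocalInvariants

section QuadraticInvariants

open Module IsDedekindDomain

variable {K L : Type*} [Field K] [NumberField K] [Field L] [NumberField L] [Algebra K L]

/-- The quadratic polynomials in the square class of `α` are those of the integral generators
of the extension by `√α`. -/
theorem isQuadDisc_iff (h2 : finrank K L = 2) {α b c : 𝓞 K} {y : L}
    (hy : y ^ 2 = algebraMap K L α) (hyr : y ∉ (algebraMap K L).range) :
    IsQuadDisc α b c ↔ ∃ θ : 𝓞 L, (θ : L) ∉ (algebraMap K L).range ∧
      θ ^ 2 + algebraMap _ _ b * θ + algebraMap _ _ c = 0 := by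
  have inj := (algebraMap K L).injective
  constructor
  · rintro ⟨H, Z, hH, hZ, e⟩
    have hH' : algebraMap K L H ≠ 0 := by
      rw [Ne, map_eq_zero_iff _ inj, RingOfIntegers.coe_eq_zero_iff]; exact hH
    have hZ' : algebraMap K L Z ≠ 0 := by
      rw [Ne, map_eq_zero_iff _ inj, RingOfIntegers.coe_eq_zero_iff]; exact hZ
    have e' := congrArg (fun x : 𝓞 K => algebraMap K L x) e
    simp only [map_mul, map_sub, map_pow, map_ofNat] at e'
    set η : L := (y * algebraMap K L Z / algebraMap K L H - algebraMap K L b) / 2 with hη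
    have hrel : η ^ 2 + algebraMap K L b * η + algebraMap K L c = 0 := by
      rw [hη]
      field_simp
      linear_combination (algebraMap K L Z) ^ 2 * hy - e'
    have hint : IsIntegral (𝓞 K) η := by
      refine ⟨.X ^ 2 + .C b * .X + .C c, by monicity!, ?_⟩
      simp only [Polynomial.eval₂_add, Polynomial.eval₂_mul, Polynomial.eval₂_X,
        Polynomial.eval₂_C, Polynomial.eval₂_pow]
      exact hrel
    have hint' : IsIntegral ℤ η := isIntegral_trans _ hint
    refine ⟨⟨η, hint'⟩, ?_, ?_⟩
    · rintro ⟨w, hw⟩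
      change algebraMap K L w = η at hw
      refine hyr ⟨(2 * w + b) * H / Z, ?_⟩
      simp only [map_div₀, map_mul, map_add, hw, map_ofNat]
      rw [hη]
      field_simp
      ring
    · exact RingOfIntegers.coe_injective hrel
  · rintro ⟨θ, hθ, hrel⟩
    have hrel' : (θ : L) ^ 2 + algebraMap K L b * θ + algebraMap K L c = 0 :=
      congrArg (fun x : 𝓞 L => (x : L)) hrel
    have hz : (2 * (θ : L) + algebraMap K L b) ^ 2 = algebraMap K L ((b ^ 2 - 4 * c : 𝓞 K) : K) := by
      simp only [map_mul, map_sub, map_pow, map_ofNat]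
      linear_combination 4 * hrel'
    have hzr : 2 * (θ : L) + algebraMap K L b ∉ (algebraMap K L).range := by
      rintro ⟨w, hw⟩
      refine hθ ⟨(w - b) / 2, ?_⟩
      simp only [map_div₀, map_sub, hw, map_ofNat]
      ring
    obtain ⟨g, h, hg, hh, e⟩ := exists_mul_sq_eq_of_finrank_two h2 hy hyr hz hzr
    exact ⟨h, g, hh, hg, e.symm⟩

section

variable (p : HeightOneSpectrum (𝓞 K)) (h2 : finrank K L = 2) {α : 𝓞 K} {y : L}
    (hy : y ^ 2 = algebraMap K L α) (hyr : y ∉ (algebraMap K L).range)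

include h2 hy hyr

theorem ordAt_relDiscIdeal_eq_discExp : ordAt p (relDiscIdeal K L) = discExp p α := by
  obtain ⟨θ, b, c, hθ, hrel, h⟩ := exists_ordAt_relDiscIdeal_eq (L := L) p h2
  have hq := (isQuadDisc_iff h2 hy hyr).2 ⟨θ, hθ, hrel⟩
  apply le_antisymm
  · refine le_csInf ⟨_, b, c, hq, rfl⟩ ?_
    rintro j ⟨b', c', hq', rfl⟩
    obtain ⟨θ', hθ', hrel'⟩ := (isQuadDisc_iff h2 hy hyr).1 hq'
    exact ordAt_relDiscIdeal_le p h2 hθ' hrel'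
  · rw [h]
    exact discExp_le p hq

theorem splits_iff_hasLocalRoot : (∃ P Q : Ideal (𝓞 L), P ≠ Q ∧ P.IsPrime ∧ Q.IsPrime ∧
    p.asIdeal.map (algebraMap (𝓞 K) (𝓞 L)) = P * Q) ↔ HasLocalRoot p α := by
  rw [splits_iff L p h2]
  constructor
  · rintro ⟨θ, b, c, hθ, hrel, h⟩
    exact ⟨b, c, (isQuadDisc_iff h2 hy hyr).2 ⟨θ, hθ, hrel⟩, h⟩
  · rintro ⟨b, c, hq, h⟩
    obtain ⟨θ, hθ, hrel⟩ := (isQuadDisc_iff h2 hy hyr).1 hq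
    exact ⟨θ, b, c, hθ, hrel, h⟩

theorem inert_iff_hasLocalInert :
    (p.asIdeal.map (algebraMap (𝓞 K) (𝓞 L))).IsPrime ↔ HasLocalInert p α := by
  rw [inert_iff L p h2]
  constructor
  · rintro ⟨θ, b, c, hθ, hrel, h⟩
    exact ⟨b, c, (isQuadDisc_iff h2 hy hyr).2 ⟨θ, hθ, hrel⟩, h⟩
  · rintro ⟨b, c, hq, h⟩
    obtain ⟨θ, hθ, hrel⟩ := (isQuadDisc_iff h2 hy hyr).1 hq
    exact ⟨θ, b, c, hθ, hrel, h⟩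

/-- The relative discriminant of the extension by `√α` in terms of `α`. -/
theorem relDiscIdeal_mul_eq (hα : α ≠ 0) {𝔟 : Ideal (𝓞 K)} (h𝔟 : 𝔟 ≠ ⊥) (hsel : IsSelected 𝔟 α)
    (S : Finset (HeightOneSpectrum (𝓞 K))) (hS2 : ∀ p ∉ S, (2 : 𝓞 K) ∉ p.asIdeal)
    (hS𝔟 : ∀ p ∈ S, ¬ 𝔟 ≤ p.asIdeal) :
    relDiscIdeal K L * 𝔟 ^ 2 * ∏ p ∈ S, p.asIdeal ^ ordAt p (Ideal.span {α}) =
      Ideal.span {α} * ∏ p ∈ S, p.asIdeal ^ discExp p α := by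
  obtain ⟨𝔞, h𝔞0, hfac, hsf⟩ := hsel.exists_factor hα
  have hD := relDiscIdeal_ne_bot (K := K) (L := L) h2
  have hP : ∀ f : HeightOneSpectrum (𝓞 K) → ℕ, ∏ p ∈ S, p.asIdeal ^ f p ≠ ⊥ := fun f =>
    Finset.prod_ne_zero_iff.2 fun q _ => pow_ne_zero _ q.ne_bot
  have h𝔟2 : 𝔟 ^ 2 ≠ ⊥ := pow_ne_zero 2 h𝔟
  have hs := span_singleton_ne_bot hα
  refine ideal_eq_of_ordAt (mul_ne_zero (mul_ne_zero hD h𝔟2) (hP _)) (mul_ne_zero hs (hP _))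
    fun q => ?_
  rw [ordAt_mul q (mul_ne_zero hD h𝔟2) (hP _), ordAt_mul q hD h𝔟2, ordAt_mul q hs (hP _),
    ordAt_prod_pow, ordAt_prod_pow, ordAt_relDiscIdeal_eq_discExp q h2 hy hyr, ordAt_pow q h𝔟]
  by_cases hq : q ∈ S
  · rw [if_pos hq, if_pos hq, (ordAt_eq_zero_iff q h𝔟).2 (hS𝔟 q hq)]
    ring
  · rw [if_neg hq, if_neg hq, discExp_eq_mod_two q (hS2 q hq) hα, hfac, ordAt_mul q h𝔞0 h𝔟2,
      ordAt_pow q h𝔟]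
    have := hsf q
    omega

end

omit [NumberField K] [NumberField L] in
/-- A real embedding extends to the extension by `√α` iff it maps `α` to a positive real. -/
theorem exists_real_extension_iff (h2 : finrank K L = 2) {α : 𝓞 K} (hα : α ≠ 0) {y : L}
    (hy : y ^ 2 = algebraMap K L α) (hyr : y ∉ (algebraMap K L).range) (σ : K →+* ℝ) :
    (∃ τ : L →+* ℝ, τ.comp (algebraMap K L) = σ) ↔ 0 < σ α := by
  constructor
  · rintro ⟨τ, rfl⟩
    refine lt_of_le_of_ne ?_ fun h => hα ?_
    · rw [RingHom.comp_apply, ← hy, map_pow]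
      exact sq_nonneg _
    · exact RingOfIntegers.coe_eq_zero_iff.1
        ((map_eq_zero_iff _ (τ.comp (algebraMap K L)).injective).1 h.symm)
  · intro hpos
    let := σ.toAlgebra
    have hpoly : (Polynomial.X ^ 2 - Polynomial.C (σ α) : Polynomial ℝ) =
        (Polynomial.X - Polynomial.C √(σ α)) * (Polynomial.X - Polynomial.C (-√(σ α))) := by
      have := Real.sq_sqrt hpos.le
      conv_lhs => rw [← this]
      simp only [map_pow, map_neg]
      ring
    have hev : Polynomial.aeval y (Polynomial.X ^ 2 - Polynomial.C (α : K)) = 0 := by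
      simp [hy]
    have hmonic : (Polynomial.X ^ 2 - Polynomial.C (α : K)).Monic := by monicity!
    have htop : IntermediateField.adjoin K {y} = ⊤ := by
      rw [eq_top_iff]
      intro z _
      obtain ⟨s, t, rfl⟩ := exists_eq_add_mul_of_finrank_two h2 hyr z
      exact add_mem (IntermediateField.algebraMap_mem _ _) (mul_mem
        (IntermediateField.algebraMap_mem _ _) (IntermediateField.mem_adjoin_simple_self K y))
    obtain ⟨φ⟩ := IntermediateField.nonempty_algHom_of_adjoin_splits (F := K) (E := L) (K := ℝ)
      (S := {y}) (fun s hs => by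
        rw [Set.mem_singleton_iff.1 hs]
        refine ⟨⟨_, hmonic, hev⟩, ?_⟩
        refine Polynomial.Splits.of_dvd (g := Polynomial.map (algebraMap K ℝ)
          (Polynomial.X ^ 2 - Polynomial.C (α : K))) ?_ ?_ ?_
        · rw [Polynomial.map_sub, Polynomial.map_pow, Polynomial.map_X, Polynomial.map_C]
          change (Polynomial.X ^ 2 - Polynomial.C (σ α) : Polynomial ℝ).Splits
          rw [hpoly]
          exact (Polynomial.Splits.X_sub_C _).mul (Polynomial.Splits.X_sub_C _)
        · exact (hmonic.map _).ne_zero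
        · exact Polynomial.map_dvd _ (minpoly.dvd K y hev)) htop
    exact ⟨φ.toRingHom, RingHom.ext fun x => φ.commutes x⟩

end QuadraticInvariants

section QuadraticSubfields

open Module IsDedekindDomain

variable {K : Type*} [Field K] [NumberField K] {L : IntermediateField K (AlgebraicClosure K)}
  {α : 𝓞 K}

theorem relDiscNorm_eq_absNorm (h2 : finrank K L = 2) [NumberField L] :
    relDiscNorm K L = (Ideal.absNorm (relDiscIdeal K L) : ℝ) := by
  have hd : ((discr K).natAbs : ℝ) ≠ 0 := by
    simpa using discr_ne_zero K
  have h := natAbs_discr_eq_absNorm_differentIdeal_mul_natAbs_discr_pow K (𝓞 K) L (𝓞 L)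
  rw [h2] at h
  rw [relDiscNorm, absDisc, dif_pos (inferInstance : FiniteDimensional ℚ L), relDiscIdeal,
    Ideal.absNorm_relNorm, h]
  push_cast
  field_simp

theorem IsSqrt.numberField (h : IsSqrt K α L) : NumberField L := by
  have : Module.Finite K L := Module.finite_of_finrank_pos (by rw [h.1]; omega)
  exact NumberField.of_module_finite K L

theorem IsSqrt.splitsIn_iff (h : IsSqrt K α L) (p : HeightOneSpectrum (𝓞 K)) :
    SplitsIn K p.asIdeal L ↔ HasLocalRoot p α := by
  have := h.numberField
  obtain ⟨y, hy, hyr⟩ := h.2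
  exact splits_iff_hasLocalRoot p h.1 hy hyr

theorem IsSqrt.inertIn_iff (h : IsSqrt K α L) (p : HeightOneSpectrum (𝓞 K)) :
    InertIn K p.asIdeal L ↔ HasLocalInert p α := by
  have := h.numberField
  obtain ⟨y, hy, hyr⟩ := h.2
  exact inert_iff_hasLocalInert p h.1 hy hyr

theorem IsSqrt.realSplitsIn_iff (h : IsSqrt K α L) (σ : K →+* ℝ) :
    RealSplitsIn K σ L ↔ 0 < σ α := by
  have := h.numberField
  obtain ⟨y, hy, hyr⟩ := h.2
  exact exists_real_extension_iff h.1 h.ne_zero hy hyr σ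

theorem ramifiesIn_iff (h2 : finrank K L = 2) (p : HeightOneSpectrum (𝓞 K)) :
    RamifiesIn K p.asIdeal L ↔ ¬ SplitsIn K p.asIdeal L ∧ ¬ InertIn K p.asIdeal L := by
  have : Module.Finite K L := Module.finite_of_finrank_pos (by rw [h2]; omega)
  have := NumberField.of_module_finite K L
  exact ramifies_iff L p h2

theorem not_splitsIn_and_inertIn (h2 : finrank K L = 2) (p : HeightOneSpectrum (𝓞 K)) :
    ¬ (SplitsIn K p.asIdeal L ∧ InertIn K p.asIdeal L) := by
  have : Module.Finite K L := Module.finite_of_finrank_pos (by rw [h2]; omega)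
  have := NumberField.of_module_finite K L
  exact not_splits_and_inert L p

theorem IsSqrt.relDiscNorm_mul_eq (h : IsSqrt K α L) {𝔟 : Ideal (𝓞 K)} (h𝔟 : 𝔟 ≠ ⊥)
    (hsel : IsSelected 𝔟 α)
    (S : Finset (HeightOneSpectrum (𝓞 K))) (hS2 : ∀ p ∉ S, (2 : 𝓞 K) ∉ p.asIdeal)
    (hS𝔟 : ∀ p ∈ S, ¬ 𝔟 ≤ p.asIdeal) :
    relDiscNorm K L * (Ideal.absNorm 𝔟 : ℝ) ^ 2 *
        ∏ p ∈ S, (Ideal.absNorm p.asIdeal : ℝ) ^ ordAt p (Ideal.span {α}) =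
      (Ideal.absNorm (Ideal.span {α}) : ℝ) *
        ∏ p ∈ S, (Ideal.absNorm p.asIdeal : ℝ) ^ discExp p α := by
  have := h.numberField
  obtain ⟨y, hy, hyr⟩ := h.2
  have e := congrArg (fun I => (Ideal.absNorm I : ℝ))
    (relDiscIdeal_mul_eq h.1 hy hyr h.ne_zero h𝔟 hsel S hS2 hS𝔟)
  simp only [map_mul, map_pow, map_prod, Nat.cast_mul, Nat.cast_pow, Nat.cast_prod] at e
  rw [relDiscNorm_eq_absNorm h.1]
  exact e

end QuadraticSubfields

section LocalMass

open IsDedekindDomain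

variable {K : Type*} [Field K] [NumberField K] (p : HeightOneSpectrum (𝓞 K))

instance fintypeQuotientPow (n : ℕ) : Fintype (𝓞 K ⧸ p.asIdeal ^ n) :=
  have := Ideal.finiteQuotientOfFreeOfNeBot (p.asIdeal ^ n) (pow_ne_zero n p.ne_bot)
  Fintype.ofFinite _

/-- The contribution of an integer satisfying `C` to the mass at `p`. -/
def localWeight (C : 𝓞 K → Prop) (a : 𝓞 K) : ℝ :=
  if a ∉ p.asIdeal ^ 2 ∧ C a then
    (Ideal.absNorm p.asIdeal : ℝ) ^ ordAt p (Ideal.span {a}) /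
      (Ideal.absNorm p.asIdeal : ℝ) ^ discExp p a
  else 0

/-- The mass at `p` of the integers satisfying a local condition `C`. -/
def localMass (C : 𝓞 K → Prop) : ℝ :=
  ∑ x : 𝓞 K ⧸ p.asIdeal ^ localLevel p, localWeight p C (Quotient.out x)

/-- A condition on integers outside `p²` that depends only on a residue class. -/
def IsLocalCondition (C : 𝓞 K → Prop) : Prop :=
  ∀ a a' : 𝓞 K, a ∉ p.asIdeal ^ 2 → a' ∉ p.asIdeal ^ 2 →
    a - a' ∈ p.asIdeal ^ localLevel p → C a → C a'

theorem isLocalCondition_hasLocalRoot : IsLocalCondition p (HasLocalRoot p) :=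
  fun _ _ ha ha' h => HasLocalRoot.congr p two_ne_zero ha ha' h

theorem isLocalCondition_hasLocalInert : IsLocalCondition p (HasLocalInert p) :=
  fun _ _ ha ha' h => HasLocalInert.congr p two_ne_zero ha ha' h

omit [NumberField K] in
theorem isLocalCondition_true : IsLocalCondition p (fun _ => True) :=
  fun _ _ _ _ _ _ => trivial

omit [NumberField K] in
variable {p} in
theorem IsLocalCondition.not_and_not {C C' : 𝓞 K → Prop} (h : IsLocalCondition p C)
    (h' : IsLocalCondition p C') : IsLocalCondition p (fun a => ¬ C a ∧ ¬ C' a) := by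
  intro a a' ha ha' haa' hC
  have haa'' : a' - a ∈ p.asIdeal ^ localLevel p := by rw [← neg_sub]; exact neg_mem haa'
  exact ⟨fun hn => hC.1 (h a' a ha' ha haa'' hn), fun hn => hC.2 (h' a' a ha' ha haa'' hn)⟩

omit [NumberField K] in
theorem two_le_localLevel : 2 ≤ localLevel p := Nat.le_add_left _ _

omit [NumberField K] in
theorem notMem_sq_of_sub_mem {a a' : 𝓞 K} (h : a - a' ∈ p.asIdeal ^ localLevel p)
    (ha : a ∉ p.asIdeal ^ 2) : a' ∉ p.asIdeal ^ 2 := fun ha' => ha (by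
  have := add_mem (Ideal.pow_le_pow_right (two_le_localLevel p) h) ha'
  simpa using this)

theorem ordAt_congr {a a' : 𝓞 K} (h : a - a' ∈ p.asIdeal ^ localLevel p)
    (ha : a ∉ p.asIdeal ^ 2) : ordAt p (Ideal.span {a}) = ordAt p (Ideal.span {a'}) := by
  rw [ordAt_of_notMem_sq p ha, ordAt_of_notMem_sq p (notMem_sq_of_sub_mem p h ha)]
  have : a - a' ∈ p.asIdeal := Ideal.pow_le_self (Nat.succ_ne_zero _) h
  have : a ∈ p.asIdeal ↔ a' ∈ p.asIdeal := by
    constructor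
    · intro h; simpa using sub_mem h this
    · intro h; simpa using add_mem this h
  simp only [this]

theorem localWeight_congr {C : 𝓞 K → Prop} (hC : IsLocalCondition p C) {a a' : 𝓞 K}
    (h : a - a' ∈ p.asIdeal ^ localLevel p) : localWeight p C a = localWeight p C a' := by
  have h' : a' - a ∈ p.asIdeal ^ localLevel p := by rw [← neg_sub]; exact neg_mem h
  unfold localWeight
  by_cases ha : a ∈ p.asIdeal ^ 2
  · have ha' : a' ∈ p.asIdeal ^ 2 := by
      by_contra hn
      exact notMem_sq_of_sub_mem p h' hn ha
    rw [if_neg (fun hh => hh.1 ha), if_neg (fun hh => hh.1 ha')]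
  · have ha' := notMem_sq_of_sub_mem p h ha
    have : C a ↔ C a' := ⟨hC a a' ha ha' h, hC a' a ha' ha h'⟩
    rw [ordAt_congr p h ha, discExp_congr p two_ne_zero ha ha' h]
    simp only [ha, ha', this]

theorem localWeight_nonneg (C : 𝓞 K → Prop) (a : 𝓞 K) : 0 ≤ localWeight p C a := by
  unfold localWeight
  split_ifs <;> positivity

omit [NumberField K] in
theorem out_mk_sub_mem (I : Ideal (𝓞 K)) (a : 𝓞 K) :
    (Quotient.out (Ideal.Quotient.mk I a) : 𝓞 K) - a ∈ I := by
  rw [← Ideal.Quotient.eq]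
  exact Quotient.out_eq _

theorem localMass_true_pos : 0 < localMass p (fun _ => True) := by
  unfold localMass
  refine Finset.sum_pos' (fun x _ => localWeight_nonneg p _ _)
    ⟨Ideal.Quotient.mk _ 1, Finset.mem_univ _, ?_⟩
  have h1 : (1 : 𝓞 K) ∉ p.asIdeal ^ 2 := by
    rw [← Ideal.eq_top_iff_one, Ideal.pow_eq_top_iff]
    simpa using p.isPrime.ne_top
  rw [localWeight_congr p (isLocalCondition_true p) (out_mk_sub_mem _ 1), localWeight,
    if_pos ⟨h1, trivial⟩]
  have : 0 < (Ideal.absNorm p.asIdeal : ℝ) := by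
    have := absNorm_pos_of_ne_bot K p.ne_bot
    exact_mod_cast this
  positivity

theorem mul_notMem_sq {g a : 𝓞 K} (hg : g ∉ p.asIdeal) (ha : a ∉ p.asIdeal ^ 2) :
    g * a ∉ p.asIdeal ^ 2 := by
  have ha0 : a ≠ 0 := fun h0 => ha (h0 ▸ zero_mem _)
  have hg0 : g ≠ 0 := fun h0 => hg (h0 ▸ zero_mem _)
  rw [mem_pow_iff_le_ordAt p ha0] at ha
  rwa [mem_pow_iff_le_ordAt p (mul_ne_zero hg0 ha0), ordAt_span_mul p hg0 ha0,
    ordAt_span_eq_zero p hg, zero_add]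

omit [NumberField K] in
theorem mk_root_iff (b c : 𝓞 K) :
    (∃ x : 𝓞 K ⧸ p.asIdeal, x ^ 2 + Ideal.Quotient.mk _ b * x + Ideal.Quotient.mk _ c = 0) ↔
      ∃ r, r ^ 2 + b * r + c ∈ p.asIdeal := by
  constructor
  · rintro ⟨x, hx⟩
    obtain ⟨r, rfl⟩ := Ideal.Quotient.mk_surjective x
    exact ⟨r, Ideal.Quotient.eq_zero_iff_mem.1 (by simpa using hx)⟩
  · rintro ⟨r, hr⟩
    exact ⟨Ideal.Quotient.mk _ r, by simpa using Ideal.Quotient.eq_zero_iff_mem.2 hr⟩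

/-- Multiplication by a suitable element prime to `p` exchanges splitting and inertness. -/
theorem exists_notMem_exchange : ∃ g ∉ p.asIdeal, ∀ a : 𝓞 K,
    (HasLocalRoot p a → HasLocalInert p (g * a)) ∧
    (HasLocalInert p a → HasLocalRoot p (g * a)) := by
  let := Ideal.Quotient.field p.asIdeal
  have : Finite (𝓞 K ⧸ p.asIdeal) := Ideal.finiteQuotientOfFreeOfNeBot _ p.ne_bot
  obtain ⟨x, y, hxy⟩ := exists_rootless_quadratic (𝓞 K ⧸ p.asIdeal)
  obtain ⟨b₀, rfl⟩ := Ideal.Quotient.mk_surjective x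
  obtain ⟨c₀, rfl⟩ := Ideal.Quotient.mk_surjective y
  have hroot : ¬∃ r, r ^ 2 + b₀ * r + c₀ ∈ p.asIdeal := by rwa [← mk_root_iff]
  have hg : b₀ ^ 2 - 4 * c₀ ∉ p.asIdeal := fun h => hroot (exists_root_of_discr_mem p h)
  have hmk : ∀ b c : 𝓞 K, b ^ 2 - 4 * c ∉ p.asIdeal →
      (Ideal.Quotient.mk p.asIdeal b) ^ 2 - 4 * Ideal.Quotient.mk p.asIdeal c ≠ 0 := by
    intro b c h h0
    refine h (Ideal.Quotient.eq_zero_iff_mem.1 ?_)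
    rwa [map_sub, map_mul, map_pow, map_ofNat]
  have key : ∀ (a b c : 𝓞 K), IsQuadDisc a b c → b ^ 2 - 4 * c ∉ p.asIdeal →
      ∃ b' c', IsQuadDisc ((b₀ ^ 2 - 4 * c₀) * a) b' c' ∧ b' ^ 2 - 4 * c' ∉ p.asIdeal ∧
        ((∃ r, r ^ 2 + b' * r + c' ∈ p.asIdeal) ↔ ¬∃ r, r ^ 2 + b * r + c ∈ p.asIdeal) := by
    rintro a b c ⟨H, Z, hH, hZ, e⟩ hd
    have hdisc : (b₀ * b) ^ 2 - 4 * (b₀ ^ 2 * c + b ^ 2 * c₀ - 4 * c₀ * c) =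
      (b₀ ^ 2 - 4 * c₀) * (b ^ 2 - 4 * c) := by ring
    refine ⟨b₀ * b, b₀ ^ 2 * c + b ^ 2 * c₀ - 4 * c₀ * c, ⟨H, Z, hH, hZ, ?_⟩, ?_, ?_⟩
    · rw [hdisc]
      linear_combination (b₀ ^ 2 - 4 * c₀) * e
    · rw [hdisc]
      exact fun hm => (p.isPrime.mem_or_mem hm).elim hg hd
    · have := exists_root_comp_iff (hmk _ _ hg) (hmk _ _ hd)
      simp only [← map_mul, ← map_pow, ← map_add, ← map_sub, mk_root_iff,
        ← map_ofNat (Ideal.Quotient.mk p.asIdeal) 4] at this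
      rw [this, iff_false_left hroot]
  refine ⟨_, hg, fun a => ⟨?_, ?_⟩⟩
  · rintro ⟨b, c, hq, hd, hr⟩
    obtain ⟨b', c', hq', hd', hr'⟩ := key a b c hq hd
    exact ⟨b', c', hq', hd', fun h => hr'.1 h hr⟩
  · rintro ⟨b, c, hq, hd, hr⟩
    obtain ⟨b', c', hq', hd', hr'⟩ := key a b c hq hd
    exact ⟨b', c', hq', hd', hr'.2 hr⟩

theorem localMass_le_of_mul {C C' : 𝓞 K → Prop} (hC' : IsLocalCondition p C')
    {g : 𝓞 K} (hg : g ∉ p.asIdeal) (h : ∀ a, C a → C' (g * a))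
    (h0 : ∀ a, C a → discExp p a = 0) (h0' : ∀ a, C' a → discExp p a = 0) :
    localMass p C ≤ localMass p C' := by
  set I := p.asIdeal ^ localLevel p with hI
  have hu : IsUnit (Ideal.Quotient.mk I g) := by
    have hcop : IsCoprime (Ideal.span {g}) I := by
      obtain ⟨y, i, hi, hyi⟩ := p.isMaximal.exists_inv hg
      exact IsCoprime.pow_right (Ideal.isCoprime_iff_exists.2
        ⟨y * g, Ideal.mem_span_singleton'.2 ⟨y, rfl⟩, i, hi, hyi⟩)
    obtain ⟨i, hi, j, hj, hij⟩ := Ideal.isCoprime_iff_exists.1 hcop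
    obtain ⟨z, rfl⟩ := Ideal.mem_span_singleton'.1 hi
    refine IsUnit.of_mul_eq_one (Ideal.Quotient.mk I z) ?_
    rw [← map_mul, ← map_one (Ideal.Quotient.mk I), Ideal.Quotient.eq, ← hij]
    have : g * z - (z * g + j) = -j := by ring
    rw [this]
    exact neg_mem hj
  obtain ⟨u, hu⟩ := hu
  unfold localMass
  rw [← Equiv.sum_comp (Units.mulLeft u) (fun x => localWeight p C' (Quotient.out x))]
  refine Finset.sum_le_sum fun x _ => ?_
  set a : 𝓞 K := Quotient.out x
  have hx : x = Ideal.Quotient.mk I a := (Quotient.out_eq x).symm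
  have hux : Units.mulLeft u x = Ideal.Quotient.mk I (g * a) := by
    rw [Units.mulLeft_apply, hu, map_mul, ← hx]
  rw [hux, localWeight_congr p hC' (out_mk_sub_mem I (g * a))]
  by_cases ha : a ∉ p.asIdeal ^ 2 ∧ C a
  · have hga := mul_notMem_sq p hg ha.1
    have hg0 : g ≠ 0 := fun h0 => hg (h0 ▸ zero_mem _)
    have ha0 : a ≠ 0 := fun h0 => ha.1 (h0 ▸ zero_mem _)
    have hCga := h a ha.2
    rw [localWeight, localWeight, if_pos ha, if_pos ⟨hga, hCga⟩, h0 a ha.2, h0' _ hCga,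
      ordAt_span_mul p hg0 ha0, ordAt_span_eq_zero p hg, zero_add]
  · rw [localWeight, if_neg ha]
    exact localWeight_nonneg p _ _

theorem localMass_hasLocalRoot_eq :
    localMass p (HasLocalRoot p) = localMass p (HasLocalInert p) := by
  obtain ⟨g, hg, h⟩ := exists_notMem_exchange p
  have hr : ∀ a, HasLocalRoot p a → discExp p a = 0 := fun a ⟨b, c, hq, hd, _⟩ =>
    discExp_eq_zero_of_exists p ⟨b, c, hq, hd⟩
  have hi : ∀ a, HasLocalInert p a → discExp p a = 0 := fun a ⟨b, c, hq, hd, _⟩ =>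
    discExp_eq_zero_of_exists p ⟨b, c, hq, hd⟩
  exact le_antisymm
    (localMass_le_of_mul p (isLocalCondition_hasLocalInert p) hg (fun a => (h a).1) hr hi)
    (localMass_le_of_mul p (isLocalCondition_hasLocalRoot p) hg (fun a => (h a).2) hi hr)

end LocalMass

section FamilyCount

open Module IsDedekindDomain mixedEmbedding fundamentalCone

variable {K : Type*} [Field K] [NumberField K]

/-- Modifying a condition at finitely many integers does not change the asymptotic count. -/
theorem tendsto_coneCount_of_finite {P P' : 𝓞 K → Prop} {F : Set (𝓞 K)} (hF : F.Finite)
    (h1 : ∀ a : 𝓞 K, mixedEmbedding K a ∈ fundamentalCone K → P' a → P a)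
    (h2 : ∀ a : 𝓞 K, mixedEmbedding K a ∈ fundamentalCone K → a ∉ F → P a → P' a) {l : ℝ}
    (h : Tendsto (fun X : ℝ => (coneCount K P X : ℝ) / X) atTop (𝓝 l)) :
    Tendsto (fun X : ℝ => (coneCount K P' X : ℝ) / X) atTop (𝓝 l) := by
  have hfin : ∀ (P : 𝓞 K → Prop) (X : ℝ), {a : 𝓞 K | mixedEmbedding K a ∈ fundamentalCone K ∧
      P a ∧ (Ideal.absNorm (Ideal.span {a}) : ℝ) ≤ X}.Finite := fun P X =>
    (setOf_mem_cone_finite K X).subset fun a ha => ⟨ha.1, ha.2.2⟩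
  have hle : ∀ X, coneCount K P' X ≤ coneCount K P X := fun X =>
    Set.ncard_le_ncard (fun a ha => ⟨ha.1, h1 a ha.1 ha.2.1, ha.2.2⟩) (hfin P X)
  have hge : ∀ X, coneCount K P X ≤ coneCount K P' X + F.ncard := fun X =>
    (Set.ncard_le_ncard (fun a ha => by
      by_cases haF : a ∈ F
      · exact .inr haF
      · exact .inl ⟨ha.1, h2 a ha.1 haF ha.2.1, ha.2.2⟩) ((hfin P' X).union hF)).trans
    (Set.ncard_union_le _ _)
  have hlow : Tendsto (fun X : ℝ => (coneCount K P X : ℝ) / X - (F.ncard : ℝ) / X) atTop (𝓝 l) := by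
    simpa using h.sub (tendsto_const_nhds.div_atTop tendsto_id)
  refine tendsto_of_tendsto_of_tendsto_of_le_of_le' hlow h ?_ ?_
  · filter_upwards [eventually_gt_atTop 0] with X hX
    rw [← sub_div]
    gcongr
    have : (coneCount K P X : ℝ) ≤ coneCount K P' X + F.ncard := by exact_mod_cast hge X
    linarith
  · filter_upwards [eventually_gt_atTop 0] with X hX
    gcongr
    exact_mod_cast hle X

/-- The set of sign conditions transported by a unit. -/
def signTwist (u : (𝓞 K)ˣ) (s : Set {w : InfinitePlace K // w.IsReal}) :
    Set {w : InfinitePlace K // w.IsReal} :=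
  {w | w ∈ s ↔ 0 < (mixedEmbedding K (u : 𝓞 K)).1 w}

theorem signSet_unit_mul_eq_iff (u : (𝓞 K)ˣ) {a : 𝓞 K}
    (ha : mixedEmbedding K a ∈ fundamentalCone K)
    (s : Set {w : InfinitePlace K // w.IsReal}) :
    signSet (mixedEmbedding K ((u * a : 𝓞 K) : K)) = s ↔
      signSet (mixedEmbedding K a) = signTwist u s := by
  have key : ∀ w : {w : InfinitePlace K // w.IsReal},
      w ∈ signSet (mixedEmbedding K ((u * a : 𝓞 K) : K)) ↔
        (w ∈ signSet (mixedEmbedding K a) ↔ 0 < (mixedEmbedding K (u : 𝓞 K)).1 w) := by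
    intro w
    have hne := isReal_apply_ne_zero_of_mem_cone K ha w
    have hu : (mixedEmbedding K (u : 𝓞 K)).1 w ≠ 0 := by
      rw [mixedEmbedding_apply_isReal]
      exact (map_ne_zero _).2 (RingOfIntegers.coe_ne_zero_iff.2 u.ne_zero)
    have hm : (mixedEmbedding K ((u * a : 𝓞 K) : K)).1 w =
        (mixedEmbedding K (u : 𝓞 K)).1 w * (mixedEmbedding K a).1 w := by
      change (mixedEmbedding K ((u : 𝓞 K) * (a : K))).1 w = _
      rw [map_mul]
      rfl
    simp only [signSet, Set.mem_ofPred_eq, hm]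
    generalize (mixedEmbedding K (u : 𝓞 K)).1 w = x at hu
    generalize (mixedEmbedding K (a : K)).1 w = y at hne
    rcases lt_or_gt_of_ne hu with h | h
    · simp [mul_nonpos_iff, h.le, h.not_ge, not_lt.2 h.le, lt_iff_le_and_ne, hne.symm]
    · simp [mul_nonpos_iff, h.le, h.not_ge, h]
  constructor
  · rintro rfl
    ext w
    have := key w
    simp only [signTwist, Set.mem_ofPred_eq]
    tauto
  · intro h
    ext w
    rw [key, h]
    simp only [signTwist, Set.mem_ofPred_eq]
    tauto

theorem absNorm_span_unit_mul (u : (𝓞 K)ˣ) (a : 𝓞 K) :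
    Ideal.absNorm (Ideal.span {(u * a : 𝓞 K)}) = Ideal.absNorm (Ideal.span {a}) := by
  rw [Ideal.span_singleton_mul_left_unit u.isUnit]

/-- A selected integer generating a square in the field has the norm of the selecting ideal
squared. -/
theorem IsSelected.absNorm_of_isSquare {𝔟 : Ideal (𝓞 K)} (h𝔟 : 𝔟 ≠ ⊥) {α : 𝓞 K} (hα : α ≠ 0)
    (h : IsSelected 𝔟 α) (hsq : IsSquare (α : K)) :
    Ideal.absNorm (Ideal.span {α}) = Ideal.absNorm 𝔟 ^ 2 := by
  obtain ⟨z, hz⟩ := hsq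
  have hzi : IsIntegral ℤ z := by
    refine IsIntegral.of_pow (n := 2) (by norm_num) ?_
    rw [sq, ← hz]
    exact α.2
  obtain ⟨w, rfl⟩ : ∃ w : 𝓞 K, (w : K) = z := ⟨⟨z, hzi⟩, rfl⟩
  have e : α = w ^ 2 := by
    apply RingOfIntegers.coe_injective
    change (α : K) = algebraMap (𝓞 K) K (w ^ 2)
    rw [map_pow, sq]
    exact hz
  have hw : w ≠ 0 := by
    rintro rfl
    exact hα (by rw [e]; ring)
  obtain ⟨𝔞, h0, h1, h2⟩ := h.exists_factor hα
  have h𝔞 : 𝔞 = ⊤ := by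
    rw [← Ideal.one_eq_top]
    refine ideal_eq_of_ordAt h0 one_ne_zero fun q => ?_
    have ho : ordAt q (1 : Ideal (𝓞 K)) = 0 := by
      rw [ordAt_eq_zero_iff q one_ne_zero, Ideal.one_eq_top, top_le_iff]
      exact q.isPrime.ne_top
    have := congrArg (ordAt q) h1
    rw [e, ordAt_span_pow q hw, ordAt_mul q h0 (pow_ne_zero 2 h𝔟), ordAt_pow q h𝔟] at this
    have := h2 q
    omega
  rw [h1, h𝔞, Ideal.top_mul, map_pow]

variable (S : Finset (HeightOneSpectrum (𝓞 K)))

/-- The modulus at which all local conditions at the primes of `S` are determined. -/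
def sieveModulus : Ideal (𝓞 K) := ∏ p ∈ S, p.asIdeal ^ localLevel p

omit [NumberField K] in
theorem sieveModulus_ne_bot : sieveModulus S ≠ ⊥ :=
  Finset.prod_ne_zero_iff.2 fun p _ => pow_ne_zero _ p.ne_bot

variable {S} in
omit [NumberField K] in
theorem sieveModulus_le {p : HeightOneSpectrum (𝓞 K)} (hp : p ∈ S) :
    sieveModulus S ≤ p.asIdeal ^ localLevel p :=
  Ideal.le_of_dvd (Finset.dvd_prod_of_mem _ hp)

theorem isCoprime_sieveModulus {q : HeightOneSpectrum (𝓞 K)} (hq : q ∉ S) :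
    IsCoprime (sieveModulus S) q.asIdeal := by
  refine IsCoprime.prod_left fun p hp => IsCoprime.pow_left ?_
  have hne : p ≠ q := fun h => hq (h ▸ hp)
  rw [Ideal.isCoprime_iff_sup_eq]
  exact p.isMaximal.coprime_of_ne q.isMaximal fun h => hne (HeightOneSpectrum.ext h)

instance fintypeQuotientSieveModulus : Fintype (𝓞 K ⧸ sieveModulus S) :=
  have := Ideal.finiteQuotientOfFreeOfNeBot (sieveModulus S) (sieveModulus_ne_bot S)
  Fintype.ofFinite _

variable {S} in
theorem sum_prod_localWeight {C : HeightOneSpectrum (𝓞 K) → 𝓞 K → Prop}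
    (hC : ∀ p ∈ S, IsLocalCondition p (C p)) :
    ∑ ρ : 𝓞 K ⧸ sieveModulus S, ∏ p ∈ S, localWeight p (C p) (Quotient.out ρ) =
      ∏ p ∈ S, localMass p (C p) := by
  let e := IsDedekindDomain.quotientEquivPiOfFinsetProdEq (s := S) (sieveModulus S)
    (fun p => p.asIdeal) (fun p => localLevel p) (fun p _ => p.prime)
    (fun p _ q _ hne h => hne (HeightOneSpectrum.ext h)) rfl
  rw [← Finset.prod_coe_sort S]
  unfold localMass
  rw [Finset.prod_univ_sum, Fintype.piFinset_univ, ← Equiv.sum_comp e.toEquiv]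
  refine Finset.sum_congr rfl fun ρ _ => ?_
  rw [← Finset.prod_coe_sort S]
  refine Finset.prod_congr rfl fun p _ => ?_
  refine localWeight_congr _ (hC p p.2) ?_
  rw [← Ideal.Quotient.eq]
  have h1 : e ρ p = Ideal.Quotient.mk _ (Quotient.out ρ : 𝓞 K) := by
    conv_lhs => rw [← Quotient.out_eq ρ]
    rfl
  change _ = Ideal.Quotient.mk _ (Quotient.out (e ρ p))
  rw [← h1]
  exact (Quotient.out_eq _).symm

end FamilyCount

section Density

open Module IsDedekindDomain mixedEmbedding fundamentalCone NumberField.Units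

variable {K : Type*} [Field K] [NumberField K]

variable (S : Finset (HeightOneSpectrum (𝓞 K)))

/-- The ratio between the norm of a selected integer in the residue class `ρ` and the relative
discriminant of the quadratic extension it generates. -/
def discScale (𝔟 : Ideal (𝓞 K)) (ρ : 𝓞 K) : ℝ :=
  (Ideal.absNorm 𝔟 : ℝ) ^ 2 * ∏ p ∈ S, (Ideal.absNorm p.asIdeal : ℝ) ^ ordAt p (Ideal.span {ρ}) /
    (Ideal.absNorm p.asIdeal : ℝ) ^ discExp p ρ

variable {S} {C : HeightOneSpectrum (𝓞 K) → 𝓞 K → Prop}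
  {T : Set {w : InfinitePlace K // w.IsReal} → Prop}
  {Q : IntermediateField K (AlgebraicClosure K) → Prop}

theorem discScale_pos {𝔟 : Ideal (𝓞 K)} (h𝔟 : 𝔟 ≠ ⊥) (ρ : 𝓞 K) : 0 < discScale S 𝔟 ρ := by
  have hpos : ∀ {I : Ideal (𝓞 K)}, I ≠ ⊥ → (0 : ℝ) < Ideal.absNorm I := fun h =>
    Nat.cast_pos.2 (Nat.pos_of_ne_zero fun h0 => h (Ideal.absNorm_eq_zero_iff.1 h0))
  exact mul_pos (pow_pos (hpos h𝔟) _) (Finset.prod_pos fun p _ =>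
    div_pos (pow_pos (hpos p.ne_bot) _) (pow_pos (hpos p.ne_bot) _))

omit [NumberField K] in
theorem IsSelected.notMem_sq {𝔟 : Ideal (𝓞 K)} {α : 𝓞 K} (h : IsSelected 𝔟 α)
    {p : HeightOneSpectrum (𝓞 K)} (hp : IsCoprime p.asIdeal 𝔟) : α ∉ p.asIdeal ^ 2 := by
  intro hα
  refine h.2 p ?_
  rw [Ideal.mul_eq_inf_of_isCoprime hp.symm.pow]
  exact ⟨h.1, hα⟩

omit [NumberField K] in
theorem isCoprime_of_mem_sieveModulus {𝔟 : Ideal (𝓞 K)} (h : IsCoprime (sieveModulus S) 𝔟)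
    {p : HeightOneSpectrum (𝓞 K)} (hp : p ∈ S) : IsCoprime p.asIdeal 𝔟 := by
  have h2 : p.asIdeal ∣ sieveModulus S :=
    (dvd_pow_self _ (by have := two_le_localLevel p; omega)).trans (Finset.dvd_prod_of_mem _ hp)
  exact h.of_isCoprime_of_dvd_left h2

/-- The quadratic extensions generated by square roots of selected integers satisfy `Q` and have
bounded discriminant precisely if the integers satisfy local conditions and have bounded norm. -/
theorem exists_isSqrt_iff (hS2 : ∀ p ∉ S, (2 : 𝓞 K) ∉ p.asIdeal)
    (hC : ∀ p ∈ S, IsLocalCondition p (C p))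
    (hQ : ∀ α L, IsSqrt K α L → (Q L ↔ (∀ p ∈ S, C p α) ∧ T (signSet (mixedEmbedding K α))))
    {𝔟 : Ideal (𝓞 K)} (h𝔟 : 𝔟 ≠ ⊥) (hco : IsCoprime (sieveModulus S) 𝔟)
    {α ρ : 𝓞 K} (hα : IsSelected 𝔟 α) (hρ : α - ρ ∈ sieveModulus S) (x : ℝ) :
    (∃ L, IsSqrt K α L ∧ Q L ∧ relDiscNorm K L ≤ x) ↔
      ((∀ p ∈ S, ρ ∉ p.asIdeal ^ 2 ∧ C p ρ) ∧ T (signSet (mixedEmbedding K α))) ∧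
        ¬ IsSquare (α : K) ∧ (Ideal.absNorm (Ideal.span {α}) : ℝ) ≤ x * discScale S 𝔟 ρ := by
  have hρp : ∀ p ∈ S, α - ρ ∈ p.asIdeal ^ localLevel p := fun p hp => sieveModulus_le hp hρ
  have hα2 : ∀ p ∈ S, α ∉ p.asIdeal ^ 2 := fun p hp =>
    hα.notMem_sq (isCoprime_of_mem_sieveModulus hco hp)
  have hρ2 : ∀ p ∈ S, ρ ∉ p.asIdeal ^ 2 := fun p hp =>
    notMem_sq_of_sub_mem p (hρp p hp) (hα2 p hp)
  have hρp' : ∀ p ∈ S, ρ - α ∈ p.asIdeal ^ localLevel p := fun p hp => by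
    have := neg_mem (hρp p hp)
    rwa [neg_sub] at this
  have hCiff : (∀ p ∈ S, ρ ∉ p.asIdeal ^ 2 ∧ C p ρ) ↔ ∀ p ∈ S, C p α :=
    forall₂_congr fun p hp => ⟨fun h => hC p hp _ _ h.1 (hα2 p hp) (hρp' p hp) h.2,
      fun h => ⟨hρ2 p hp, hC p hp _ _ (hα2 p hp) (hρ2 p hp) (hρp p hp) h⟩⟩
  have hnp : ∀ p ∈ S, ¬ 𝔟 ≤ p.asIdeal := fun p hp hle => by
    have := (Ideal.isCoprime_iff_sup_eq.1 (isCoprime_of_mem_sieveModulus hco hp))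
    rw [sup_eq_left.2 hle] at this
    exact p.isPrime.ne_top this
  have hnorm : ∀ L, IsSqrt K α L → (relDiscNorm K L ≤ x ↔
      (Ideal.absNorm (Ideal.span {α}) : ℝ) ≤ x * discScale S 𝔟 ρ) := by
    intro L hL
    have h1 := hL.relDiscNorm_mul_eq h𝔟 hα S hS2 hnp
    have h2 : relDiscNorm K L * discScale S 𝔟 ρ = Ideal.absNorm (Ideal.span {α}) := by
      have h3 : ∏ p ∈ S, (Ideal.absNorm p.asIdeal : ℝ) ^ discExp p α ≠ 0 :=
        Finset.prod_ne_zero_iff.2 fun p _ => pow_ne_zero _ <| by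
          exact_mod_cast (absNorm_pos_of_ne_bot K p.ne_bot).ne'
      have h4 : discScale S 𝔟 ρ = discScale S 𝔟 α := by
        unfold discScale
        congr 1
        refine Finset.prod_congr rfl fun p hp => ?_
        rw [ordAt_congr p (hρp p hp) (hα2 p hp),
          discExp_congr p two_ne_zero (hα2 p hp) (hρ2 p hp) (hρp p hp)]
      rw [h4, discScale, Finset.prod_div_distrib, ← mul_assoc, ← mul_div_assoc, h1,
        mul_div_cancel_right₀ _ h3]
    rw [← h2]
    exact (mul_le_mul_iff_left₀ (discScale_pos h𝔟 ρ)).symm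
  rw [hCiff]
  constructor
  · rintro ⟨L, hL, h1, h2⟩
    exact ⟨(hQ α L hL).1 h1, hL.not_isSquare, (hnorm L hL).1 h2⟩
  · rintro ⟨h1, h2, h3⟩
    obtain ⟨L, hL⟩ := exists_isSqrt α h2
    exact ⟨L, hL, (hQ α L hL).2 h1, (hnorm L hL).2 h3⟩

/-- The condition on the last coordinate of a parameter of a quadratic extension satisfying the
local conditions, in terms of the residue class and the signs of the radicand. -/
def IsFamilyMember (S : Finset (HeightOneSpectrum (𝓞 K))) (C : HeightOneSpectrum (𝓞 K) → 𝓞 K → Prop)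
    (T : Set {w : InfinitePlace K // w.IsReal} → Prop) (𝔟 : Ideal (𝓞 K)) (u : (𝓞 K)ˣ) (ρ : 𝓞 K)
    (s : Set {w : InfinitePlace K // w.IsReal}) (a : 𝓞 K) : Prop :=
  ((∀ p ∈ S, ρ ∉ p.asIdeal ^ 2 ∧ C p ρ) ∧ T s) ∧ IsSelected 𝔟 a ∧ u * a - ρ ∈ sieveModulus S ∧
    signSet (mixedEmbedding K ((u * a : 𝓞 K) : K)) = s ∧ ¬ IsSquare ((u * a : 𝓞 K) : K)

theorem finite_coneCount (P : 𝓞 K → Prop) (X : ℝ) :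
    Finite {a : 𝓞 K // mixedEmbedding K a ∈ fundamentalCone K ∧ P a ∧
      (Ideal.absNorm (Ideal.span {a}) : ℝ) ≤ X} :=
  ((setOf_mem_cone_finite K X).subset fun _ ha => ⟨ha.1, ha.2.2⟩).to_subtype

theorem quadCount_mul_card_torsion (hS2 : ∀ p ∉ S, (2 : 𝓞 K) ∉ p.asIdeal)
    (hC : ∀ p ∈ S, IsLocalCondition p (C p))
    (hQ : ∀ α L, IsSqrt K α L → (Q L ↔ (∀ p ∈ S, C p α) ∧ T (signSet (mixedEmbedding K α))))
    (r : ClassReps K) (hr : ∀ c, IsCoprime (sieveModulus S) (r.rep c : Ideal (𝓞 K)))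
    [Fintype (UnitClasses K)] (x : ℝ) :
    quadCount K Q x * Nat.card (torsion K) =
      ∑ i : ClassGroup (𝓞 K) × UnitClasses K × (𝓞 K ⧸ sieveModulus S) ×
          Set {w : InfinitePlace K // w.IsReal},
        coneCount K (IsFamilyMember S C T (r.rep i.1) (Quotient.out i.2.1) (Quotient.out i.2.2.1)
          i.2.2.2) (x * discScale S (r.rep i.1) (Quotient.out i.2.2.1)) := by
  have := finite_coneCount (K := K)
  unfold quadCount coneCount
  rw [card_quadratic_mul_card_torsion r, ← Nat.card_sigma]
  symm
  refine Nat.card_congr (Equiv.ofBijective (fun y => ⟨(y.1.1, y.1.2.1, y.2.1), ?_, ?_⟩) ⟨?_, ?_⟩)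
  · exact ⟨y.2.2.1, y.2.2.2.1.2.1⟩
  · obtain ⟨⟨c, j, ρ, s⟩, a, ha, ⟨hg, hsel, hρ, hs, hsq⟩, hle⟩ := y
    refine (exists_isSqrt_iff hS2 hC hQ (r.rep_ne_bot c) (hr c) (hsel.unit_mul _) hρ x).2
      ⟨?_, hsq, ?_⟩
    · rw [hs]
      exact hg
    · rwa [absNorm_span_unit_mul]
  · rintro ⟨⟨c, j, ρ, s⟩, a, ha, ⟨hg, hsel, hρ, hs, hsq⟩, hle⟩
      ⟨⟨c', j', ρ', s'⟩, a', ha', ⟨hg', hsel', hρ', hs', hsq'⟩, hle'⟩ h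
    simp only [Subtype.mk.injEq, Prod.mk.injEq] at h
    obtain ⟨rfl, rfl, rfl⟩ := h
    dsimp only at hρ hρ' hs hs'
    obtain rfl : s = s' := hs.symm.trans hs'
    obtain rfl : ρ = ρ' := by
      rw [← Ideal.Quotient.eq] at hρ hρ'
      have := hρ.symm.trans hρ'
      rwa [show Ideal.Quotient.mk _ (Quotient.out ρ) = ρ from Quotient.out_eq _,
        show Ideal.Quotient.mk _ (Quotient.out ρ') = ρ' from Quotient.out_eq _] at this
    rfl
  · rintro ⟨⟨c, j, a⟩, ⟨ha, hsel⟩, hL⟩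
    have hρ : (Quotient.out j : (𝓞 K)ˣ) * a - Quotient.out (Ideal.Quotient.mk (sieveModulus S)
        ((Quotient.out j : (𝓞 K)ˣ) * a : 𝓞 K)) ∈ sieveModulus S := by
      have := neg_mem (out_mk_sub_mem (sieveModulus S) ((Quotient.out j : (𝓞 K)ˣ) * a : 𝓞 K))
      rwa [neg_sub] at this
    have h := (exists_isSqrt_iff hS2 hC hQ (r.rep_ne_bot c) (hr c) (hsel.unit_mul _) hρ x).1 hL
    rw [absNorm_span_unit_mul] at h
    exact ⟨⟨(c, j, _, _), a, ha, ⟨h.1, hsel, hρ, rfl, h.2.1⟩, h.2.2⟩, rfl⟩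

end Density

section Limit

open Module IsDedekindDomain mixedEmbedding fundamentalCone NumberField.Units

variable {K : Type*} [Field K] [NumberField K]

variable {S : Finset (HeightOneSpectrum (𝓞 K))} {C : HeightOneSpectrum (𝓞 K) → 𝓞 K → Prop}
  {T : Set {w : InfinitePlace K // w.IsReal} → Prop}
  {Q : IntermediateField K (AlgebraicClosure K) → Prop}

theorem sum_indicator_setOf_one {α : Type*} [Fintype α] (T : α → Prop) :
    ∑ s, {s | T s}.indicator (1 : α → ℝ) s = Nat.card {s // T s} := by
  simp [Set.indicator_apply, Fintype.card_subtype]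

omit [NumberField K] in
theorem isSelected_iff {𝔟 : Ideal (𝓞 K)} {a : 𝓞 K}
    (h : ∀ p ∈ S, a ∉ p.asIdeal ^ 2) :
    IsSelected 𝔟 a ↔ a ∈ 𝔟 ^ 2 ∧ ∀ q, q ∉ S → a ∉ 𝔟 ^ 2 * q.asIdeal ^ 2 :=
  ⟨fun h' => ⟨h'.1, fun q _ => h'.2 q⟩, fun h' => ⟨h'.1, fun q => by
    by_cases hq : q ∈ S
    · exact fun hmem => h q hq ((Ideal.mul_le_right : 𝔟 ^ 2 * q.asIdeal ^ 2 ≤ q.asIdeal ^ 2) hmem)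
    · exact h'.2 q hq⟩⟩

theorem tendsto_coneCount_isFamilyMember {κ : ℝ}
    (hκ : ∀ 𝔪 𝔟 : Ideal (𝓞 K), 𝔪 ≠ ⊥ → 𝔟 ≠ ⊥ → IsCoprime 𝔪 𝔟 →
      (∀ q, q ∉ S → IsCoprime 𝔪 q.asIdeal) → ∀ (r : 𝓞 K)
      (s : Set {w : InfinitePlace K // w.IsReal}),
      Tendsto (fun X : ℝ => (coneCount K (fun a => (a - r ∈ 𝔪 ∧
        signSet (mixedEmbedding K a) = s) ∧
        a ∈ 𝔟 ^ 2 ∧ ∀ q, q ∉ S → a ∉ 𝔟 ^ 2 * q.asIdeal ^ 2) X : ℝ) / X) atTop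
        (𝓝 (κ / (Ideal.absNorm 𝔪 * Ideal.absNorm 𝔟 ^ 2))))
    {𝔟 : Ideal (𝓞 K)} (h𝔟 : 𝔟 ≠ ⊥) (hco : IsCoprime (sieveModulus S) 𝔟) (u : (𝓞 K)ˣ) (ρ : 𝓞 K)
    (s : Set {w : InfinitePlace K // w.IsReal}) :
    Tendsto (fun X : ℝ => (coneCount K (IsFamilyMember S C T 𝔟 u ρ s) X : ℝ) / X) atTop
      (𝓝 (if (∀ p ∈ S, ρ ∉ p.asIdeal ^ 2 ∧ C p ρ) ∧ T s then
        κ / (Ideal.absNorm (sieveModulus S) * Ideal.absNorm 𝔟 ^ 2) else 0)) := by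
  split_ifs with hg
  · refine tendsto_coneCount_of_finite
      (setOf_mem_cone_finite K ((Ideal.absNorm 𝔟 ^ 2 : ℕ) : ℝ)) (fun a ha h => ?_) (fun a ha haF h => ?_)
      (hκ _ 𝔟 (sieveModulus_ne_bot S) h𝔟 hco (fun q hq => isCoprime_sieveModulus S hq)
        (↑u⁻¹ * ρ) (signTwist u s))
    · obtain ⟨-, hsel, hρ, hs, -⟩ := h
      refine ⟨⟨?_, (signSet_unit_mul_eq_iff u ha s).1 hs⟩, hsel.1, fun q _ => hsel.2 q⟩
      have := Ideal.mul_mem_left _ (↑u⁻¹ : 𝓞 K) hρ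
      rwa [mul_sub, ← mul_assoc, Units.inv_mul, one_mul] at this
    · obtain ⟨⟨hρ, hs⟩, hsel⟩ := h
      have hρ' : (u : 𝓞 K) * a - ρ ∈ sieveModulus S := by
        have := Ideal.mul_mem_left _ (u : 𝓞 K) hρ
        rwa [mul_sub, ← mul_assoc, Units.mul_inv, one_mul] at this
      have ha2 : ∀ p ∈ S, a ∉ p.asIdeal ^ 2 := fun p hp hmem => by
        have := neg_mem (sieveModulus_le hp hρ')
        rw [neg_sub] at this
        exact notMem_sq_of_sub_mem p this (hg.1 p hp).1 (Ideal.mul_mem_left _ _ hmem)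
      have hsel' : IsSelected 𝔟 a := (isSelected_iff ha2).2 hsel
      refine ⟨hg, hsel', hρ', (signSet_unit_mul_eq_iff u ha s).2 hs, fun hsq => haF ⟨ha, ?_⟩⟩
      have h0 : (u * a : 𝓞 K) ≠ 0 := mul_ne_zero u.ne_zero (int_ne_zero_of_mem_cone K ha)
      rw [← absNorm_span_unit_mul u, (hsel'.unit_mul u).absNorm_of_isSquare h𝔟 h0 hsq]
  · refine tendsto_const_nhds.congr fun X => ?_
    have : IsEmpty {a : 𝓞 K // mixedEmbedding K a ∈ fundamentalCone K ∧
        IsFamilyMember S C T 𝔟 u ρ s a ∧ (Ideal.absNorm (Ideal.span {a}) : ℝ) ≤ X} :=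
      ⟨fun a => hg a.2.2.1.1⟩
    rw [coneCount, Nat.card_of_isEmpty, Nat.cast_zero, zero_div]

theorem mul_discScale_eq {κ : ℝ} {𝔟 : Ideal (𝓞 K)} (h𝔟 : 𝔟 ≠ ⊥) (ρ : 𝓞 K)
    (s : Set {w : InfinitePlace K // w.IsReal}) :
    (if (∀ p ∈ S, ρ ∉ p.asIdeal ^ 2 ∧ C p ρ) ∧ T s then
        κ / (Ideal.absNorm (sieveModulus S) * Ideal.absNorm 𝔟 ^ 2) else 0) * discScale S 𝔟 ρ =
      κ / Ideal.absNorm (sieveModulus S) *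
        ((∏ p ∈ S, localWeight p (C p) ρ) * {s | T s}.indicator 1 s) := by
  by_cases h : ∀ p ∈ S, ρ ∉ p.asIdeal ^ 2 ∧ C p ρ
  · have hw : ∏ p ∈ S, localWeight p (C p) ρ =
        ∏ p ∈ S, (Ideal.absNorm p.asIdeal : ℝ) ^ ordAt p (Ideal.span {ρ}) /
          (Ideal.absNorm p.asIdeal : ℝ) ^ discExp p ρ :=
      Finset.prod_congr rfl fun p hp => if_pos (h p hp)
    have hb : (Ideal.absNorm 𝔟 : ℝ) ≠ 0 :=
      Nat.cast_ne_zero.2 fun h0 => h𝔟 (Ideal.absNorm_eq_zero_iff.1 h0)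
    rw [hw, discScale]
    by_cases hT : T s
    · rw [if_pos ⟨h, hT⟩, Set.indicator_of_mem (s := {s | T s}) hT, Pi.one_apply]
      field_simp
    · rw [if_neg fun h' => hT h'.2, Set.indicator_of_notMem (s := {s | T s}) hT]
      simp
  · have hw : ∏ p ∈ S, localWeight p (C p) ρ = 0 := by
      push Not at h
      obtain ⟨p, hp, hn⟩ := h
      exact Finset.prod_eq_zero hp (if_neg fun h' => hn h'.1 h'.2)
    rw [hw, if_neg fun h' => h h'.1]
    simp

theorem exists_tendsto_quadCount (hS2 : ∀ p ∉ S, (2 : 𝓞 K) ∉ p.asIdeal) :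
    ∃ κ : ℝ, κ ≠ 0 ∧ ∀ (C : HeightOneSpectrum (𝓞 K) → 𝓞 K → Prop)
      (T : Set {w : InfinitePlace K // w.IsReal} → Prop)
      (Q : IntermediateField K (AlgebraicClosure K) → Prop),
      (∀ p ∈ S, IsLocalCondition p (C p)) →
      (∀ α L, IsSqrt K α L → (Q L ↔ (∀ p ∈ S, C p α) ∧ T (signSet (mixedEmbedding K α)))) →
      Tendsto (fun x : ℝ => (quadCount K Q x : ℝ) / x) atTop
        (𝓝 (κ * ((∏ p ∈ S, localMass p (C p)) * Nat.card {s // T s}))) := by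
  obtain ⟨κ, hκ0, hκ⟩ := tendsto_sieve K S
  obtain ⟨r, hr⟩ := exists_classReps_isCoprime (sieveModulus_ne_bot S)
  have := Fintype.ofFinite (UnitClasses K)
  have ht : (Nat.card (torsion K) : ℝ) ≠ 0 := Nat.cast_ne_zero.2 Nat.card_pos.ne'
  have hN : (Ideal.absNorm (sieveModulus S) : ℝ) ≠ 0 :=
    Nat.cast_ne_zero.2 fun h0 => sieveModulus_ne_bot S (Ideal.absNorm_eq_zero_iff.1 h0)
  refine ⟨κ / Ideal.absNorm (sieveModulus S) * Nat.card (ClassGroup (𝓞 K)) *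
    Nat.card (UnitClasses K) / Nat.card (torsion K), ?_, fun C T Q hC hQ => ?_⟩
  · have h1 : (Nat.card (ClassGroup (𝓞 K)) : ℝ) ≠ 0 := Nat.cast_ne_zero.2 Nat.card_pos.ne'
    have h2 : (Nat.card (UnitClasses K) : ℝ) ≠ 0 := Nat.cast_ne_zero.2 Nat.card_pos.ne'
    exact div_ne_zero (mul_ne_zero (mul_ne_zero (div_ne_zero hκ0 hN) h1) h2) ht
  have hlim : ∀ i : ClassGroup (𝓞 K) × UnitClasses K × (𝓞 K ⧸ sieveModulus S) ×
      Set {w : InfinitePlace K // w.IsReal},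
      Tendsto (fun x : ℝ => (coneCount K (IsFamilyMember S C T (r.rep i.1) (Quotient.out i.2.1)
        (Quotient.out i.2.2.1) i.2.2.2)
          (x * discScale S (r.rep i.1) (Quotient.out i.2.2.1)) : ℝ) / x) atTop
        (𝓝 (κ / Ideal.absNorm (sieveModulus S) * ((∏ p ∈ S, localWeight p (C p)
          (Quotient.out i.2.2.1)) * {s | T s}.indicator 1 i.2.2.2))) := by
    rintro ⟨c, j, ρ, s⟩
    dsimp only
    have hpos : 0 < discScale S (r.rep c : Ideal (𝓞 K)) (Quotient.out ρ) :=
      discScale_pos (r.rep_ne_bot c) _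
    rw [← mul_discScale_eq (r.rep_ne_bot c)]
    have h := (tendsto_coneCount_isFamilyMember (C := C) (T := T) hκ (r.rep_ne_bot c) (hr c)
      (Quotient.out j) (Quotient.out ρ) s).comp (tendsto_id.atTop_mul_const hpos)
    refine (h.mul_const (discScale S (r.rep c : Ideal (𝓞 K)) (Quotient.out ρ))).congr fun x => ?_
    simp only [Function.comp_apply, id]
    rw [div_mul_eq_mul_div, mul_div_mul_right _ _ hpos.ne']
  have hsum := (tendsto_finsetSum Finset.univ fun i _ => hlim i).div_const
    (Nat.card (torsion K) : ℝ)
  refine (hsum.congr fun x => ?_).trans_eq ?_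
  · rw [← Finset.sum_div, ← Nat.cast_sum, ← quadCount_mul_card_torsion hS2 hC hQ r hr, Nat.cast_mul]
    field_simp
  · rw [← Finset.mul_sum]
    simp only [Fintype.sum_prod_type, Finset.sum_const, Finset.card_univ, nsmul_eq_mul,
      ← Nat.card_eq_fintype_card]
    rw [← Finset.sum_mul_sum, sum_prod_localWeight hC]
    rw [sum_indicator_setOf_one]
    congr 1
    ring

end Limit

section Independence

open Module IsDedekindDomain mixedEmbedding InfinitePlace

variable {K : Type*} [Field K] [NumberField K]

/-- The real place of a real embedding. -/
def realPlace (σ : K →+* ℝ) : {w : InfinitePlace K // w.IsReal} :=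
  ⟨mk (Complex.ofRealHom.comp σ), isReal_mk_iff.2 <| by
    rw [ComplexEmbedding.isReal_iff]
    ext x
    simp⟩

omit [NumberField K] in
theorem embedding_realPlace (σ : K →+* ℝ) :
    (realPlace σ).1.embedding = Complex.ofRealHom.comp σ := by
  refine embedding_mk_eq_of_isReal ?_
  rw [ComplexEmbedding.isReal_iff]
  ext x
  simp

omit [NumberField K] in
theorem realPlace_injective : Function.Injective (realPlace (K := K)) := by
  intro σ τ h
  have := (embedding_realPlace σ).symm.trans ((congrArg (·.1.embedding) h).trans (embedding_realPlace τ))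
  ext x
  exact Complex.ofReal_injective (RingHom.congr_fun this x)

omit [NumberField K] in
theorem realPlace_mem_signSet_iff (σ : K →+* ℝ) (a : K) :
    realPlace σ ∈ signSet (mixedEmbedding K a) ↔ σ a ≤ 0 := by
  have h : ((mixedEmbedding K a).1 (realPlace σ) : ℂ) = σ a := by
    rw [mixedEmbedding_apply_isReal, embedding_of_isReal_apply, embedding_realPlace]
    rfl
  rw [signSet, Set.mem_ofPred_eq, Complex.ofReal_injective h]

theorem card_sets_prescribed_mul {W : Type*} [Finite W] (F : Finset W) (A : W → Prop) :
    Nat.card {s : Set W // ∀ w ∈ F, (w ∈ s ↔ A w)} * 2 ^ F.card = Nat.card (Set W) := by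
  have := Fintype.ofFinite W
  have e : {s : Set W // ∀ w ∈ F, (w ∈ s ↔ A w)} ≃ Set {w // w ∉ F} :=
    { toFun s := {w | w.1 ∈ s.1}
      invFun t := ⟨{w | if h : w ∈ F then A w else ⟨w, h⟩ ∈ t}, fun w hw => by simp [hw]⟩
      left_inv s := by
        ext w
        by_cases hw : w ∈ F
        · simp [hw, s.2 w hw]
        · simp [hw]
      right_inv t := by
        ext w
        simp [w.2] }
  rw [Nat.card_congr e, Nat.card_eq_fintype_card, Nat.card_eq_fintype_card, Fintype.card_set,
    Fintype.card_set, ← pow_add, Fintype.card_subtype_compl, Fintype.card_coe,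
    Nat.sub_add_cancel (Finset.card_le_univ F)]

/-- The condition on an integer describing the behaviour of a prime in the quadratic extension
generated by its square root. -/
def FiniteBehavior.localCondition (b : FiniteBehavior) (p : HeightOneSpectrum (𝓞 K)) (a : 𝓞 K) :
    Prop :=
  match b with
  | .ramified => ¬ HasLocalRoot p a ∧ ¬ HasLocalInert p a
  | .split => HasLocalRoot p a
  | .inert => HasLocalInert p a

theorem FiniteBehavior.isLocalCondition (b : FiniteBehavior) (p : HeightOneSpectrum (𝓞 K)) :
    IsLocalCondition p (b.localCondition p) := by
  cases b
  · exact (isLocalCondition_hasLocalRoot p).not_and_not (isLocalCondition_hasLocalInert p)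
  · exact isLocalCondition_hasLocalRoot p
  · exact isLocalCondition_hasLocalInert p

theorem IsSqrt.holds_iff {α : 𝓞 K} {L : IntermediateField K (AlgebraicClosure K)}
    (h : IsSqrt K α L) (b : FiniteBehavior) (p : HeightOneSpectrum (𝓞 K)) :
    b.holds K p.asIdeal L ↔ b.localCondition p α := by
  cases b
  · exact (ramifiesIn_iff h.1 p).trans (and_congr (not_congr (h.splitsIn_iff p))
      (not_congr (h.inertIn_iff p)))
  · exact h.splitsIn_iff p
  · exact h.inertIn_iff p

theorem IsSqrt.real_holds_iff {α : 𝓞 K} {L : IntermediateField K (AlgebraicClosure K)}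
    (h : IsSqrt K α L) (b : RealBehavior) (σ : K →+* ℝ) :
    b.holds K σ L ↔ (realPlace σ ∈ signSet (mixedEmbedding K α) ↔ b = .ramified) := by
  rw [realPlace_mem_signSet_iff, ← not_lt, ← h.realSplitsIn_iff σ]
  cases b
  · simp [RealBehavior.holds, RealRamifiesIn]
  · simp [RealBehavior.holds]

/-- The density of quadratic extensions with a given behaviour at a prime. -/
def localProb (p : HeightOneSpectrum (𝓞 K)) (b : FiniteBehavior) : ℝ :=
  localMass p (b.localCondition p) / localMass p fun _ => True

theorem hasProb_holds (F : Finset (HeightOneSpectrum (𝓞 K))) (R : Finset (K →+* ℝ))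
    (b : HeightOneSpectrum (𝓞 K) → FiniteBehavior) (b' : (K →+* ℝ) → RealBehavior) :
    HasProb K (fun L => (∀ p ∈ F, (b p).holds K p.asIdeal L) ∧ ∀ σ ∈ R, (b' σ).holds K σ L)
      ((∏ p ∈ F, localProb p (b p)) * (1 / 2) ^ R.card) := by
  have hfin : {p : HeightOneSpectrum (𝓞 K) | p.asIdeal ∣ Ideal.span {2}}.Finite :=
    Ideal.finite_factors (by simp)
  set S := F ∪ hfin.toFinset with hS
  have hS2 : ∀ p ∉ S, (2 : 𝓞 K) ∉ p.asIdeal := fun p hp h2 => hp <| by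
    simp [hS, Ideal.dvd_span_singleton, h2]
  obtain ⟨κ, hκ, hlim⟩ := exists_tendsto_quadCount hS2
  set C : HeightOneSpectrum (𝓞 K) → 𝓞 K → Prop := fun p a => p ∈ F → (b p).localCondition p a
    with hC
  have hCF : ∀ p ∈ F, C p = (b p).localCondition p := fun p hp => by simp [hC, hp]
  have hCn : ∀ p ∉ F, C p = fun _ => True := fun p hp => by simp [hC, hp]
  set T : Set {w : InfinitePlace K // w.IsReal} → Prop := fun s =>
    ∀ w ∈ R.image realPlace, (w ∈ s ↔ ∃ σ, realPlace σ = w ∧ b' σ = .ramified) with hT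
  have h1 := hlim C T (fun L => (∀ p ∈ F, (b p).holds K p.asIdeal L) ∧
    ∀ σ ∈ R, (b' σ).holds K σ L) (fun p _ => by
      by_cases hp : p ∈ F
      · rw [hCF p hp]
        exact (b p).isLocalCondition p
      · rw [hCn p hp]
        exact isLocalCondition_true p) fun α L h => by
      refine and_congr ⟨fun hp p _ hpF => (h.holds_iff _ _).1 (hp p hpF), fun hp p hpF =>
        (h.holds_iff _ _).2 (hp p (Finset.mem_union_left _ hpF) hpF)⟩ ?_
      simp only [hT, Finset.forall_mem_image]
      refine forall₂_congr fun σ _ => ?_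
      rw [h.real_holds_iff]
      refine iff_congr Iff.rfl ⟨fun hb => ⟨σ, rfl, hb⟩, ?_⟩
      rintro ⟨τ, hτ, hb⟩
      rwa [← realPlace_injective hτ]
  have h2 := hlim (fun _ _ => True) (fun _ => True) (fun _ => True)
    (fun p _ => isLocalCondition_true p) fun α L h => by simp
  have hm : (∏ p ∈ S, localMass p fun _ => True) ≠ 0 :=
    Finset.prod_ne_zero_iff.2 fun p _ => (localMass_true_pos p).ne'
  have hcT : (Nat.card {s // T s} : ℝ) * 2 ^ R.card =
      Nat.card (Set {w : InfinitePlace K // w.IsReal}) := by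
    rw [← Finset.card_image_of_injective R realPlace_injective]
    exact_mod_cast card_sets_prescribed_mul _ _
  have hc0 : (Nat.card (Set {w : InfinitePlace K // w.IsReal}) : ℝ) ≠ 0 :=
    Nat.cast_ne_zero.2 Nat.card_pos.ne'
  rw [Nat.card_congr (Equiv.subtypeUnivEquiv fun _ => trivial)] at h2
  have hprod : (∏ p ∈ F, localProb p (b p)) =
      (∏ p ∈ S, localMass p (C p)) / ∏ p ∈ S, localMass p fun _ => True := by
    rw [← Finset.prod_div_distrib]
    rw [← Finset.prod_subset (Finset.subset_union_left : F ⊆ S) fun p _ hp => ?_]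
    · exact Finset.prod_congr rfl fun p hp => by rw [hCF p hp, localProb]
    · rw [hCn p hp, div_self (localMass_true_pos p).ne']
  refine ((h1.div h2 (mul_ne_zero hκ (mul_ne_zero hm hc0))).congr' ?_).trans_eq ?_
  · filter_upwards [eventually_ne_atTop 0] with x hx
    exact div_div_div_cancel_right₀ hx _ _
  · congr 1
    rw [hprod, ← hcT, one_div, inv_pow]
    rw [← hcT] at hc0
    have := left_ne_zero_of_mul hc0
    field_simp

theorem HasProb.eq {P : IntermediateField K (AlgebraicClosure K) → Prop} {c c' : ℝ}
    (h : HasProb K P c) (h' : HasProb K P c') : c = c' :=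
  tendsto_nhds_unique h h'

theorem hasProb_true : HasProb K (fun _ => True) 1 := by
  simpa using hasProb_holds (K := K) ∅ ∅ (fun _ => .split) fun _ => .split

theorem hasProb_finite (p : HeightOneSpectrum (𝓞 K)) (b : FiniteBehavior) :
    HasProb K (fun L => b.holds K p.asIdeal L) (localProb p b) := by
  simpa using hasProb_holds {p} ∅ (fun _ => b) fun _ => .split

theorem hasProb_real (σ : K →+* ℝ) (b : RealBehavior) :
    HasProb K (fun L => b.holds K σ L) (1 / 2) := by
  simpa using hasProb_holds ∅ {σ} (fun _ => .split) fun _ => b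

theorem quadCount_add {P P' : IntermediateField K (AlgebraicClosure K) → Prop} {x : ℝ}
    (hx : quadCount K (fun _ => True) x ≠ 0)
    (h : ∀ L : IntermediateField K (AlgebraicClosure K), finrank K L = 2 → ¬ (P L ∧ P' L)) :
    quadCount K (fun L => P L ∨ P' L) x = quadCount K P x + quadCount K P' x := by
  let A (P : IntermediateField K (AlgebraicClosure K) → Prop) :
      Set (IntermediateField K (AlgebraicClosure K)) :=
    {L | finrank K L = 2 ∧ P L ∧ relDiscNorm K L ≤ x}
  have hfin : (A fun _ => True).Finite := Nat.finite_of_card_ne_zero hx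
  have hunion : A (fun L => P L ∨ P' L) = A P ∪ A P' := by
    ext L
    simp only [A, Set.mem_ofPred_eq, Set.mem_union]
    tauto
  have := Set.ncard_union_eq (s := A P) (t := A P')
    (Set.disjoint_left.2 fun L hL hL' => h L hL.1 ⟨hL.2.1, hL'.2.1⟩)
    (hfin.subset fun L hL => ⟨hL.1, trivial, hL.2.2⟩)
    (hfin.subset fun L hL => ⟨hL.1, trivial, hL.2.2⟩)
  rw [← hunion] at this
  exact this

theorem HasProb.or {P P' : IntermediateField K (AlgebraicClosure K) → Prop} {c c' : ℝ}
    (hP : HasProb K P c) (hP' : HasProb K P' c')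
    (h : ∀ L : IntermediateField K (AlgebraicClosure K), finrank K L = 2 → ¬ (P L ∧ P' L)) :
    HasProb K (fun L => P L ∨ P' L) (c + c') := by
  refine (Tendsto.add hP hP').congr' ?_
  filter_upwards [(hasProb_true (K := K)).eventually_ne one_ne_zero] with x hx
  rw [quadCount_add (fun h0 => hx (by simp [h0])) h, Nat.cast_add, add_div]

theorem HasProb.congr {P P' : IntermediateField K (AlgebraicClosure K) → Prop} {c : ℝ}
    (hP : HasProb K P c)
    (h : ∀ L : IntermediateField K (AlgebraicClosure K), finrank K L = 2 → (P L ↔ P' L)) :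
    HasProb K P' c := by
  refine Tendsto.congr (fun x => ?_) hP
  congr 2
  exact Nat.card_congr (Equiv.subtypeEquivRight fun L => and_congr_right fun hL =>
    and_congr (h L hL) Iff.rfl)

theorem localProb_inert (p : HeightOneSpectrum (𝓞 K)) :
    localProb p .inert = localProb p .split := by
  unfold localProb
  congr 1
  exact (localMass_hasLocalRoot_eq p).symm

theorem localProb_add_add (p : HeightOneSpectrum (𝓞 K)) :
    localProb p .ramified + (localProb p .split + localProb p .inert) = 1 := by
  have hsi := HasProb.or (hasProb_finite p .split) (hasProb_finite p .inert)
    fun L hL => not_splitsIn_and_inertIn hL p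
  have hall := HasProb.or (hasProb_finite p .ramified) hsi fun L hL h =>
    absurd h.2 (not_or.2 ((ramifiesIn_iff hL p).1 h.1))
  refine HasProb.eq (hall.congr (P' := fun _ => True) fun L hL => iff_true_intro ?_) hasProb_true
  have : RamifiesIn K p.asIdeal L ∨ SplitsIn K p.asIdeal L ∨ InertIn K p.asIdeal L := by
    rw [ramifiesIn_iff hL p]
    tauto
  exact this

omit [NumberField K] in
theorem exists_eq_image_asIdeal {F : Finset (Ideal (𝓞 K))} (hF : ∀ p ∈ F, p.IsPrime ∧ p ≠ ⊥) :
    ∃ F' : Finset (HeightOneSpectrum (𝓞 K)), F = F'.image HeightOneSpectrum.asIdeal := by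
  refine ⟨F.attach.image fun p => ⟨p.1, (hF p.1 p.2).1, (hF p.1 p.2).2⟩, ?_⟩
  ext p
  simp only [Finset.mem_image, Finset.mem_attach, true_and, Subtype.exists]
  constructor
  · exact fun hp => ⟨_, ⟨p, hp, rfl⟩, rfl⟩
  · rintro ⟨_, ⟨q, hq, rfl⟩, rfl⟩
    exact hq

end Independence

/-- **Wood's theorem** on splitting densities for quadratic extensions of a number
field ordered by discriminant: the individual probabilities exist (i), the events at
the finitely many prescribed places are independent (ii), real places ramify and split
each with probability `1/2` (iii), and at a finite prime splitting and inertness each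
have probability `(1 - Prob(ramified))/2` (iv). -/
theorem wood_independence
    (Sf : Finset (Ideal (𝓞 k))) (hSf : ∀ p ∈ Sf, p.IsPrime ∧ p ≠ ⊥)
    (Sr : Finset (k →+* ℝ))
    (bf : Ideal (𝓞 k) → FiniteBehavior) (br : (k →+* ℝ) → RealBehavior) :
    (∃ (Pf : Ideal (𝓞 k) → ℝ) (Pr : (k →+* ℝ) → ℝ),
      (∀ p ∈ Sf, HasProb k (fun L => (bf p).holds k p L) (Pf p)) ∧
      (∀ σ ∈ Sr, HasProb k (fun L => (br σ).holds k σ L) (Pr σ)) ∧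
      HasProb k
        (fun L => (∀ p ∈ Sf, (bf p).holds k p L) ∧ (∀ σ ∈ Sr, (br σ).holds k σ L))
        ((∏ p ∈ Sf, Pf p) * ∏ σ ∈ Sr, Pr σ)) ∧
    (∀ σ ∈ Sr, HasProb k (RealRamifiesIn k σ) (1 / 2) ∧
      HasProb k (RealSplitsIn k σ) (1 / 2)) ∧
    (∀ p ∈ Sf, ∃ cram : ℝ, HasProb k (RamifiesIn k p) cram ∧
      HasProb k (SplitsIn k p) ((1 - cram) / 2) ∧
      HasProb k (InertIn k p) ((1 - cram) / 2)) := by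
  obtain ⟨F, rfl⟩ := exists_eq_image_asIdeal hSf
  set Pf : Ideal (𝓞 k) → ℝ :=
    fun p => if h : p.IsPrime ∧ p ≠ ⊥ then localProb ⟨p, h.1, h.2⟩ (bf p) else 0
  have hPf : ∀ p : IsDedekindDomain.HeightOneSpectrum (𝓞 k),
      Pf p.asIdeal = localProb p (bf p.asIdeal) := fun p => dif_pos ⟨p.isPrime, p.ne_bot⟩
  refine ⟨⟨Pf, fun _ => 1 / 2, ?_, fun σ _ => hasProb_real σ (br σ), ?_⟩,
    fun σ _ => ⟨hasProb_real σ .ramified, hasProb_real σ .split⟩, ?_⟩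
  · rw [Finset.forall_mem_image]
    intro p _
    rw [hPf]
    exact hasProb_finite p (bf p.asIdeal)
  · simp only [Finset.forall_mem_image, Finset.prod_const]
    rw [Finset.prod_image fun p _ q _ => IsDedekindDomain.HeightOneSpectrum.ext,
      Finset.prod_congr rfl fun p _ => hPf p]
    exact hasProb_holds F Sr (fun p => bf p.asIdeal) br
  · rw [Finset.forall_mem_image]
    intro p _
    have h1 := localProb_add_add p
    have h2 := localProb_inert p
    have h3 : (1 - localProb p .ramified) / 2 = localProb p .split := by linarith
    refine ⟨localProb p .ramified, hasProb_finite p .ramified, ?_, ?_⟩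
    · rw [h3]
      exact hasProb_finite p .split
    · rw [h3, ← h2]
      exact hasProb_finite p .inert

end
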